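/- arXiv:2010.11519 — 2 statements merged into one kernel-verified Lean document; each statement's English description precedes it below -/
import Mathlib

section
/- (Fully discrete, upper bound.) Assume (δ_N)_N, (ε_N)_N → 0, μ⁰_N → μ⁰ narrowly, τ_N = o(ε_N), W₂²(μ⁰_N, μ⁰) = o(ε_N), and additionally δ_N^{2/r'} = o(ε_N) where r' = r/(r−1). Then for every sequence (Q_N)_N, where Q_N minimizes the fully discrete problem (M_{N, μ⁰_N, δ_N, ε_N}), one has limsup_{N→∞} J_{δ_N, ε_N}(Q_N) ≤ J(Q_min). -/
open MeasureTheory Filter Topology Set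
open scoped ENNReal NNReal

noncomputable section

abbrev Euc (d : ℕ) : Type := EuclideanSpace ℝ (Fin d)

abbrev Traj (d : ℕ) (T : ℝ) : Type := C(Set.Icc (0:ℝ) T, Euc d)

instance (d : ℕ) (T : ℝ) : MeasurableSpace (Traj d T) := borel _
instance (d : ℕ) (T : ℝ) : BorelSpace (Traj d T) := ⟨rfl⟩

/-- evaluation of a trajectory at time `t ∈ ℝ` (projected onto `[0,T]`). -/
def evalAt {d : ℕ} {T : ℝ} (hT : 0 ≤ T) (t : ℝ) (γ : Traj d T) : Euc d :=
  γ (Set.projIcc 0 T hT t)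

/-- Narrow convergence of a sequence of measures. -/
def NarrowTendsto {X : Type*} [TopologicalSpace X] [MeasurableSpace X]
    (μ : ℕ → Measure X) (ν : Measure X) : Prop :=
  ∀ f : BoundedContinuousFunction X ℝ,
    Tendsto (fun n => ∫ x, f x ∂(μ n)) atTop (𝓝 (∫ x, f x ∂ν))

/-- Squared 2-Wasserstein distance. -/
def W2sq {X : Type*} [MeasurableSpace X] [PseudoMetricSpace X]
    (μ ν : Measure X) : ℝ≥0∞ :=
  ⨅ (π : Measure (X × X)) (_ : π.map Prod.fst = μ ∧ π.map Prod.snd = ν),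
    ∫⁻ p, ENNReal.ofReal (dist p.1 p.2 ^ 2) ∂π

/-- Uniform discrete probability measures on `N` points. -/
def IsUnifDiscrete {X : Type*} [MeasurableSpace X] (N : ℕ) (μ : Measure X) : Prop :=
  ∃ x : Fin N → X, μ = ((N : ℝ≥0∞))⁻¹ • ∑ i, MeasureTheory.Measure.dirac (x i)

/-- Shifted (by `+C`) kinetic action: equals `∫₀ᵀ (L(γ'(t)) + C) dt` if `γ ∈ W^{1,r}`,
`+∞` otherwise. -/
def actionN {d : ℕ} {T : ℝ} (L : Euc d → ℝ) (C : ℝ) (γ : Traj d T) : ℝ≥0∞ :=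
  sInf { a : ℝ≥0∞ | ∃ g : ℝ → Euc d, IntervalIntegrable g volume 0 T ∧
      (∀ s t : Set.Icc (0:ℝ) T, γ t - γ s = ∫ u in (s:ℝ)..(t:ℝ), g u) ∧
      a = ∫⁻ t in Set.Ioc (0:ℝ) T, ENNReal.ofReal (L (g t) + C) }

/-- Kinetic part of the energy: `∫_Γ L(γ) dQ(γ)`. -/
def kinE {d : ℕ} {T : ℝ} (L : Euc d → ℝ) (C : ℝ) (Q : Measure (Traj d T)) : EReal :=
  ((∫⁻ γ, actionN L C γ ∂Q : ℝ≥0∞) : EReal) - ((C * T : ℝ) : EReal)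

/-- The mean-field game energy `J`. -/
def Jfun {d : ℕ} {T : ℝ} (hT : 0 ≤ T) (L : Euc d → ℝ) (C : ℝ)
    (F : Measure (Euc d) → ℝ≥0∞) (G : Measure (Traj d T) → ℝ)
    (Q : Measure (Traj d T)) : EReal :=
  kinE L C Q
    + ((∫⁻ t in Set.Ioc (0:ℝ) T, F (Q.map (evalAt hT t)) : ℝ≥0∞) : EReal)
    + ((G Q : ℝ) : EReal)

/-- Moreau envelope of `F` with parameter `ε` in the 2-Wasserstein space. -/
def moreau {d : ℕ} (Ω : Set (Euc d)) (F : Measure (Euc d) → ℝ≥0∞) (ε : ℝ)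
    (μ : Measure (Euc d)) : ℝ≥0∞ :=
  ⨅ (ρ : Measure (Euc d)) (_ : IsProbabilityMeasure ρ ∧ ρ Ωᶜ = 0),
    W2sq μ ρ / ENNReal.ofReal (2 * ε) + F ρ

/-- The regularized energy `J_ε`. -/
def Jeps {d : ℕ} {T : ℝ} (hT : 0 ≤ T) (Ω : Set (Euc d)) (L : Euc d → ℝ) (C : ℝ)
    (F : Measure (Euc d) → ℝ≥0∞) (G : Measure (Traj d T) → ℝ) (ε : ℝ)
    (Q : Measure (Traj d T)) : EReal :=
  kinE L C Q
    + ((∫⁻ t in Set.Ioc (0:ℝ) T, moreau Ω F ε (Q.map (evalAt hT t)) : ℝ≥0∞) : EReal)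
    + ((G Q : ℝ) : EReal)

end

noncomputable section

/-- The fully time-discretized energy `J_{δ,ε}`, for the uniform grid
`0, δ, …, Mδ = T`. -/
def Jde {d : ℕ} {T : ℝ} (hT : 0 ≤ T) (Ω : Set (Euc d)) (L : Euc d → ℝ) (C : ℝ)
    (F : Measure (Euc d) → ℝ≥0∞) (G : Measure (Traj d T) → ℝ) (δ ε : ℝ) (M : ℕ)
    (Q : Measure (Traj d T)) : EReal :=
  kinE L C Q
    + ((ENNReal.ofReal δ *
        ∑ i ∈ Finset.Ico 1 M, moreau Ω F ε (Q.map (evalAt hT (i * δ))) : ℝ≥0∞) : EReal)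
    + ((G Q : ℝ) : EReal)

/-- A trajectory which is affine on each interval `[iδ, (i+1)δ]`, `i = 0, …, M−1`. -/
def PiecewiseAffine {d : ℕ} {T : ℝ} (hT : 0 ≤ T) (δ : ℝ) (M : ℕ) (γ : Traj d T) : Prop :=
  ∀ i : ℕ, i < M → ∀ a ∈ Set.Icc (0:ℝ) 1,
    evalAt hT ((1 - a) * (i * δ) + a * ((i + 1) * δ)) γ
      = (1 - a) • evalAt hT (i * δ) γ + a • evalAt hT ((i + 1) * δ) γ

/-- Uniform discrete measures on `N` piecewise-affine trajectories: `P_N(Γ^lin_δ)`. -/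
def IsUnifDiscreteAffine {d : ℕ} {T : ℝ} (hT : 0 ≤ T) (N : ℕ) (δ : ℝ) (M : ℕ)
    (Q : Measure (Traj d T)) : Prop :=
  ∃ x : Fin N → Traj d T, (∀ i, PiecewiseAffine hT δ M (x i)) ∧
    Q = ((N : ℝ≥0∞))⁻¹ • ∑ i, MeasureTheory.Measure.dirac (x i)

end


open MeasureTheory Filter Topology Set
open scoped ENNReal NNReal
set_option linter.all false

theorem pieces_exist {X Y : Type*} [MeasurableSpace X] [MeasurableSingletonClass X]
    [MeasurableSpace Y] {N : ℕ} (x : Fin N → X) (π : Measure (X × Y))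
    (hπ : π.map Prod.fst = ((N : ℝ≥0∞))⁻¹ • ∑ i, Measure.dirac (x i)) :
    ∃ ν : Fin N → Measure Y, (∀ i, ν i univ = (N : ℝ≥0∞)⁻¹) ∧ (∑ i, ν i = π.map Prod.snd) ∧
      ∀ c : X × Y → ℝ≥0∞, Measurable c → ∑ i, ∫⁻ y, c (x i, y) ∂(ν i) = ∫⁻ p, c p ∂π := by
  classical
  let m : X → ℕ := fun p => (Finset.univ.filter (fun j => x j = p)).card
  have hm : ∀ i, m (x i) ≠ 0 := fun i => by
    simp only [m, ne_eq, Finset.card_eq_zero, Finset.filter_eq_empty_iff]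
    push Not
    exact ⟨i, by simp⟩
  let S : X → Set (X × Y) := fun p => Prod.fst ⁻¹' {p}
  have hS : ∀ p, MeasurableSet (S p) := fun p => measurable_fst (measurableSet_singleton p)
  have hπS : ∀ p, π (S p) = (N : ℝ≥0∞)⁻¹ * m p := by
    intro p
    have : π (S p) = π.map Prod.fst {p} := by
      rw [Measure.map_apply measurable_fst (measurableSet_singleton p)]
    rw [this, hπ]
    simp only [Measure.smul_apply, Measure.coe_finsetSum, Finset.sum_apply, smul_eq_mul,
      Measure.dirac_apply' _ (measurableSet_singleton p), m]
    congr 1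
    rw [Finset.card_filter]
    push_cast
    refine Finset.sum_congr rfl fun i _ => ?_
    simp [Set.indicator]
  let ν : Fin N → Measure Y := fun i => ((m (x i) : ℝ≥0∞))⁻¹ • (π.restrict (S (x i))).map Prod.snd
  have key : ∀ c : X × Y → ℝ≥0∞, Measurable c →
      ∑ i, ∫⁻ y, c (x i, y) ∂(ν i) = ∫⁻ p, c p ∂π := by
    intro c hc
    have h1 : ∀ i, ∫⁻ y, c (x i, y) ∂(ν i) = ((m (x i) : ℝ≥0∞))⁻¹ * ∫⁻ p in S (x i), c p ∂π := by
      intro i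
      simp only [ν]
      rw [lintegral_smul_measure, lintegral_map (by fun_prop) measurable_snd, smul_eq_mul]
      congr 1
      refine setLIntegral_congr_fun (hS _) ?_
      rintro ⟨a, b⟩ hab
      simp only [S, mem_preimage, mem_singleton_iff] at hab
      simp [hab]
    simp_rw [h1]
    rw [← Finset.sum_fiberwise_of_maps_to (s := Finset.univ) (t := Finset.univ.image x)
      (g := x) (fun i _ => Finset.mem_image_of_mem _ (Finset.mem_univ _))]
    have h2 : ∀ p ∈ Finset.univ.image x, (∑ i with x i = p,
        ((m (x i) : ℝ≥0∞))⁻¹ * ∫⁻ p in S (x i), c p ∂π) = ∫⁻ q in S p, c q ∂π := by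
      intro p hp
      obtain ⟨i, -, rfl⟩ := Finset.mem_image.1 hp
      rw [Finset.sum_congr rfl (g := fun _ => ((m (x i) : ℝ≥0∞))⁻¹ * ∫⁻ p in S (x i), c p ∂π)
        (fun j hj => by rw [(Finset.mem_filter.1 hj).2])]
      rw [Finset.sum_const, nsmul_eq_mul, ← mul_assoc]
      change ((m (x i) : ℝ≥0∞)) * _ * _ = _
      rw [ENNReal.mul_inv_cancel (by exact_mod_cast hm i) (ENNReal.natCast_ne_top _), one_mul]
    rw [Finset.sum_congr rfl h2, ← lintegral_biUnion_finset]
    · have : π.restrict (⋃ p ∈ Finset.univ.image x, S p) = π := by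
        rw [Measure.restrict_eq_self_of_ae_mem]
        have : ∀ᵐ p ∂(π.map Prod.fst), p ∈ (Finset.univ.image x : Finset X) := by
          rw [hπ]
          refine Measure.ae_smul_measure ?_ _
          rw [ae_iff]
          simp only [Measure.coe_finsetSum, Finset.sum_apply, Finset.sum_eq_zero_iff]
          intro i _
          rw [Measure.dirac_apply']
          · simp
          · exact (Finset.measurableSet (Finset.univ.image x)).compl
        have := ae_of_ae_map measurable_fst.aemeasurable this
        filter_upwards [this] with p hp
        simp only [S, mem_iUnion]
        exact ⟨p.1, hp, rfl⟩
      rw [this]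
    · intro p _ q _ hpq
      refine Set.disjoint_left.2 fun a ha hb => hpq ?_
      simp only [S, mem_preimage, mem_singleton_iff] at ha hb
      rw [← ha, hb]
    · intro p _; exact hS p
  refine ⟨ν, ?_, ?_, key⟩
  · intro i
    simp only [ν, Measure.smul_apply, smul_eq_mul]
    rw [Measure.map_apply measurable_snd MeasurableSet.univ, preimage_univ,
      Measure.restrict_apply_univ, hπS, mul_comm, mul_assoc, ENNReal.mul_inv_cancel
      (by exact_mod_cast hm i) (ENNReal.natCast_ne_top _), mul_one]
  · ext A hA
    have := key (fun p => A.indicator 1 p.2) ((measurable_one.indicator hA).comp measurable_snd)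
    simp only [Measure.coe_finsetSum, Finset.sum_apply]
    rw [Measure.map_apply measurable_snd hA]
    simp only [lintegral_indicator_one hA] at this
    rw [this]
    have h3 : (fun p : X × Y => A.indicator (1 : Y → ℝ≥0∞) p.2)
        = (Prod.snd ⁻¹' A).indicator 1 := by
      ext p; simp [Set.indicator]
    rw [h3, lintegral_indicator_one (measurable_snd hA)]

theorem W2sq_le_pieces {X Z : Type*} [MeasurableSpace X] [PseudoMetricSpace X]
    [SecondCountableTopology X] [OpensMeasurableSpace X] [MeasurableSpace Z]
    {N : ℕ} (S : Fin N → Measure Z) (hS : ∀ i, S i univ = (N : ℝ≥0∞)⁻¹)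
    (a : Fin N → X) (b : Z → X) (hb : Measurable b) :
    W2sq ((N : ℝ≥0∞)⁻¹ • ∑ i, Measure.dirac (a i)) ((∑ i, S i).map b)
      ≤ ∑ i, ∫⁻ z, (edist (a i) (b z)) ^ 2 ∂(S i) := by
  have hmeas : ∀ i, Measurable (fun z => (a i, b z)) := fun i => by fun_prop
  refine (iInf₂_le (∑ i, (S i).map (fun z => (a i, b z))) ⟨?_, ?_⟩).trans ?_
  rotate_left
  · rw [Measure.map_finset_sum measurable_fst.aemeasurable, Finset.smul_sum]
    refine Finset.sum_congr rfl fun i _ => ?_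
    rw [Measure.map_map measurable_fst (hmeas i)]
    have : (Prod.fst ∘ fun z => (a i, b z)) = fun _ => a i := rfl
    rw [this, Measure.map_const, hS]
  · rw [Measure.map_finset_sum measurable_snd.aemeasurable, Measure.map_finset_sum hb.aemeasurable]
    refine Finset.sum_congr rfl fun i _ => ?_
    rw [Measure.map_map measurable_snd (hmeas i)]
    rfl
  · rw [lintegral_finsetSum_measure]
    refine Finset.sum_le_sum fun i _ => ?_
    rw [lintegral_map _ (hmeas i)]
    · refine lintegral_mono fun z => ?_
      simp only
      rw [ENNReal.ofReal_pow dist_nonneg, edist_dist]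
    · exact ENNReal.measurable_ofReal.comp ((measurable_fst.dist measurable_snd).pow_const 2)

theorem jensen_enn {E : Type*} [NormedAddCommGroup E] [NormedSpace ℝ E] [CompleteSpace E]
    {Z : Type*} [MeasurableSpace Z] (ν : Measure Z) [IsFiniteMeasure ν]
    (hν : ν ≠ 0) (L : E → ℝ) (C : ℝ) (hLconv : ConvexOn ℝ Set.univ L) (hLcont : Continuous L)
    (hL0 : ∀ p, 0 ≤ L p + C) (f : Z → E) (hf : Integrable f ν) :
    ν univ * ENNReal.ofReal (L (⨍ z, f z ∂ν) + C) ≤ ∫⁻ z, ENNReal.ofReal (L (f z) + C) ∂ν := by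
  by_cases htop : ∫⁻ z, ENNReal.ofReal (L (f z) + C) ∂ν = ⊤
  · rw [htop]; exact le_top
  have : NeZero ν := ⟨hν⟩
  have hmeas : AEStronglyMeasurable (fun z => L (f z) + C) ν :=
    (hLcont.comp_aestronglyMeasurable hf.aestronglyMeasurable).add aestronglyMeasurable_const
  have hIntg : Integrable (fun z => L (f z) + C) ν := by
    refine ⟨hmeas, ?_⟩
    rw [hasFiniteIntegral_iff_ofReal (ae_of_all _ fun z => hL0 _)]
    exact lt_top_iff_ne_top.2 htop
  have hJ := (hLconv.add (convexOn_const C convex_univ)).map_average_le (μ := ν) (f := f)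
    (by fun_prop) isClosed_univ (by simp) hf hIntg
  simp only [Pi.add_apply] at hJ
  rw [← ofReal_integral_eq_lintegral_ofReal hIntg (ae_of_all _ fun z => hL0 _)]
  refine (mul_le_mul_right (ENNReal.ofReal_le_ofReal hJ) _).trans ?_
  rw [average_eq]
  simp only [Function.comp_def, Pi.add_apply, smul_eq_mul]
  have h1 : ν univ = ENNReal.ofReal (ν.real univ) := by
    simp [Measure.real, ENNReal.ofReal_toReal]
  have h2 : ν.real univ ≠ 0 := by
    simpa [Measure.real, ENNReal.toReal_eq_zero_iff] using hν
  rw [h1, ← ENNReal.ofReal_mul measureReal_nonneg, ← mul_assoc, mul_inv_cancel₀ h2, one_mul]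

theorem birkhoff_assign {N : ℕ} (hN : N ≠ 0) (a c : Fin N → Fin N → ℝ≥0∞)
    (hrow : ∀ j, ∑ k, a j k = (N : ℝ≥0∞)⁻¹) (hcol : ∀ k, ∑ j, a j k = (N : ℝ≥0∞)⁻¹)
    (hc : ∀ j k, c j k ≠ ⊤) :
    ∃ σ : Equiv.Perm (Fin N), (N : ℝ≥0∞)⁻¹ * ∑ j, c j (σ j) ≤ ∑ j, ∑ k, a j k * c j k := by
  classical
  have hN0 : (N : ℝ≥0∞) ≠ 0 := by exact_mod_cast hN
  have hNr : (N : ℝ) ≠ 0 := by exact_mod_cast hN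
  have ha : ∀ j k, a j k ≠ ⊤ := by
    intro j k h
    have := hrow j
    have h2 : a j k ≤ ∑ k, a j k := Finset.single_le_sum (fun _ _ => zero_le) (Finset.mem_univ k)
    rw [this, h] at h2
    exact absurd (top_le_iff.1 h2) (ENNReal.inv_ne_top.2 hN0)
  let A : Matrix (Fin N) (Fin N) ℝ := fun j k => N * (a j k).toReal
  have hA : A ∈ doublyStochastic ℝ (Fin N) := by
    rw [mem_doublyStochastic_iff_sum]
    refine ⟨fun i j => by positivity, fun i => ?_, fun i => ?_⟩
    · simp only [A]
      rw [← Finset.mul_sum, ← ENNReal.toReal_sum (fun k _ => ha i k), hrow]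
      simp [hNr]
    · simp only [A]
      rw [← Finset.mul_sum, ← ENNReal.toReal_sum (fun k _ => ha k i), hcol]
      simp [hNr]
  rw [← SetLike.mem_coe, doublyStochastic_eq_convexHull_permMatrix] at hA
  let φ : Matrix (Fin N) (Fin N) ℝ →ₗ[ℝ] ℝ :=
    { toFun := fun B => ∑ j, ∑ k, B j k * (c j k).toReal
      map_add' := fun B B' => by simp [add_mul, Finset.sum_add_distrib]
      map_smul' := fun r B => by simp [Finset.mul_sum, mul_assoc] }
  obtain ⟨_, ⟨σ, rfl⟩, hσ⟩ :=
    (φ.concaveOn convex_univ).exists_le_of_mem_convexHull (subset_univ _) hA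
  refine ⟨σ, ?_⟩
  have h1 : φ (Equiv.Perm.permMatrix ℝ σ) = ∑ j, (c j (σ j)).toReal := by
    simp only [φ, LinearMap.coe_mk, AddHom.coe_mk]
    refine Finset.sum_congr rfl fun j _ => ?_
    rw [Finset.sum_eq_single (σ j)]
    · simp [Equiv.Perm.permMatrix, PEquiv.toMatrix_apply]
    · intro k _ hk
      simp [Equiv.Perm.permMatrix, PEquiv.toMatrix_apply, hk.symm]
    · simp
  have h2 : φ A = N * ∑ j, ∑ k, (a j k * c j k).toReal := by
    simp only [φ, LinearMap.coe_mk, AddHom.coe_mk, A, Finset.mul_sum, ENNReal.toReal_mul, mul_assoc]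
  rw [h1, h2] at hσ
  rw [ENNReal.inv_mul_le_iff hN0 (ENNReal.natCast_ne_top _)]
  have e1 : ∑ j, c j (σ j) ≠ ⊤ := ENNReal.sum_ne_top.2 fun j _ => hc _ _
  have e3 : ∀ j k, a j k * c j k ≠ ⊤ := fun j k => ENNReal.mul_ne_top (ha _ _) (hc _ _)
  have e2 : ∑ j, ∑ k, a j k * c j k ≠ ⊤ :=
    ENNReal.sum_ne_top.2 fun j _ => ENNReal.sum_ne_top.2 fun k _ => e3 j k
  rw [← ENNReal.toReal_le_toReal e1 (ENNReal.mul_ne_top (ENNReal.natCast_ne_top _) e2),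
    ENNReal.toReal_mul, ENNReal.toReal_sum (fun j _ => hc _ _),
    ENNReal.toReal_sum (fun j _ => ENNReal.sum_ne_top.2 fun k _ => e3 j k)]
  simp_rw [ENNReal.toReal_sum (fun k _ => e3 _ k)]
  simpa using hσ

theorem evalAt_of_mem {d : ℕ} {T : ℝ} (hT : 0 ≤ T) {t : ℝ} (ht : t ∈ Set.Icc 0 T) (γ : Traj d T) :
    evalAt hT t γ = γ ⟨t, ht⟩ := by
  simp [evalAt, Set.projIcc_of_mem hT ht]

theorem evalAt_continuous {d : ℕ} {T : ℝ} (hT : 0 ≤ T) (t : ℝ) :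
    Continuous (evalAt (d := d) hT t) := by
  unfold evalAt
  exact continuous_eval_const _

theorem evalAt_measurable {d : ℕ} {T : ℝ} (hT : 0 ≤ T) (t : ℝ) :
    Measurable (evalAt (d := d) hT t) := (evalAt_continuous hT t).measurable

theorem evalAt_edist_le {d : ℕ} {T : ℝ} (hT : 0 ≤ T) (t : ℝ) (γ γ' : Traj d T) :
    edist (evalAt hT t γ) (evalAt hT t γ') ≤ edist γ γ' := by
  rw [edist_dist, edist_dist]
  exact ENNReal.ofReal_le_ofReal (ContinuousMap.dist_apply_le_dist _)

noncomputable def incB {d : ℕ} {T : ℝ} (hT : 0 ≤ T) (L : Euc d → ℝ) (C : ℝ) (s t : ℝ)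
    (γ : Traj d T) : ℝ :=
  (t - s) * (L ((t - s)⁻¹ • (evalAt hT t γ - evalAt hT s γ)) + C)

theorem incB_nonneg {d : ℕ} {T : ℝ} (hT : 0 ≤ T) (L : Euc d → ℝ) (C : ℝ)
    (hL0 : ∀ p, 0 ≤ L p + C) {s t : ℝ} (hst : s ≤ t) (γ : Traj d T) :
    0 ≤ incB hT L C s t γ := mul_nonneg (by linarith) (hL0 _)

theorem incB_continuous {d : ℕ} {T : ℝ} (hT : 0 ≤ T) (L : Euc d → ℝ) (C : ℝ)
    (hLcont : Continuous L) (s t : ℝ) : Continuous (incB (d := d) hT L C s t) := by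
  unfold incB
  have h1 := evalAt_continuous (d := d) hT t
  have h2 := evalAt_continuous (d := d) hT s
  fun_prop

theorem action_ge {d : ℕ} {T : ℝ} (hT : 0 ≤ T) (L : Euc d → ℝ) (C : ℝ)
    (hLconv : ConvexOn ℝ Set.univ L) (hLcont : Continuous L)
    (hL0 : ∀ p, 0 ≤ L p + C) (γ : Traj d T) (δ : ℝ) (hδ : 0 < δ) (M : ℕ) (hM : (M : ℝ) * δ = T)
    (s t : ℕ → ℝ) (hs : ∀ i < M, i * δ ≤ s i) (hst : ∀ i < M, s i ≤ t i)
    (ht : ∀ i < M, t i ≤ (i + 1) * δ) :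
    ∑ i ∈ Finset.range M, ENNReal.ofReal (incB hT L C (s i) (t i) γ) ≤ actionN L C γ := by
  refine le_sInf ?_
  rintro a ⟨g, hg, hγ, rfl⟩
  have hsub : ∀ i < M, Ioc (s i) (t i) ⊆ Ioc 0 T := by
    intro i hi
    refine Ioc_subset_Ioc ((by positivity : (0:ℝ) ≤ i * δ).trans (hs i hi)) ((ht i hi).trans ?_)
    rw [← hM]
    have : ((i : ℝ) + 1) ≤ M := by exact_mod_cast hi
    gcongr
  have hone : ∀ i < M, ENNReal.ofReal (incB hT L C (s i) (t i) γ)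
      ≤ ∫⁻ u in Ioc (s i) (t i), ENNReal.ofReal (L (g u) + C) := by
    intro i hi
    rcases eq_or_lt_of_le (hst i hi) with h | h
    · simp [incB, h]
    have hsi : s i ∈ Icc 0 T := by
      refine ⟨(by positivity : (0:ℝ) ≤ i * δ).trans (hs i hi), ?_⟩
      exact h.le.trans (hsub i hi ⟨h, le_rfl⟩).2
    have hti : t i ∈ Icc 0 T := ⟨hsi.1.trans h.le, (hsub i hi ⟨h, le_rfl⟩).2⟩
    have hν : volume.restrict (Ioc (s i) (t i)) ≠ 0 := by
      rw [Ne, Measure.restrict_eq_zero, Real.volume_Ioc]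
      simp [h]
    have hIntg : Integrable g (volume.restrict (Ioc (s i) (t i))) := by
      have := (intervalIntegrable_iff_integrableOn_Ioc_of_le hT).1 hg
      exact IntegrableOn.mono_set this (hsub i hi)
    have := jensen_enn (volume.restrict (Ioc (s i) (t i))) hν L C hLconv hLcont hL0 g hIntg
    refine le_trans (le_of_eq ?_) this
    rw [setAverage_eq, Measure.restrict_apply_univ, Real.volume_Ioc, Real.volume_real_Ioc_of_le h.le,
      ← ENNReal.ofReal_mul (by linarith), ← intervalIntegral.integral_of_le h.le]
    have := hγ ⟨s i, hsi⟩ ⟨t i, hti⟩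
    simp only at this
    rw [← this, incB, evalAt_of_mem hT hsi, evalAt_of_mem hT hti]
  calc _ ≤ ∑ i ∈ Finset.range M, ∫⁻ u in Ioc (s i) (t i), ENNReal.ofReal (L (g u) + C) :=
        Finset.sum_le_sum fun i hi => hone i (Finset.mem_range.1 hi)
    _ = ∫⁻ u in ⋃ i ∈ Finset.range M, Ioc (s i) (t i), ENNReal.ofReal (L (g u) + C) := by
        rw [lintegral_biUnion_finset]
        · intro i hi j hj hij
          have hi' := Finset.mem_range.1 (Finset.mem_coe.1 hi)
          have hj' := Finset.mem_range.1 (Finset.mem_coe.1 hj)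
          refine Set.disjoint_left.2 fun u hu hv => ?_
          have a1 := (hs i hi').trans_lt hu.1
          have a2 := hu.2.trans (ht i hi')
          have b1 := (hs j hj').trans_lt hv.1
          have b2 := hv.2.trans (ht j hj')
          have c1 : (i : ℝ) < j + 1 := lt_of_mul_lt_mul_right (a1.trans_le b2) hδ.le
          have c2 : (j : ℝ) < i + 1 := lt_of_mul_lt_mul_right (b1.trans_le a2) hδ.le
          have c1' : i < j + 1 := by exact_mod_cast c1
          have c2' : j < i + 1 := by exact_mod_cast c2
          omega
        · intro i _; exact measurableSet_Ioc
    _ ≤ _ := by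
        refine lintegral_mono_set ?_
        refine iUnion₂_subset fun i hi => hsub i (Finset.mem_range.1 hi)

theorem action_ge_one {d : ℕ} {T : ℝ} (hT : 0 < T) (L : Euc d → ℝ) (C : ℝ)
    (hLconv : ConvexOn ℝ Set.univ L) (hLcont : Continuous L)
    (hL0 : ∀ p, 0 ≤ L p + C) (γ : Traj d T) (s t : ℝ) (hs : 0 ≤ s) (hst : s ≤ t) (ht : t ≤ T) :
    ENNReal.ofReal (incB hT.le L C s t γ) ≤ actionN L C γ := by
  have := action_ge hT.le L C hLconv hLcont hL0 γ T hT 1 (by simp) (fun _ => s) (fun _ => t)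
    (by simpa using hs) (by simpa using hst) (by simpa using ht)
  simpa using this

theorem inc_pow {d : ℕ} {T : ℝ} (hT : 0 ≤ T) (r C : ℝ) (hr : 1 < r) (hC : 0 < C) (L : Euc d → ℝ)
    (hLgrow : ∀ p : Euc d, 1 / (r * C) * ‖p‖ ^ r - C ≤ L p)
    (γ : Traj d T) {s t : ℝ} (hst : s ≤ t) :
    dist (evalAt hT t γ) (evalAt hT s γ) ^ r ≤ (t - s) ^ (r - 1) * (r * C * incB hT L C s t γ) := by
  rcases eq_or_lt_of_le hst with h | h
  · subst h
    simp [incB, Real.zero_rpow (by linarith : r ≠ 0)]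
  have hh : 0 < t - s := by linarith
  have h1 := hLgrow ((t - s)⁻¹ • (evalAt hT t γ - evalAt hT s γ))
  rw [norm_smul, Real.mul_rpow (by positivity) (by positivity), ← dist_eq_norm, norm_inv,
    Real.norm_of_nonneg hh.le, Real.inv_rpow hh.le] at h1
  unfold incB
  set X := dist (evalAt hT t γ) (evalAt hT s γ) ^ r
  set ℓ := L ((t - s)⁻¹ • (evalAt hT t γ - evalAt hT s γ))
  have h2 : (t - s) ^ (r - 1) * (t - s) = (t - s) ^ r := by
    rw [← Real.rpow_add_one hh.ne']; congr 1; ring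
  have h3 : 0 < (t - s) ^ r := Real.rpow_pos_of_pos hh _
  have h4 : X ≤ r * C * (ℓ + C) * (t - s) ^ r := by
    have h5 : 1 / (r * C) * (((t - s) ^ r)⁻¹ * X) ≤ ℓ + C := by linarith
    have h6 : 1 / (r * C) * (((t - s) ^ r)⁻¹ * X) = X / (r * C * (t - s) ^ r) := by
      field_simp
    rw [h6, div_le_iff₀ (by positivity)] at h5
    linarith
  calc X ≤ _ := h4
    _ = _ := by rw [← h2]; ring

theorem inc_real_sq {r δ h D x B : ℝ} (hr : 1 < r) (hδ : 0 < δ) (hδ1 : δ ≤ 1) (hh : 0 ≤ h)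
    (hhδ : h ≤ δ) (hD : 1 ≤ D) (hx : 0 ≤ x) (hxD : x ≤ D) (hB : 0 ≤ B)
    (hxr : x ^ r ≤ h ^ (r - 1) * B) :
    δ * x ^ 2 ≤ D ^ 2 * δ ^ (2 / (r / (r - 1))) * (δ + B) := by
  have hr0 : 0 < r := by linarith
  have hD2 : 1 ≤ D ^ 2 := one_le_pow₀ hD
  have hhp : h ^ (r - 1) ≤ δ ^ (r - 1) := Real.rpow_le_rpow hh hhδ (by linarith)
  have hxr' : x ^ r ≤ δ ^ (r - 1) * B := hxr.trans (by gcongr)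
  have hexp : 2 / (r / (r - 1)) = (r - 1) * (2 / r) := by field_simp
  rcases le_or_gt 2 r with h2 | h2
  · have e1 : x ^ 2 = (x ^ r) ^ (2 / r) := by
      rw [← Real.rpow_mul hx, mul_div_cancel₀ _ hr0.ne']; norm_num
    have e2 : x ^ 2 ≤ δ ^ (2 / (r / (r - 1))) * B ^ (2 / r) := by
      rw [e1, hexp, Real.rpow_mul hδ.le, ← Real.mul_rpow (by positivity) hB]
      exact Real.rpow_le_rpow (by positivity) hxr' (by positivity)
    have e3 : B ^ (2 / r) ≤ 1 + B := by
      rcases le_or_gt B 1 with hb | hb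
      · have := Real.rpow_le_one hB hb (by positivity : 0 ≤ 2 / r); linarith
      · have := Real.rpow_le_rpow_of_exponent_le hb.le ((div_le_one hr0).2 h2)
        rw [Real.rpow_one] at this; linarith
    set P := δ ^ (2 / (r / (r - 1)))
    have hP : 0 ≤ P := by positivity
    calc δ * x ^ 2 ≤ δ * (P * (1 + B)) := by gcongr; exact e2.trans (by gcongr)
      _ = 1 * P * (δ + δ * B) := by ring
      _ ≤ D ^ 2 * P * (δ + 1 * B) := by gcongr
      _ = _ := by ring
  · have e1 : x ^ 2 = x ^ (2 - r) * x ^ r := by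
      rcases eq_or_lt_of_le hx with h0 | h0
      · rw [← h0, Real.zero_rpow hr0.ne']; simp
      · rw [← Real.rpow_add h0]; norm_num
    have e2 : x ^ (2 - r) ≤ D ^ 2 := by
      calc x ^ (2 - r) ≤ D ^ (2 - r) := Real.rpow_le_rpow hx hxD (by linarith)
        _ ≤ D ^ (2 : ℝ) := Real.rpow_le_rpow_of_exponent_le hD (by linarith)
        _ = D ^ 2 := by norm_num
    have e3 : δ * δ ^ (r - 1) ≤ δ ^ (2 / (r / (r - 1))) := by
      have : δ * δ ^ (r - 1) = δ ^ r := by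
        rw [mul_comm, ← Real.rpow_add_one hδ.ne']; congr 1; ring
      rw [this]
      refine Real.rpow_le_rpow_of_exponent_ge hδ hδ1 ?_
      rw [hexp, ← mul_div_assoc, div_le_iff₀ hr0]
      nlinarith [sq_nonneg (r - 1)]
    have hxr0 : 0 ≤ x ^ r := by positivity
    calc δ * x ^ 2 ≤ δ * (D ^ 2 * (δ ^ (r - 1) * B)) := by rw [e1]; gcongr
      _ = D ^ 2 * (δ * δ ^ (r - 1)) * B := by ring
      _ ≤ D ^ 2 * δ ^ (2 / (r / (r - 1))) * (δ + B) := by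
        gcongr
        linarith

theorem inc_real_one {r δ h x B : ℝ} (hr : 1 < r) (hδ : 0 < δ) (hh : 0 ≤ h)
    (hhδ : h ≤ δ) (hx : 0 ≤ x) (hB : 0 ≤ B)
    (hxr : x ^ r ≤ h ^ (r - 1) * B) :
    x ≤ δ ^ ((r - 1) / r) * (1 + B) := by
  have hr0 : 0 < r := by linarith
  have hhp : h ^ (r - 1) ≤ δ ^ (r - 1) := Real.rpow_le_rpow hh hhδ (by linarith)
  have hxr' : x ^ r ≤ δ ^ (r - 1) * B := hxr.trans (by gcongr)
  have e1 : x = (x ^ r) ^ (1 / r) := by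
    rw [← Real.rpow_mul hx, mul_div_cancel₀ _ hr0.ne', Real.rpow_one]
  have e2 : x ≤ δ ^ ((r - 1) / r) * B ^ (1 / r) := by
    calc x = (x ^ r) ^ (1 / r) := e1
      _ ≤ (δ ^ (r - 1) * B) ^ (1 / r) := Real.rpow_le_rpow (by positivity) hxr' (by positivity)
      _ = _ := by
        rw [Real.mul_rpow (by positivity) hB, ← Real.rpow_mul hδ.le, mul_one_div]
  have e3 : B ^ (1 / r) ≤ 1 + B := by
    rcases le_or_gt B 1 with hb | hb
    · have := Real.rpow_le_one hB hb (by positivity : 0 ≤ 1 / r); linarith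
    · have := Real.rpow_le_rpow_of_exponent_le hb.le ((div_le_one hr0).2 hr.le)
      rw [Real.rpow_one] at this; linarith
  exact e2.trans (by gcongr)

theorem integral_indicator_clamp {d : ℕ} (a b : ℝ) (hab : a ≤ b) (c : Euc d) (s t : ℝ) :
    ∫ u in s..t, (Ioc a b).indicator (fun _ => c) u
      = (max a (min b t) - max a (min b s)) • c := by
  have key : ∀ s t : ℝ, s ≤ t → ∫ u in s..t, (Ioc a b).indicator (fun _ => c) u
      = (max a (min b t) - max a (min b s)) • c := by
    intro s t hst
    rw [intervalIntegral.integral_of_le hst, setIntegral_indicator measurableSet_Ioc,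
      setIntegral_const, Ioc_inter_Ioc, Real.volume_real_Ioc]
    congr 1
    rcases le_total a s with h1 | h1 <;> rcases le_total a t with h2 | h2 <;>
    rcases le_total b s with h3 | h3 <;> rcases le_total b t with h4 | h4 <;>
    simp only [max_def, min_def] <;> split_ifs <;> linarith
  rcases le_total s t with h | h
  · exact key s t h
  · rw [intervalIntegral.integral_symm, key t s h, ← neg_smul]; congr 1; ring

theorem interp_exists {d : ℕ} {T : ℝ} (hT : 0 ≤ T) (L : Euc d → ℝ) (C : ℝ)
    (δ : ℝ) (hδ : 0 < δ) (M : ℕ) (hM : (M : ℝ) * δ = T) (v : ℕ → Euc d) :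
    ∃ γ : Traj d T, PiecewiseAffine hT δ M γ ∧
      (∀ k ≤ M, evalAt hT (k * δ) γ = v k) ∧
      actionN L C γ ≤ ∑ k ∈ Finset.range M,
        ENNReal.ofReal (δ * (L (δ⁻¹ • (v (k + 1) - v k)) + C)) := by
  let φ : ℕ → ℝ → ℝ := fun k t => δ⁻¹ * (max (k * δ) (min ((k + 1) * δ) t) - k * δ)
  let γ : Traj d T := ⟨fun t => v 0 + ∑ k ∈ Finset.range M, φ k t • (v (k + 1) - v k), by
    simp only [φ]; fun_prop⟩
  have hγ : ∀ t : Icc (0:ℝ) T, γ t = v 0 + ∑ k ∈ Finset.range M, φ k t • (v (k + 1) - v k) :=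
    fun t => rfl
  have hval : ∀ j < M, ∀ a ∈ Icc (0:ℝ) 1, evalAt hT ((j + a) * δ) γ
      = v j + a • (v (j + 1) - v j) := by
    intro j hj a ha
    have hmem : (j + a) * δ ∈ Icc 0 T := by
      refine ⟨mul_nonneg (add_nonneg (Nat.cast_nonneg _) ha.1) hδ.le, ?_⟩
      rw [← hM]
      have : ((j : ℝ) + 1) ≤ M := by exact_mod_cast hj
      have := ha.2
      gcongr
      linarith
    rw [evalAt_of_mem hT hmem, hγ]
    have h1 : ∀ k, j < k → φ k ((j + a) * δ) = 0 := by
      intro k hk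
      have : ((j : ℝ) + 1) ≤ k := by exact_mod_cast hk
      have h2 : (j + a) * δ ≤ k * δ := by have := ha.2; gcongr; linarith
      simp only [φ]
      rw [min_eq_right (h2.trans (by gcongr; linarith)), max_eq_left h2]; simp
    have h2 : φ j ((j + a) * δ) = a := by
      simp only [φ]
      have := ha.1
      rw [min_eq_right (by have := ha.2; gcongr), max_eq_right (by gcongr; linarith)]
      field_simp; ring
    have h3 : ∀ k, k < j → φ k ((j + a) * δ) = 1 := by
      intro k hk
      have : ((k : ℝ) + 1) ≤ j := by exact_mod_cast hk
      have := ha.1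
      simp only [φ]
      rw [min_eq_left (mul_le_mul_of_nonneg_right (by linarith) hδ.le),
        max_eq_right (mul_le_mul_of_nonneg_right (by linarith) hδ.le)]
      field_simp; ring
    have h4 : ∑ k ∈ Finset.range M, φ k ((j + a) * δ) • (v (k + 1) - v k)
        = ∑ k ∈ Finset.range (j + 1), φ k ((j + a) * δ) • (v (k + 1) - v k) := by
      symm
      refine Finset.sum_subset (Finset.range_subset_range.2 hj) ?_
      intro k _ hk
      rw [h1 k (by simpa using hk), zero_smul]
    simp only
    rw [h4, Finset.sum_range_succ, h2, Finset.sum_congr rfl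
      (g := fun k => v (k + 1) - v k) (fun k hk => by rw [h3 k (Finset.mem_range.1 hk), one_smul]),
      Finset.sum_range_sub]
    abel
  have hgrid : ∀ k ≤ M, evalAt hT (k * δ) γ = v k := by
    intro k hk
    rcases Nat.lt_or_ge k M with h | h
    · have := hval k h 0 (by simp)
      simpa using this
    · have hkM : k = M := le_antisymm hk h
      rcases Nat.eq_zero_or_pos M with h0 | h0
      · have hmem : (k : ℝ) * δ ∈ Icc 0 T := by
          rw [hkM, hM]; exact ⟨hT, le_rfl⟩
        have hemp : Finset.range M = ∅ := by simp [h0]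
        rw [evalAt_of_mem hT hmem, hγ, hemp, Finset.sum_empty, add_zero, hkM.trans h0]
      · obtain ⟨m, rfl⟩ : ∃ m, M = m + 1 := ⟨M - 1, by omega⟩
        have := hval m (by omega) 1 (by simp)
        rw [hkM]
        push_cast
        rw [this]; simp
  refine ⟨γ, ?_, hgrid, ?_⟩
  · intro i hi a ha
    have e1 : (1 - a) * (i * δ) + a * ((i + 1) * δ) = (i + a) * δ := by ring
    have e2 := hgrid (i + 1) hi
    push_cast at e2
    rw [e1, hval i hi a ha, hgrid i hi.le, e2]
    module
  · let g : ℝ → Euc d := fun u => ∑ k ∈ Finset.range M,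
      (Ioc ((k:ℝ) * δ) ((k + 1) * δ)).indicator (fun _ => δ⁻¹ • (v (k + 1) - v k)) u
    have hIntg : ∀ (k : ℕ) (s t : ℝ), IntervalIntegrable
        ((Ioc ((k:ℝ) * δ) ((k + 1) * δ)).indicator (fun _ => δ⁻¹ • (v (k + 1) - v k)))
        volume s t := by
      intro k s t
      rw [intervalIntegrable_iff]
      refine (integrable_indicator_iff measurableSet_Ioc).2 ?_
      exact integrableOn_const (by
        rw [Measure.restrict_apply measurableSet_Ioc]
        exact ((measure_mono inter_subset_left).trans_lt (by simp [Real.volume_Ioc])).ne)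
    unfold actionN
    refine le_trans (b := ∫⁻ t in Set.Ioc (0:ℝ) T, ENNReal.ofReal (L (g t) + C))
      (sInf_le ⟨g, ?_, ?_, rfl⟩) ?_
    · rw [intervalIntegrable_iff]
      exact integrable_finset_sum _ fun k _ => intervalIntegrable_iff.1 (hIntg k 0 T)
    · intro s t
      simp only [g]
      rw [intervalIntegral.integral_finsetSum (fun k _ => hIntg k _ _), hγ, hγ,
        add_sub_add_left_eq_sub, ← Finset.sum_sub_distrib]
      refine Finset.sum_congr rfl fun k _ => ?_
      rw [integral_indicator_clamp _ _ (by gcongr; linarith), ← sub_smul, smul_smul]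
      congr 1
      simp only [φ]; ring
    · have hcov : Ioc 0 T ⊆ ⋃ k ∈ Finset.range M, Ioc ((k:ℝ) * δ) ((k + 1) * δ) := by
        intro u hu
        have hp : 0 < u / δ := div_pos hu.1 hδ
        have hc : 0 < ⌈u / δ⌉₊ := Nat.ceil_pos.2 hp
        obtain ⟨k, hk⟩ : ∃ k, ⌈u / δ⌉₊ = k + 1 := ⟨⌈u / δ⌉₊ - 1, by omega⟩
        have h1 := (Nat.ceil_eq_iff (by omega)).1 hk
        simp only [Nat.add_sub_cancel] at h1
        have h2 : k + 1 ≤ M := by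
          rw [← hk]; refine Nat.ceil_le.2 ?_
          rw [div_le_iff₀ hδ, hM]; exact hu.2
        simp only [mem_iUnion]
        refine ⟨k, Finset.mem_range.2 h2, ?_, ?_⟩
        · exact (lt_div_iff₀ hδ).1 h1.1
        · have := (div_le_iff₀ hδ).1 h1.2
          push_cast at this; exact this
      have hdisj : ∀ i j : ℕ, i ≠ j → ∀ u, u ∈ Ioc ((i:ℝ) * δ) ((i + 1) * δ) →
          u ∉ Ioc ((j:ℝ) * δ) ((j + 1) * δ) := by
        intro i j hij u hu hv
        have c1 : (i : ℝ) < j + 1 := lt_of_mul_lt_mul_right (hu.1.trans_le hv.2) hδ.le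
        have c2 : (j : ℝ) < i + 1 := lt_of_mul_lt_mul_right (hv.1.trans_le hu.2) hδ.le
        have c1' : i < j + 1 := by exact_mod_cast c1
        have c2' : j < i + 1 := by exact_mod_cast c2
        omega
      refine (lintegral_mono_set hcov).trans ?_
      rw [lintegral_biUnion_finset (fun i _ j _ hij =>
        Set.disjoint_left.2 fun u hu hv => hdisj i j hij u hu hv) (fun i _ => measurableSet_Ioc)]
      refine Finset.sum_le_sum fun k hk => ?_
      have : ∀ u ∈ Ioc ((k:ℝ) * δ) ((k + 1) * δ), ENNReal.ofReal (L (g u) + C)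
          = ENNReal.ofReal (L (δ⁻¹ • (v (k + 1) - v k)) + C) := by
        intro u hu
        have : g u = δ⁻¹ • (v (k + 1) - v k) := by
          simp only [g]
          rw [Finset.sum_eq_single k]
          · simp only [indicator_of_mem hu]
          · intro j _ hj
            rw [indicator_of_notMem (hdisj k j hj.symm u hu)]
          · intro h; exact absurd hk h
        rw [this]
      rw [setLIntegral_congr_fun measurableSet_Ioc this, setLIntegral_const, Real.volume_Ioc,
        mul_comm, ← ENNReal.ofReal_mul (by linarith)]
      refine le_of_eq ?_
      congr 2; ring

theorem enn_add_sq_le (a b : ℝ≥0∞) : (a + b) ^ 2 ≤ 2 * a ^ 2 + 2 * b ^ 2 := by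
  have := ENNReal.rpow_add_le_mul_rpow_add_rpow a b (p := 2) (by norm_num)
  norm_num at this
  rwa [mul_add] at this

theorem assign_exists {X Z : Type*} [MeasurableSpace X] [PseudoMetricSpace X]
    [SecondCountableTopology X] [OpensMeasurableSpace X] [MeasurableSpace Z]
    {N : ℕ} (hN : N ≠ 0) (S : Fin N → Measure Z) (hS : ∀ i, S i univ = (N : ℝ≥0∞)⁻¹)
    (e : Z → X) (he : Measurable e)
    (V : Fin N → Measure X) (hV : ∀ i, V i univ = (N : ℝ≥0∞)⁻¹)
    (hVS : ∑ i, V i = (∑ i, S i).map e) (x p : Fin N → X) :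
    ∃ σ : Equiv.Perm (Fin N), (N : ℝ≥0∞)⁻¹ * ∑ j, edist (x (σ j)) (p j) ^ 2
      ≤ 2 * ∑ k, ∫⁻ y, edist (x k) y ^ 2 ∂(V k) + 2 * ∑ j, ∫⁻ z, edist (p j) (e z) ^ 2 ∂(S j) := by
  have hN0 : (N : ℝ≥0∞) ≠ 0 := by exact_mod_cast hN
  have hNi : (N : ℝ≥0∞)⁻¹ < ⊤ := ENNReal.inv_lt_top.2 (pos_iff_ne_zero.2 hN0)
  have hSf : ∀ i, IsFiniteMeasure (S i) := fun i => ⟨by rw [hS]; exact hNi⟩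
  have hVf : ∀ i, IsFiniteMeasure (V i) := fun i => ⟨by rw [hV]; exact hNi⟩
  set μ : Measure X := ∑ i, V i with hμ
  have hVle : ∀ k, V k ≤ μ := fun k => Finset.single_le_sum (f := V)
    (fun i _ => Measure.zero_le _) (Finset.mem_univ k)
  have hSle : ∀ k, S k ≤ ∑ i, S i := fun k => Finset.single_le_sum (f := S)
    (fun i _ => Measure.zero_le _) (Finset.mem_univ k)
  let g : Fin N → X → ℝ≥0∞ := fun k => (V k).rnDeriv μ
  have hgm : ∀ k, Measurable (g k) := fun k => Measure.measurable_rnDeriv _ _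
  have hVg : ∀ k, μ.withDensity (g k) = V k := fun k =>
    Measure.withDensity_rnDeriv_eq _ _ (Measure.absolutelyContinuous_of_le (hVle k))
  have hg1 : ∀ᵐ y ∂μ, ∑ k, g k y = 1 := by
    have h1 : μ.withDensity (∑ k, g k) = μ.withDensity 1 := by
      have := withDensity_tsum (μ := μ) hgm
      rw [tsum_fintype, Measure.sum_fintype] at this
      rw [this, withDensity_one]
      simp_rw [hVg]
      rfl
    have := (withDensity_eq_iff_of_sigmaFinite (μ := μ)
      (Finset.measurable_sum _ (fun k _ => hgm k)).aemeasurable aemeasurable_const).1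
      (by rw [show (fun a => ∑ k, g k a) = ∑ k, g k from by ext; simp]; exact h1)
    filter_upwards [this] with y hy
    simpa using hy
  have hg1S : ∀ j, ∀ᵐ z ∂(S j), ∑ k, g k (e z) = 1 := by
    intro j
    rw [hVS] at hg1
    have := ae_of_ae_map he.aemeasurable hg1
    exact (Measure.absolutelyContinuous_of_le (hSle j)).ae_le this
  obtain ⟨σ, hσ⟩ := birkhoff_assign hN (fun j k => ∫⁻ z, g k (e z) ∂(S j))
    (fun j k => edist (x k) (p j) ^ 2) (fun j => by
      rw [← lintegral_finsetSum (f := fun k z => g k (e z)) _ (fun k _ => (hgm k).comp he),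
        lintegral_congr_ae (hg1S j)]
      simp [hS]) (fun k => by
      rw [← lintegral_finsetSum_measure, ← lintegral_map (hgm k) he, ← hVS,
        ← setLIntegral_univ, ← withDensity_apply _ MeasurableSet.univ, hVg, hV])
      (fun j k => ENNReal.pow_ne_top (edist_ne_top _ _))
  refine ⟨σ, hσ.trans ?_⟩
  have hd1 : ∀ k, Measurable (fun z => edist (x k) z) := fun k => measurable_edist_right
  have hd2 : ∀ j, Measurable (fun z => edist (p j) (e z)) := fun j => measurable_edist_right.comp he
  have hbound : ∀ j k, (∫⁻ z, g k (e z) ∂(S j)) * edist (x k) (p j) ^ 2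
      ≤ 2 * ∫⁻ z, g k (e z) * edist (x k) (e z) ^ 2 ∂(S j)
        + 2 * ∫⁻ z, g k (e z) * edist (p j) (e z) ^ 2 ∂(S j) := by
    intro j k
    have m1 : Measurable fun z => g k (e z) := (hgm k).comp he
    have m2 : Measurable fun z => edist (x k) (e z) := (hd1 k).comp he
    have m3 : Measurable fun z => g k (e z) * edist (x k) (e z) ^ 2 := m1.mul (m2.pow_const 2)
    have m4 : Measurable fun z => g k (e z) * edist (p j) (e z) ^ 2 :=
      m1.mul ((hd2 j).pow_const 2)
    rw [← lintegral_mul_const _ m1, ← lintegral_const_mul _ m3, ← lintegral_const_mul _ m4,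
      ← lintegral_add_left (m3.const_mul 2)]
    refine lintegral_mono fun z => ?_
    have h1 : edist (x k) (p j) ^ 2 ≤ 2 * edist (x k) (e z) ^ 2 + 2 * edist (p j) (e z) ^ 2 := by
      refine le_trans ?_ (enn_add_sq_le _ _)
      gcongr
      rw [edist_comm (p j)]
      exact edist_triangle _ _ _
    calc g k (e z) * edist (x k) (p j) ^ 2 
        ≤ g k (e z) * (2 * edist (x k) (e z) ^ 2 + 2 * edist (p j) (e z) ^ 2) := by gcongr
      _ = _ := by ring
  refine (Finset.sum_le_sum fun j _ => Finset.sum_le_sum fun k _ => hbound j k).trans ?_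
  simp_rw [Finset.sum_add_distrib, ← Finset.mul_sum]
  refine add_le_add (le_of_eq ?_) (le_of_eq ?_)
  · congr 1
    rw [Finset.sum_comm]
    refine Finset.sum_congr rfl fun k _ => ?_
    have m3 : Measurable (fun y => g k y * edist (x k) y ^ 2) := (hgm k).mul ((hd1 k).pow_const 2)
    rw [← lintegral_finsetSum_measure, ← lintegral_map (f := fun y => g k y * edist (x k) y ^ 2) m3 he,
      ← hVS]
    conv_rhs => rw [← hVg k, lintegral_withDensity_eq_lintegral_mul _ (hgm k) ((hd1 k).pow_const 2)]
    rfl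
  · congr 1
    refine Finset.sum_congr rfl fun j _ => ?_
    rw [← lintegral_finsetSum (f := fun k z => g k (e z) * edist (p j) (e z) ^ 2) _
      (fun k _ => ((hgm k).comp he).mul ((hd2 j).pow_const 2))]
    refine lintegral_congr_ae ?_
    filter_upwards [hg1S j] with z hz
    rw [← Finset.sum_mul, hz, one_mul]

theorem evalAt_average {d : ℕ} {T : ℝ} (hT : 0 ≤ T) (ν : Measure (Traj d T)) [IsFiniteMeasure ν]
    (hIntg : Integrable (fun γ : Traj d T => γ) ν) (t : ℝ) :
    evalAt hT t (⨍ γ, γ ∂ν) = ⨍ γ, evalAt hT t γ ∂ν := by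
  let E : Traj d T →L[ℝ] Euc d := ContinuousMap.evalCLM ℝ (Set.projIcc 0 T hT t)
  have hE : ∀ γ, E γ = evalAt hT t γ := fun γ => rfl
  rw [average_eq, average_eq, ← hE, map_smul, ← E.integral_comp_comm hIntg]
  simp_rw [hE]

theorem integrable_traj {d : ℕ} {T : ℝ} (ν : Measure (Traj d T)) [IsFiniteMeasure ν]
    (q : Traj d T) (h : ∫⁻ γ, edist q γ ^ 2 ∂ν ≠ ⊤) : Integrable (fun γ : Traj d T => γ) ν := by
  have h1 : Integrable (fun γ : Traj d T => q - γ) ν := by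
    refine ⟨(by fun_prop : Continuous fun γ : Traj d T => q - γ).aestronglyMeasurable, ?_⟩
    have : ∀ γ, ‖q - γ‖ₑ ≤ 1 + edist q γ ^ 2 := by
      intro γ
      rw [← edist_eq_enorm_sub]
      rcases le_total (edist q γ) 1 with h | h
      · exact h.trans le_self_add
      · refine le_trans ?_ le_add_self
        calc edist q γ = edist q γ ^ 1 := (pow_one _).symm
          _ ≤ _ := pow_le_pow_right₀ h (by norm_num)
    refine (lintegral_mono this).trans_lt ?_
    rw [lintegral_add_left measurable_const]
    simp only [lintegral_const, one_mul]
    exact ENNReal.add_lt_top.2 ⟨measure_lt_top _ _, lt_top_iff_ne_top.2 h⟩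
  have h2 := (integrable_const q).sub h1
  refine h2.congr (ae_of_all _ fun γ => ?_)
  simp

theorem average_dist_sq {d : ℕ} {T : ℝ} (ν : Measure (Traj d T)) [IsFiniteMeasure ν] (hν : ν ≠ 0)
    (q : Traj d T) (h : ∫⁻ γ, edist q γ ^ 2 ∂ν ≠ ⊤) :
    ν univ * edist q (⨍ γ, γ ∂ν) ^ 2 ≤ ∫⁻ γ, edist q γ ^ 2 ∂ν := by
  have := jensen_enn ν hν (fun γ : Traj d T => dist γ q ^ 2) 0
    ((convexOn_univ_dist q).pow (fun _ _ => dist_nonneg) 2) (by fun_prop)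
    (fun p => by positivity) (fun γ => γ) (integrable_traj ν q h)
  simp only [add_zero, ENNReal.ofReal_pow dist_nonneg, ← edist_dist] at this
  simpa only [edist_comm q] using this

theorem average_cost {d : ℕ} {T : ℝ} (ν : Measure (Traj d T)) [IsFiniteMeasure ν] (hν : ν ≠ 0)
    (q : Traj d T) (h : ∫⁻ γ, edist q γ ^ 2 ∂ν ≠ ⊤) :
    ∫⁻ γ, edist (⨍ γ, γ ∂ν) γ ^ 2 ∂ν ≤ 4 * ∫⁻ γ, edist q γ ^ 2 ∂ν := by
  have hm : Measurable fun γ : Traj d T => edist q γ ^ 2 := measurable_edist_right.pow_const 2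
  calc ∫⁻ γ, edist (⨍ γ, γ ∂ν) γ ^ 2 ∂ν
      ≤ ∫⁻ γ, 2 * edist q (⨍ γ, γ ∂ν) ^ 2 + 2 * edist q γ ^ 2 ∂ν := by
        refine lintegral_mono fun γ => ?_
        refine le_trans ?_ (enn_add_sq_le _ _)
        gcongr
        rw [edist_comm q]
        exact edist_triangle _ _ _
    _ = 2 * (ν univ * edist q (⨍ γ, γ ∂ν) ^ 2) + 2 * ∫⁻ γ, edist q γ ^ 2 ∂ν := by
        rw [lintegral_add_left measurable_const, lintegral_const, lintegral_const_mul _ hm]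
        ring
    _ ≤ 2 * (∫⁻ γ, edist q γ ^ 2 ∂ν) + 2 * ∫⁻ γ, edist q γ ^ 2 ∂ν := by
        gcongr
        exact average_dist_sq ν hν q h
    _ = _ := by ring

theorem competitor {d : ℕ} {T : ℝ} (hT : 0 ≤ T) (L : Euc d → ℝ) (C : ℝ)
    (hLconv : ConvexOn ℝ Set.univ L) (hLcont : Continuous L)
    (hL0 : ∀ p, 0 ≤ L p + C) (δ : ℝ) (hδ : 0 < δ) (M : ℕ) (hM : (M : ℝ) * δ = T)
    {N : ℕ} (hN : N ≠ 0) (S : Fin N → Measure (Traj d T)) (hS : ∀ i, S i univ = (N : ℝ≥0∞)⁻¹)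
    (q : Fin N → Traj d T) (hq : ∑ j, ∫⁻ γ, edist (q j) γ ^ 2 ∂(S j) ≠ ⊤)
    (V : Fin N → Measure (Euc d)) (hV : ∀ i, V i univ = (N : ℝ≥0∞)⁻¹)
    (hVS : ∑ i, V i = (∑ i, S i).map (evalAt hT 0)) (x : Fin N → Euc d) :
    ∃ (y : Fin N → Traj d T) (E : Fin N → Traj d T → ℝ≥0∞),
      (∀ j, PiecewiseAffine hT δ M (y j)) ∧
      (((N : ℝ≥0∞)⁻¹ • ∑ j, Measure.dirac (y j)).map (evalAt hT 0)
        = (N : ℝ≥0∞)⁻¹ • ∑ k, Measure.dirac (x k)) ∧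
      ((N : ℝ≥0∞)⁻¹ * ∑ j, actionN L C (y j) ≤ ∫⁻ γ, actionN L C γ ∂(∑ i, S i)) ∧
      (∀ j, Measurable (E j)) ∧
      (∀ j γ, ∀ k ≤ M, edist (evalAt hT (k * δ) (y j)) (evalAt hT (k * δ) γ) ≤ E j γ) ∧
      ∑ j, ∫⁻ γ, E j γ ^ 2 ∂(S j) ≤ 24 * ∑ j, ∫⁻ γ, edist (q j) γ ^ 2 ∂(S j)
        + 4 * ∑ k, ∫⁻ z, edist (x k) z ^ 2 ∂(V k) := by
  have hN0 : (N : ℝ≥0∞) ≠ 0 := by exact_mod_cast hN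
  have hNi : (N : ℝ≥0∞)⁻¹ < ⊤ := ENNReal.inv_lt_top.2 (pos_iff_ne_zero.2 hN0)
  have hSf : ∀ i, IsFiniteMeasure (S i) := fun i => ⟨by rw [hS]; exact hNi⟩
  have hSne : ∀ i, S i ≠ 0 := fun i h => by
    have := hS i
    rw [h] at this
    simp at this
    exact (ENNReal.inv_ne_zero.2 (ENNReal.natCast_ne_top N)) this.symm
  have hqj : ∀ j, ∫⁻ γ, edist (q j) γ ^ 2 ∂(S j) ≠ ⊤ := fun j =>
    (ENNReal.sum_ne_top.1 hq) j (Finset.mem_univ j)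
  have hIntg : ∀ j, Integrable (fun γ : Traj d T => γ) (S j) := fun j =>
    integrable_traj (S j) (q j) (hqj j)
  let z : Fin N → Traj d T := fun j => ⨍ γ, γ ∂(S j)
  have hz : ∑ j, ∫⁻ γ, edist (z j) γ ^ 2 ∂(S j) ≤ 4 * ∑ j, ∫⁻ γ, edist (q j) γ ^ 2 ∂(S j) := by
    rw [Finset.mul_sum]
    exact Finset.sum_le_sum fun j _ => average_cost (S j) (hSne j) (q j) (hqj j)
  obtain ⟨σ, hσ⟩ := assign_exists hN S hS (evalAt hT 0) (evalAt_measurable hT 0) V hV hVS x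
    (fun j => evalAt hT 0 (z j))
  let w : Fin N → Euc d := fun j => x (σ j) - evalAt hT 0 (z j)
  choose y hy1 hy2 hy3 using fun j => interp_exists hT L C δ hδ M hM
    (fun k => evalAt hT (k * δ) (z j) + w j)
  refine ⟨y, fun j γ => edist (z j) γ + ‖w j‖ₑ, hy1, ?_, ?_, ?_, ?_, ?_⟩
  · rw [Measure.map_smul, Measure.map_finset_sum (evalAt_measurable hT 0).aemeasurable]
    congr 1
    rw [← Equiv.sum_comp σ (fun k => Measure.dirac (x k))]
    refine Finset.sum_congr rfl fun j _ => ?_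
    rw [Measure.map_dirac' (evalAt_measurable hT 0)]
    have := hy2 j 0 (Nat.zero_le _)
    simp only [Nat.cast_zero, zero_mul] at this
    rw [this]
    simp [w]
  · rw [lintegral_finsetSum_measure, Finset.mul_sum]
    refine Finset.sum_le_sum fun j _ => ?_
    have h1 : ∫⁻ γ, ∑ k ∈ Finset.range M,
        ENNReal.ofReal (incB hT L C (k * δ) ((k + 1) * δ) γ) ∂(S j)
        ≤ ∫⁻ γ, actionN L C γ ∂(S j) := by
      refine lintegral_mono fun γ => ?_
      exact action_ge hT L C hLconv hLcont hL0 γ δ hδ M hM (fun k => k * δ)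
        (fun k => (k + 1) * δ) (fun _ _ => le_rfl) (fun _ _ => by gcongr; linarith)
        (fun _ _ => le_rfl)
    refine le_trans ?_ h1
    rw [lintegral_finsetSum (f := fun (k : ℕ) γ =>
      ENNReal.ofReal (incB hT L C (k * δ) ((k + 1) * δ) γ)) _ (fun k _ => ENNReal.measurable_ofReal.comp
      (incB_continuous hT L C hLcont _ _).measurable)]
    refine (mul_le_mul_right (hy3 j) _).trans ?_
    rw [Finset.mul_sum]
    refine Finset.sum_le_sum fun k _ => ?_
    have hdd : ((k : ℝ) + 1) * δ - k * δ = δ := by ring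
    have hi : ∀ t, Integrable (fun γ : Traj d T => evalAt hT t γ) (S j) := fun t =>
      (ContinuousMap.evalCLM ℝ (Set.projIcc 0 T hT t) : Traj d T →L[ℝ] Euc d).integrable_comp
        (hIntg j)
    have hJ := jensen_enn (S j) (hSne j) L C hLconv hLcont hL0
      (fun γ => δ⁻¹ • (evalAt hT ((k + 1) * δ) γ - evalAt hT (k * δ) γ))
      (((hi ((k + 1) * δ)).sub (hi (k * δ))).smul δ⁻¹)
    have hav : (⨍ γ, δ⁻¹ • (evalAt hT ((k + 1) * δ) γ - evalAt hT (k * δ) γ) ∂(S j))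
        = δ⁻¹ • ((evalAt hT (((k + 1 : ℕ) : ℝ) * δ) (z j) + w j)
          - (evalAt hT (k * δ) (z j) + w j)) := by
      rw [add_sub_add_right_eq_sub, evalAt_average hT (S j) (hIntg j),
        evalAt_average hT (S j) (hIntg j), average_eq, average_eq, average_eq, integral_smul,
        integral_sub (hi _) (hi _)]
      push_cast
      module
    rw [hav, hS] at hJ
    simp only [incB, hdd]
    simp_rw [ENNReal.ofReal_mul hδ.le]
    rw [lintegral_const_mul' _ _ ENNReal.ofReal_ne_top, mul_left_comm]
    gcongr
  · intro j
    exact measurable_edist_right.add_const _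
  · intro j γ k hk
    rw [hy2 j k hk]
    calc edist (evalAt hT (k * δ) (z j) + w j) (evalAt hT (k * δ) γ)
        ≤ edist (evalAt hT (k * δ) (z j) + w j) (evalAt hT (k * δ) (z j))
          + edist (evalAt hT (k * δ) (z j)) (evalAt hT (k * δ) γ) := edist_triangle _ _ _
      _ ≤ ‖w j‖ₑ + edist (z j) γ := by
        refine add_le_add (le_of_eq ?_) (evalAt_edist_le _ _ _ _)
        rw [edist_eq_enorm_sub]; simp
      _ = _ := add_comm _ _
  · have hwb : ∑ j, (N : ℝ≥0∞)⁻¹ * ‖w j‖ₑ ^ 2 ≤ 2 * ∑ k, ∫⁻ z, edist (x k) z ^ 2 ∂(V k)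
        + 8 * ∑ j, ∫⁻ γ, edist (q j) γ ^ 2 ∂(S j) := by
      rw [← Finset.mul_sum]
      have e1 : ∀ j, ‖w j‖ₑ = edist (x (σ j)) (evalAt hT 0 (z j)) := fun j => by
        rw [edist_eq_enorm_sub]
      simp_rw [e1]
      refine hσ.trans (add_le_add le_rfl ?_)
      calc 2 * ∑ j, ∫⁻ γ, edist (evalAt hT 0 (z j)) (evalAt hT 0 γ) ^ 2 ∂(S j)
          ≤ 2 * ∑ j, ∫⁻ γ, edist (z j) γ ^ 2 ∂(S j) := by
            gcongr
            exact evalAt_edist_le _ _ _ _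
        _ ≤ 2 * (4 * ∑ j, ∫⁻ γ, edist (q j) γ ^ 2 ∂(S j)) := by gcongr
        _ = _ := by ring
    calc ∑ j, ∫⁻ γ, (edist (z j) γ + ‖w j‖ₑ) ^ 2 ∂(S j)
        ≤ ∑ j, (2 * ∫⁻ γ, edist (z j) γ ^ 2 ∂(S j) + 2 * ((N : ℝ≥0∞)⁻¹ * ‖w j‖ₑ ^ 2)) := by
          refine Finset.sum_le_sum fun j _ => ?_
          have hm : Measurable fun γ : Traj d T => edist (z j) γ ^ 2 :=
            measurable_edist_right.pow_const 2
          calc ∫⁻ γ, (edist (z j) γ + ‖w j‖ₑ) ^ 2 ∂(S j)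
              ≤ ∫⁻ γ, 2 * edist (z j) γ ^ 2 + 2 * ‖w j‖ₑ ^ 2 ∂(S j) :=
                lintegral_mono fun γ => enn_add_sq_le _ _
            _ = _ := by
                rw [lintegral_add_right _ measurable_const, lintegral_const, hS,
                  lintegral_const_mul _ hm]
                ring
      _ = 2 * ∑ j, ∫⁻ γ, edist (z j) γ ^ 2 ∂(S j) + 2 * ∑ j, (N : ℝ≥0∞)⁻¹ * ‖w j‖ₑ ^ 2 := by
          rw [Finset.sum_add_distrib, Finset.mul_sum, Finset.mul_sum]
      _ ≤ 2 * (4 * ∑ j, ∫⁻ γ, edist (q j) γ ^ 2 ∂(S j))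
          + 2 * (2 * ∑ k, ∫⁻ z, edist (x k) z ^ 2 ∂(V k)
            + 8 * ∑ j, ∫⁻ γ, edist (q j) γ ^ 2 ∂(S j)) := by gcongr
      _ = _ := by ring

theorem pieces_of_W2 {X : Type*} [MeasurableSpace X] [PseudoMetricSpace X]
    [SecondCountableTopology X] [OpensMeasurableSpace X] [MeasurableSingletonClass X]
    {N : ℕ} (p : Fin N → X) (ν : Measure X) (b : ℝ≥0∞)
    (h : W2sq ((N : ℝ≥0∞)⁻¹ • ∑ i, Measure.dirac (p i)) ν < b) :
    ∃ V : Fin N → Measure X, (∀ i, V i univ = (N : ℝ≥0∞)⁻¹) ∧ ∑ i, V i = ν ∧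
      ∑ i, ∫⁻ z, edist (p i) z ^ 2 ∂(V i) ≤ b := by
  unfold W2sq at h
  simp only [iInf_lt_iff] at h
  obtain ⟨π, ⟨h1, h2⟩, h3⟩ := h
  obtain ⟨V, hV1, hV2, hV3⟩ := pieces_exist p π h1
  refine ⟨V, hV1, hV2.trans h2, ?_⟩
  have := hV3 (fun q => edist q.1 q.2 ^ 2) (by fun_prop)
  simp only at this
  rw [this]
  refine le_trans (le_of_eq ?_) h3.le
  refine lintegral_congr fun q => ?_
  rw [edist_dist, ENNReal.ofReal_pow dist_nonneg]

theorem support_lemma {d : ℕ} {T : ℝ} (hT : 0 < T) (Ω : Set (Euc d)) (hΩ : IsClosed Ω)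
    (F : Measure (Euc d) → ℝ≥0∞) (hFsupp : ∀ ρ : Measure (Euc d), F ρ ≠ ⊤ → ρ Ωᶜ = 0)
    (Q : Measure (Traj d T))
    (hF : ∫⁻ t in Set.Ioc (0:ℝ) T, F (Q.map (evalAt hT.le t)) ≠ ⊤)
    (s : ℝ) (hs : s ∈ Icc 0 T) : ∀ᵐ γ ∂Q, evalAt hT.le s γ ∈ Ω := by
  have key : ∀ n : ℕ, ∃ t : ℝ, |t - s| ≤ 1 / ((n : ℝ) + 1) ∧ F (Q.map (evalAt hT.le t)) ≠ ⊤ := by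
    intro n
    by_contra hcon
    push Not at hcon
    apply hF
    set η : ℝ := 1 / ((n : ℝ) + 1) with hη
    have hη0 : 0 < η := by positivity
    have hlt : max 0 (s - η) < min T (s + η) := by
      rw [max_lt_iff, lt_min_iff, lt_min_iff]
      refine ⟨⟨hT, ?_⟩, ?_, ?_⟩ <;> linarith [hs.1, hs.2]
    have hsub : Ioc (max 0 (s - η)) (min T (s + η)) ⊆ Ioc 0 T :=
      Ioc_subset_Ioc (le_max_left _ _) (min_le_left _ _)
    rw [eq_top_iff]
    calc (⊤ : ℝ≥0∞) = ∫⁻ t in Ioc (max 0 (s - η)) (min T (s + η)), ⊤ := by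
          rw [setLIntegral_const, Real.volume_Ioc, ENNReal.top_mul]
          rw [ne_eq, ENNReal.ofReal_eq_zero, not_le, sub_pos]
          exact hlt
      _ ≤ ∫⁻ t in Ioc (max 0 (s - η)) (min T (s + η)), F (Q.map (evalAt hT.le t)) := by
          refine setLIntegral_mono' measurableSet_Ioc fun t ht => ?_
          rw [hcon t]
          have h1 := (le_max_right 0 (s - η)).trans ht.1.le
          have h2 := ht.2.trans (min_le_right _ _)
          rw [abs_le]
          constructor <;> linarith
      _ ≤ _ := lintegral_mono_set hsub
  choose t ht1 ht2 using key
  have hae : ∀ᵐ γ ∂Q, ∀ n, evalAt hT.le (t n) γ ∈ Ω := by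
    rw [ae_all_iff]
    intro n
    have := hFsupp _ (ht2 n)
    rw [Measure.map_apply (evalAt_measurable hT.le _) hΩ.measurableSet.compl] at this
    exact this
  filter_upwards [hae] with γ hγ
  have hlim : Tendsto t atTop (𝓝 s) := by
    rw [tendsto_iff_dist_tendsto_zero]
    refine squeeze_zero (fun _ => dist_nonneg) (fun n => ?_)
      tendsto_one_div_add_atTop_nhds_zero_nat
    rw [Real.dist_eq]; exact ht1 n
  have hc : Continuous (fun u => evalAt hT.le u γ) := by
    unfold evalAt
    exact γ.continuous.comp continuous_projIcc
  exact hΩ.mem_of_tendsto ((hc.tendsto s).comp hlim) (Eventually.of_forall hγ)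

theorem pick_time (f : ℝ → ℝ≥0∞) (a b : ℝ) (hab : a < b) (η : ℝ≥0∞) (hη : η ≠ 0)
    (hI : ∫⁻ t in Ioc a b, f t ≠ ⊤) :
    ∃ t ∈ Ioc a b, ENNReal.ofReal (b - a) * f t
      ≤ (∫⁻ t in Ioc a b, f t) + ENNReal.ofReal (b - a) * η := by
  by_contra hcon
  push Not at hcon
  set I := ∫⁻ t in Ioc a b, f t with hIdef
  set l := ENNReal.ofReal (b - a) with hl
  have hl0 : l ≠ 0 := by simpa [hl] using hab
  have hlt : l ≠ ⊤ := ENNReal.ofReal_ne_top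
  have h1 : l * I + l * (l * η) ≤ l * I := by
    calc l * I + l * (l * η) = ∫⁻ t in Ioc a b, (I + l * η) := by
          rw [setLIntegral_const, Real.volume_Ioc, ← hl]; ring
      _ ≤ ∫⁻ t in Ioc a b, l * f t := setLIntegral_mono' measurableSet_Ioc fun t ht =>
          (hcon t ht).le
      _ = l * I := lintegral_const_mul' _ _ hlt
  have h2 : l * (l * η) = 0 := by
    have := ENNReal.le_of_add_le_add_left (a := l * I) (b := l * (l * η)) (c := 0)
      (ENNReal.mul_ne_top hlt hI) (by simpa using h1)
    simpa using this
  simp [hl0, hη] at h2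

theorem sum_intervals (f : ℝ → ℝ≥0∞) (δ : ℝ) (hδ : 0 < δ) (m : ℕ) :
    ∑ k ∈ Finset.range m, ∫⁻ t in Ioc (k * δ) ((k + 1) * δ), f t
      ≤ ∫⁻ t in Ioc 0 (m * δ), f t := by
  induction m with
  | zero => simp
  | succ m ih =>
    rw [Finset.sum_range_succ]
    have hu : Ioc 0 (((m + 1 : ℕ) : ℝ) * δ) = Ioc 0 (m * δ) ∪ Ioc (m * δ) ((m + 1) * δ) := by
      rw [Ioc_union_Ioc_eq_Ioc (by positivity) (by gcongr; linarith)]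
      push_cast; rfl
    rw [hu, lintegral_union measurableSet_Ioc (by
      rw [Set.disjoint_left]; intro x hx hx'; exact absurd hx.2 (not_le.2 hx'.1))]
    gcongr

theorem grid_sum_pointwise {d : ℕ} {T : ℝ} (hT : 0 ≤ T) (r C : ℝ) (hr : 1 < r) (hC : 0 < C)
    (L : Euc d → ℝ) (hLconv : ConvexOn ℝ Set.univ L) (hLcont : Continuous L)
    (hLgrow : ∀ p : Euc d, 1 / (r * C) * ‖p‖ ^ r - C ≤ L p)
    (hL0 : ∀ p, 0 ≤ L p + C) (δ : ℝ) (hδ : 0 < δ) (hδ1 : δ ≤ 1) (M : ℕ) (hM : (M : ℝ) * δ = T)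
    (D : ℝ) (hD : 1 ≤ D) (t : ℕ → ℝ) (ht : ∀ k < M, t k ∈ Ioc (k * δ) ((k + 1) * δ))
    (γ : Traj d T)
    (hγ : ∀ k < M, dist (evalAt hT ((k + 1) * δ) γ) (evalAt hT (t k) γ) ≤ D) :
    ∑ k ∈ Finset.range M, ENNReal.ofReal δ *
        edist (evalAt hT ((k + 1) * δ) γ) (evalAt hT (t k) γ) ^ 2
      ≤ ENNReal.ofReal (D ^ 2 * δ ^ (2 / (r / (r - 1)))) *
        (ENNReal.ofReal T + ENNReal.ofReal (r * C) * actionN L C γ) := by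
  have hP : 0 ≤ D ^ 2 * δ ^ (2 / (r / (r - 1))) := by positivity
  have hrC : 0 ≤ r * C := by positivity
  have h1 : ∀ k ∈ Finset.range M, ENNReal.ofReal δ *
        edist (evalAt hT ((k + 1) * δ) γ) (evalAt hT (t k) γ) ^ 2
      ≤ ENNReal.ofReal (D ^ 2 * δ ^ (2 / (r / (r - 1)))) * (ENNReal.ofReal δ
        + ENNReal.ofReal (r * C) * ENNReal.ofReal (incB hT L C (t k) ((k + 1) * δ) γ)) := by
    intro k hk
    have hk' := Finset.mem_range.1 hk
    have htk := ht k hk'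
    have hB : 0 ≤ incB hT L C (t k) ((k + 1) * δ) γ := incB_nonneg hT L C hL0 htk.2 γ
    have := inc_real_sq (h := (k + 1) * δ - t k) hr hδ hδ1 (by linarith [htk.2])
      (by have := htk.1; linarith) hD dist_nonneg (hγ k hk') (mul_nonneg hrC hB)
      (inc_pow hT r C hr hC L hLgrow γ htk.2)
    rw [edist_dist, ← ENNReal.ofReal_pow dist_nonneg, ← ENNReal.ofReal_mul hδ.le,
      ← ENNReal.ofReal_mul hrC, ← ENNReal.ofReal_add hδ.le (mul_nonneg hrC hB),
      ← ENNReal.ofReal_mul hP]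
    exact ENNReal.ofReal_le_ofReal this
  refine (Finset.sum_le_sum h1).trans ?_
  rw [← Finset.mul_sum, Finset.sum_add_distrib, ← Finset.mul_sum]
  gcongr
  · rw [Finset.sum_const, Finset.card_range, nsmul_eq_mul, ← hM, ENNReal.ofReal_mul (by positivity),
      ENNReal.ofReal_natCast]
  · exact action_ge hT L C hLconv hLcont hL0 γ δ hδ M hM t (fun k => (k + 1) * δ)
      (fun k hk => (ht k hk).1.le) (fun k hk => (ht k hk).2) (fun _ _ => le_rfl)

theorem unif_close {d : ℕ} {T : ℝ} (hT : 0 < T) (r C : ℝ) (hr : 1 < r) (hC : 0 < C)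
    (L : Euc d → ℝ) (hLconv : ConvexOn ℝ Set.univ L) (hLcont : Continuous L)
    (hLgrow : ∀ p : Euc d, 1 / (r * C) * ‖p‖ ^ r - C ≤ L p)
    (hL0 : ∀ p, 0 ≤ L p + C) (δ : ℝ) (hδ : 0 < δ) (M : ℕ) (hM : (M : ℝ) * δ = T)
    (y γ : Traj d T) (hy : PiecewiseAffine hT.le δ M y) (e : ℝ≥0∞)
    (he : ∀ k ≤ M, edist (evalAt hT.le (k * δ) y) (evalAt hT.le (k * δ) γ) ≤ e) :
    edist y γ ≤ e + ENNReal.ofReal (δ ^ ((r - 1) / r)) *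
      (1 + ENNReal.ofReal (r * C) * actionN L C γ) := by
  have hrC : 0 < r * C := by positivity
  have hp0 : 0 < δ ^ ((r - 1) / r) := by positivity
  by_cases hA : actionN L C γ = ⊤
  · rw [hA, ENNReal.mul_top (by simpa using hrC), add_top, ENNReal.mul_top (by simpa using hp0)]
    simp
  by_cases hetop : e = ⊤
  · simp [hetop]
  lift e to ℝ≥0 using hetop
  set A : ℝ := (actionN L C γ).toReal with hAdef
  have hA0 : 0 ≤ A := ENNReal.toReal_nonneg
  have hAe : actionN L C γ = ENNReal.ofReal A := (ENNReal.ofReal_toReal hA).symm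
  have hinc : ∀ s t, 0 ≤ s → s ≤ t → t ≤ T → t - s ≤ δ →
      dist (evalAt hT.le t γ) (evalAt hT.le s γ) ≤ δ ^ ((r - 1) / r) * (1 + r * C * A) := by
    intro s t hs hst ht hts
    have hB : 0 ≤ incB hT.le L C s t γ := incB_nonneg hT.le L C hL0 hst γ
    have hBA : incB hT.le L C s t γ ≤ A := by
      have := action_ge_one hT L C hLconv hLcont hL0 γ s t hs hst ht
      rw [hAe] at this
      exact (ENNReal.ofReal_le_ofReal_iff hA0).1 this
    refine (inc_real_one (h := t - s) hr hδ (by linarith) hts dist_nonneg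
      (mul_nonneg hrC.le hB) (inc_pow hT.le r C hr hC L hLgrow γ hst)).trans ?_
    gcongr
  have hrhs : (e : ℝ≥0∞) + ENNReal.ofReal (δ ^ ((r - 1) / r)) *
      (1 + ENNReal.ofReal (r * C) * actionN L C γ)
      = ENNReal.ofReal (e + δ ^ ((r - 1) / r) * (1 + r * C * A)) := by
    rw [hAe, ENNReal.ofReal_add (by positivity) (by positivity), ENNReal.ofReal_mul hp0.le,
      ENNReal.ofReal_add (by positivity) (by positivity), ENNReal.ofReal_mul hrC.le,
      ENNReal.ofReal_one, ENNReal.ofReal_coe_nnreal]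
  rw [hrhs, edist_dist]
  refine ENNReal.ofReal_le_ofReal ((ContinuousMap.dist_le (by positivity)).2 ?_)
  intro u
  obtain ⟨u, hu⟩ := u
  have hM0 : M ≠ 0 := by rintro rfl; simp at hM; linarith
  obtain ⟨k, hkM, hk1, hk2⟩ : ∃ k < M, (k : ℝ) * δ ≤ u ∧ u ≤ (k + 1) * δ := by
    by_cases huT : u = T
    · refine ⟨M - 1, by omega, ?_, ?_⟩
      · rw [huT, ← hM]; gcongr; omega
      · rw [huT, ← hM]; push_cast [Nat.one_le_iff_ne_zero.2 hM0]; simp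
    · have hul : u < T := lt_of_le_of_ne hu.2 huT
      have h0 : 0 ≤ u / δ := div_nonneg hu.1 hδ.le
      refine ⟨⌊u / δ⌋₊, ?_, ?_, ?_⟩
      · rw [Nat.floor_lt h0, div_lt_iff₀ hδ, hM]; exact hul
      · rw [← le_div_iff₀ hδ]; exact Nat.floor_le h0
      · rw [← div_le_iff₀ hδ]; exact (Nat.lt_floor_add_one _).le
  have hkT : ((k : ℝ) + 1) * δ ≤ T := by
    rw [← hM]; gcongr; exact_mod_cast hkM
  have hk0 : 0 ≤ (k : ℝ) * δ := by positivity
  have hev : ∀ g : Traj d T, g ⟨u, hu⟩ = evalAt hT.le u g := fun g => by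
    rw [evalAt_of_mem hT.le hu]
  rw [hev, hev]
  have heR : ∀ k ≤ M, dist (evalAt hT.le (k * δ) y) (evalAt hT.le (k * δ) γ) ≤ e := by
    intro k hk
    have := he k hk
    rw [edist_dist, ← ENNReal.ofReal_coe_nnreal] at this
    exact (ENNReal.ofReal_le_ofReal_iff e.2).1 this
  have m1 : evalAt hT.le (k * δ) y ∈ Metric.closedBall (evalAt hT.le u γ)
      (e + δ ^ ((r - 1) / r) * (1 + r * C * A)) := by
    rw [Metric.mem_closedBall]
    refine (dist_triangle _ (evalAt hT.le (k * δ) γ) _).trans (add_le_add (heR k hkM.le) ?_)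
    rw [dist_comm]
    exact hinc _ _ hk0 hk1 hu.2 (by linarith)
  have m2 : evalAt hT.le ((k + 1) * δ) y ∈ Metric.closedBall (evalAt hT.le u γ)
      (e + δ ^ ((r - 1) / r) * (1 + r * C * A)) := by
    rw [Metric.mem_closedBall]
    have := heR (k + 1) hkM
    push_cast at this
    refine (dist_triangle _ (evalAt hT.le ((k + 1) * δ) γ) _).trans (add_le_add this ?_)
    exact hinc _ _ hu.1 hk2 hkT (by linarith)
  set a := (u - k * δ) / δ with ha
  have ha0 : 0 ≤ a := div_nonneg (by linarith) hδ.le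
  have ha1 : a ≤ 1 := by rw [ha, div_le_one hδ]; linarith
  have hau : (1 - a) * (k * δ) + a * ((k + 1) * δ) = u := by
    rw [ha]; field_simp; ring
  have := hy k hkM a ⟨ha0, ha1⟩
  rw [hau] at this
  rw [this, ← Metric.mem_closedBall]
  exact convex_closedBall _ _ m1 m2 (by linarith) ha0 (by ring)

theorem moreau_sum_bound {d : ℕ} {T : ℝ} (hT : 0 < T) (Ω : Set (Euc d)) (hΩ : IsClosed Ω)
    (r C : ℝ) (hr : 1 < r) (hC : 0 < C)
    (L : Euc d → ℝ) (hLconv : ConvexOn ℝ Set.univ L) (hLcont : Continuous L)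
    (hLgrow : ∀ p : Euc d, 1 / (r * C) * ‖p‖ ^ r - C ≤ L p)
    (hL0 : ∀ p, 0 ≤ L p + C) (δ : ℝ) (hδ : 0 < δ) (hδ1 : δ ≤ 1) (M : ℕ) (hM : (M : ℝ) * δ = T)
    (D : ℝ) (hD : 1 ≤ D) (hDΩ : ∀ a ∈ Ω, ∀ b ∈ Ω, dist a b ≤ D)
    (F : Measure (Euc d) → ℝ≥0∞) (hFsupp : ∀ ρ : Measure (Euc d), F ρ ≠ ⊤ → ρ Ωᶜ = 0)
    (Q : Measure (Traj d T)) [IsProbabilityMeasure Q]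
    (hF : ∫⁻ t in Set.Ioc (0:ℝ) T, F (Q.map (evalAt hT.le t)) ≠ ⊤)
    (ε : ℝ) (hε : 0 < ε) (η : ℝ≥0∞) (hη : η ≠ 0) (hη' : η ≠ ⊤)
    {N : ℕ} (S : Fin N → Measure (Traj d T)) (hS : ∀ i, S i univ = (N : ℝ≥0∞)⁻¹)
    (hSQ : ∑ i, S i = Q) (y : Fin N → Traj d T) (E : Fin N → Traj d T → ℝ≥0∞)
    (hEm : ∀ j, Measurable (E j))
    (hE : ∀ j γ, ∀ k ≤ M, edist (evalAt hT.le (k * δ) (y j)) (evalAt hT.le (k * δ) γ) ≤ E j γ) :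
    ENNReal.ofReal δ * ∑ i ∈ Finset.Ico 1 M, moreau Ω F ε
        (((N : ℝ≥0∞)⁻¹ • ∑ j, Measure.dirac (y j)).map (evalAt hT.le (i * δ)))
      ≤ (∫⁻ t in Set.Ioc (0:ℝ) T, F (Q.map (evalAt hT.le t))) + ENNReal.ofReal T * η
        + (ENNReal.ofReal ε)⁻¹ * (2 * (ENNReal.ofReal T * ∑ j, ∫⁻ γ, E j γ ^ 2 ∂(S j))
          + 2 * (ENNReal.ofReal (D ^ 2 * δ ^ (2 / (r / (r - 1)))) *
        (ENNReal.ofReal T + ENNReal.ofReal (r * C) * ∫⁻ γ, actionN L C γ ∂Q))) := by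
  set f : ℝ → ℝ≥0∞ := fun t => F (Q.map (evalAt hT.le t)) with hf
  have hkT : ∀ k < M, ((k : ℝ) + 1) * δ ≤ T := by
    intro k hk
    rw [← hM]; gcongr; exact_mod_cast hk
  have hIk : ∀ k : ℕ, k < M → ∫⁻ t in Ioc (k * δ) ((k + 1) * δ), f t ≠ ⊤ := by
    intro k hk
    refine ne_top_of_le_ne_top hF (lintegral_mono_set (Ioc_subset_Ioc (by positivity) (hkT k hk)))
  have hch : ∀ k : ℕ, ∃ t, k < M → t ∈ Ioc (k * δ) ((k + 1) * δ) ∧ ENNReal.ofReal δ * f t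
      ≤ (∫⁻ t in Ioc (k * δ) ((k + 1) * δ), f t) + ENNReal.ofReal δ * η := by
    intro k
    by_cases hk : k < M
    · obtain ⟨t, h1, h2⟩ := pick_time f (k * δ) ((k + 1) * δ) (by gcongr; linarith) η hη (hIk k hk)
      have : ((k : ℝ) + 1) * δ - k * δ = δ := by ring
      rw [this] at h2
      exact ⟨t, fun _ => ⟨h1, h2⟩⟩
    · exact ⟨0, fun h => absurd h hk⟩
  choose t ht using hch
  have htf : ∀ k < M, f (t k) ≠ ⊤ := by
    intro k hk h
    have := (ht k hk).2
    rw [h, ENNReal.mul_top (by simpa using hδ), top_le_iff] at this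
    exact ENNReal.add_ne_top.2 ⟨hIk k hk, ENNReal.mul_ne_top ENNReal.ofReal_ne_top hη'⟩ this
  set e : ℝ≥0∞ := ∑ j, ∫⁻ γ, E j γ ^ 2 ∂(S j) with he
  let g : ℕ → Traj d T → ℝ≥0∞ := fun k γ =>
    edist (evalAt hT.le ((k + 1) * δ) γ) (evalAt hT.le (t k) γ) ^ 2
  have hgm : ∀ k, Measurable (g k) := fun k =>
    ((evalAt_measurable hT.le _).edist (evalAt_measurable hT.le _)).pow_const 2
  -- one term
  have hterm : ∀ k < M, moreau Ω F ε
        (((N : ℝ≥0∞)⁻¹ • ∑ j, Measure.dirac (y j)).map (evalAt hT.le ((k + 1) * δ)))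
      ≤ (ENNReal.ofReal ε)⁻¹ * (2 * e + 2 * ∫⁻ γ, g k γ ∂Q) + f (t k) := by
    intro k hk
    have hadm : IsProbabilityMeasure (Q.map (evalAt hT.le (t k))) ∧
        (Q.map (evalAt hT.le (t k))) Ωᶜ = 0 :=
      ⟨Measure.isProbabilityMeasure_map (evalAt_measurable hT.le _).aemeasurable,
        hFsupp _ (htf k hk)⟩
    refine (iInf₂_le (Q.map (evalAt hT.le (t k))) hadm).trans ?_
    refine add_le_add ?_ le_rfl
    rw [div_eq_mul_inv, mul_comm]
    refine mul_le_mul' ?_ ?_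
    · rw [ENNReal.inv_le_inv]
      exact ENNReal.ofReal_le_ofReal (by linarith)
    · rw [Measure.map_smul, Measure.map_finset_sum (evalAt_measurable hT.le _).aemeasurable]
      simp_rw [Measure.map_dirac' (evalAt_measurable hT.le _)]
      rw [← hSQ]
      refine (W2sq_le_pieces S hS _ _ (evalAt_measurable hT.le _)).trans ?_
      rw [lintegral_finsetSum_measure, he, Finset.mul_sum, Finset.mul_sum,
        ← Finset.sum_add_distrib]
      refine Finset.sum_le_sum fun j _ => ?_
      rw [← lintegral_const_mul _ ((hEm j).pow_const 2), ← lintegral_const_mul _ (hgm k),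
        ← lintegral_add_left (((hEm j).pow_const 2).const_mul 2)]
      refine lintegral_mono fun γ => ?_
      refine le_trans ?_ (enn_add_sq_le _ _)
      gcongr
      refine (edist_triangle _ (evalAt hT.le ((k + 1) * δ) γ) _).trans (add_le_add ?_ le_rfl)
      have := hE j γ (k + 1) hk
      push_cast at this
      exact this
  -- shift the index
  have hshift : ∑ i ∈ Finset.Ico 1 M, moreau Ω F ε
        (((N : ℝ≥0∞)⁻¹ • ∑ j, Measure.dirac (y j)).map (evalAt hT.le (i * δ)))
      ≤ ∑ k ∈ Finset.range M,
        ((ENNReal.ofReal ε)⁻¹ * (2 * e + 2 * ∫⁻ γ, g k γ ∂Q) + f (t k)) := by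
    rw [Finset.sum_Ico_eq_sum_range]
    calc _ ≤ ∑ k ∈ Finset.range (M - 1),
        ((ENNReal.ofReal ε)⁻¹ * (2 * e + 2 * ∫⁻ γ, g k γ ∂Q) + f (t k)) := by
          refine Finset.sum_le_sum fun k hk => ?_
          have hk' : k < M := by have := Finset.mem_range.1 hk; omega
          have := hterm k hk'
          push_cast
          rwa [add_comm (1 : ℝ)]
      _ ≤ _ := Finset.sum_le_sum_of_subset (Finset.range_subset_range.2 (by omega))
  have hMT : (M : ℝ≥0∞) * ENNReal.ofReal δ = ENNReal.ofReal T := by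
    rw [← hM, ENNReal.ofReal_mul (by positivity), ENNReal.ofReal_natCast]
  have hfsum : ∑ k ∈ Finset.range M, ENNReal.ofReal δ * f (t k)
      ≤ (∫⁻ t in Set.Ioc (0:ℝ) T, f t) + ENNReal.ofReal T * η := by
    refine (Finset.sum_le_sum fun k hk => (ht k (Finset.mem_range.1 hk)).2).trans ?_
    rw [Finset.sum_add_distrib, Finset.sum_const, Finset.card_range, nsmul_eq_mul, ← mul_assoc, hMT]
    have := sum_intervals f δ hδ M
    rw [hM] at this
    gcongr
  have hae : ∀ᵐ γ ∂Q, ∀ k : ℕ, k < M →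
      dist (evalAt hT.le ((k + 1) * δ) γ) (evalAt hT.le (t k) γ) ≤ D := by
    rw [ae_all_iff]
    intro k
    by_cases hk : k < M
    · have h0 : 0 ≤ (k : ℝ) * δ := by positivity
      have h1 := support_lemma hT Ω hΩ F hFsupp Q hF ((k + 1) * δ)
        ⟨by positivity, hkT k hk⟩
      have h2 := support_lemma hT Ω hΩ F hFsupp Q hF (t k)
        ⟨h0.trans (ht k hk).1.1.le, (ht k hk).1.2.trans (hkT k hk)⟩
      filter_upwards [h1, h2] with γ g1 g2 _
      exact hDΩ _ g1 _ g2
    · exact ae_of_all _ fun γ h => absurd h hk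
  have hgsum : ∑ k ∈ Finset.range M, ENNReal.ofReal δ * ∫⁻ γ, g k γ ∂Q
      ≤ ENNReal.ofReal (D ^ 2 * δ ^ (2 / (r / (r - 1)))) *
        (ENNReal.ofReal T + ENNReal.ofReal (r * C) * ∫⁻ γ, actionN L C γ ∂Q) := by
    calc ∑ k ∈ Finset.range M, ENNReal.ofReal δ * ∫⁻ γ, g k γ ∂Q
        = ∫⁻ γ, ∑ k ∈ Finset.range M, ENNReal.ofReal δ * g k γ ∂Q := by
          rw [lintegral_finsetSum (f := fun k γ => ENNReal.ofReal δ * g k γ) _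
            (fun k _ => (hgm k).const_mul _)]
          refine Finset.sum_congr rfl fun k _ => ?_
          rw [lintegral_const_mul _ (hgm k)]
      _ ≤ ∫⁻ γ, ENNReal.ofReal (D ^ 2 * δ ^ (2 / (r / (r - 1)))) *
        (ENNReal.ofReal T + ENNReal.ofReal (r * C) * actionN L C γ) ∂Q := by
          refine lintegral_mono_ae ?_
          filter_upwards [hae] with γ hγ
          exact grid_sum_pointwise hT.le r C hr hC L hLconv hLcont hLgrow hL0 δ hδ hδ1 M hM D hD t
            (fun k hk => (ht k hk).1) γ hγ
      _ = _ := by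
          rw [lintegral_const_mul' _ _ ENNReal.ofReal_ne_top, lintegral_add_left measurable_const,
            lintegral_const_mul' _ _ ENNReal.ofReal_ne_top]
          simp
  calc _ ≤ ENNReal.ofReal δ * ∑ k ∈ Finset.range M,
        ((ENNReal.ofReal ε)⁻¹ * (2 * e + 2 * ∫⁻ γ, g k γ ∂Q) + f (t k)) := by gcongr
    _ = ∑ k ∈ Finset.range M, ENNReal.ofReal δ * f (t k)
        + (ENNReal.ofReal ε)⁻¹ * (2 * (((M : ℝ≥0∞) * ENNReal.ofReal δ) * e)
          + 2 * ∑ k ∈ Finset.range M, ENNReal.ofReal δ * ∫⁻ γ, g k γ ∂Q) := by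
        simp_rw [Finset.sum_add_distrib, ← Finset.mul_sum, Finset.sum_add_distrib, ← Finset.mul_sum,
          Finset.sum_const, Finset.card_range, nsmul_eq_mul]
        ring
    _ ≤ _ := by
        rw [hMT]
        gcongr

theorem lip_bound {d : ℕ} {T : ℝ} {N : ℕ} (Q : Measure (Traj d T)) [IsProbabilityMeasure Q]
    (hN : N ≠ 0)
    (S : Fin N → Measure (Traj d T)) (hS : ∀ i, S i univ = (N : ℝ≥0∞)⁻¹)
    (hSQ : ∑ i, S i = Q) (y : Fin N → Traj d T) (f : BoundedContinuousFunction (Traj d T) ℝ)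
    (K : ℝ≥0) (hf : LipschitzWith K f) :
    edist (∫ γ, f γ ∂((N : ℝ≥0∞)⁻¹ • ∑ j, Measure.dirac (y j))) (∫ γ, f γ ∂Q)
      ≤ K * ∑ j, ∫⁻ γ, edist (y j) γ ∂(S j) := by
  have hN0 : (N : ℝ≥0∞) ≠ 0 := by exact_mod_cast hN
  have hNi : (N : ℝ≥0∞)⁻¹ < ⊤ := ENNReal.inv_lt_top.2 (pos_iff_ne_zero.2 hN0)
  have hSf : ∀ i, IsFiniteMeasure (S i) := fun i => ⟨by rw [hS]; exact hNi⟩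
  have h1 : ∫ γ, f γ ∂((N : ℝ≥0∞)⁻¹ • ∑ j, Measure.dirac (y j)) = ∑ j, ∫ γ, f (y j) ∂(S j) := by
    rw [integral_smul_measure, integral_finsetSum_measure (fun i _ => f.integrable _)]
    simp only [integral_dirac, integral_const, Measure.real, hS]
    rw [Finset.smul_sum]
  have h2 : ∫ γ, f γ ∂Q = ∑ j, ∫ γ, f γ ∂(S j) := by
    rw [← hSQ, integral_finsetSum_measure (fun i _ => f.integrable _)]
  rw [h1, h2, edist_eq_enorm_sub, ← Finset.sum_sub_distrib]
  refine (enorm_sum_le _ _).trans ?_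
  rw [Finset.mul_sum]
  refine Finset.sum_le_sum fun j _ => ?_
  rw [← integral_sub (integrable_const _) (f.integrable _)]
  refine (enorm_integral_le_lintegral_enorm _).trans ?_
  rw [← lintegral_const_mul _ measurable_edist_right]
  refine lintegral_mono fun γ => ?_
  rw [← edist_eq_enorm_sub]
  exact hf _ _

theorem step_exists {d : ℕ} {T : ℝ} (hT : 0 < T) (Ω : Set (Euc d)) (hΩ : IsClosed Ω)
    (r C : ℝ) (hr : 1 < r) (hC : 0 < C)
    (L : Euc d → ℝ) (hLconv : ConvexOn ℝ Set.univ L) (hLcont : Continuous L)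
    (hLgrow : ∀ p : Euc d, 1 / (r * C) * ‖p‖ ^ r - C ≤ L p)
    (hL0 : ∀ p, 0 ≤ L p + C) (δ : ℝ) (hδ : 0 < δ) (hδ1 : δ ≤ 1) (M : ℕ) (hM : (M : ℝ) * δ = T)
    (D : ℝ) (hD : 1 ≤ D) (hDΩ : ∀ a ∈ Ω, ∀ b ∈ Ω, dist a b ≤ D)
    (F : Measure (Euc d) → ℝ≥0∞) (hFsupp : ∀ ρ : Measure (Euc d), F ρ ≠ ⊤ → ρ Ωᶜ = 0)
    (Q : Measure (Traj d T)) [IsProbabilityMeasure Q]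
    (hF : ∫⁻ t in Set.Ioc (0:ℝ) T, F (Q.map (evalAt hT.le t)) ≠ ⊤)
    (ε : ℝ) (hε : 0 < ε) (η : ℝ≥0∞) (hη : η ≠ 0) (hη' : η ≠ ⊤)
    {N : ℕ} (hN : N ≠ 0)
    {H : Type*} [NormedAddCommGroup H] [InnerProductSpace ℝ H]
    [SecondCountableTopology H] [MeasurableSpace H] [BorelSpace H]
    (ι : H →L[ℝ] Traj d T) (R : Measure H) (hRι : R.map ι = Q)
    (μN : Measure (Euc d)) (hμN : IsUnifDiscrete N μN) (c b : ℝ≥0∞) (hc : c ≠ ⊤)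
    (hcτ : (⨅ (P : Measure H) (_ : IsUnifDiscrete N P), W2sq P R) < c)
    (hbW : W2sq μN (Q.map (evalAt hT.le 0)) < b) :
    ∃ Q' : Measure (Traj d T), IsUnifDiscreteAffine hT.le N δ M Q' ∧
      Q'.map (evalAt hT.le 0) = μN ∧
      ∫⁻ γ, actionN L C γ ∂Q' ≤ ∫⁻ γ, actionN L C γ ∂Q ∧
      ENNReal.ofReal δ * ∑ i ∈ Finset.Ico 1 M, moreau Ω F ε (Q'.map (evalAt hT.le (i * δ)))
      ≤ (∫⁻ t in Set.Ioc (0:ℝ) T, F (Q.map (evalAt hT.le t))) + ENNReal.ofReal T * η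
        + (ENNReal.ofReal ε)⁻¹ * (2 * (ENNReal.ofReal T * (24 * (‖ι‖ₑ ^ 2 * c) + 4 * b))
          + 2 * (ENNReal.ofReal (D ^ 2 * δ ^ (2 / (r / (r - 1)))) *
        (ENNReal.ofReal T + ENNReal.ofReal (r * C) * ∫⁻ γ, actionN L C γ ∂Q))) ∧
      ∀ (f : BoundedContinuousFunction (Traj d T) ℝ) (K : ℝ≥0), LipschitzWith K f →
        edist (∫ γ, f γ ∂Q') (∫ γ, f γ ∂Q) ≤ K * (ENNReal.ofReal ε
          + (ENNReal.ofReal ε)⁻¹ * (24 * (‖ι‖ₑ ^ 2 * c) + 4 * b)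
          + ENNReal.ofReal (δ ^ ((r - 1) / r)) *
            (1 + ENNReal.ofReal (r * C) * ∫⁻ γ, actionN L C γ ∂Q)) := by
  simp only [iInf_lt_iff] at hcτ
  obtain ⟨P, ⟨p, rfl⟩, hP⟩ := hcτ
  obtain ⟨x, rfl⟩ := hμN
  obtain ⟨ν, hν1, hν2, hν3⟩ := pieces_of_W2 p R c hP
  obtain ⟨V, hV1, hV2, hV3⟩ := pieces_of_W2 x _ b hbW
  have hιm : Measurable ι := ι.continuous.measurable
  let S : Fin N → Measure (Traj d T) := fun j => (ν j).map ι
  have hS : ∀ j, S j univ = (N : ℝ≥0∞)⁻¹ := fun j => by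
    simp only [S]
    rw [Measure.map_apply hιm MeasurableSet.univ, preimage_univ, hν1]
  have hSQ : ∑ j, S j = Q := by
    simp only [S]
    rw [← Measure.map_finset_sum hιm.aemeasurable, hν2, hRι]
  have hιe : ∀ a b : H, edist (ι a) (ι b) ≤ ‖ι‖ₑ * edist a b := by
    intro a b
    rw [edist_eq_enorm_sub, edist_eq_enorm_sub, ← map_sub]
    exact ι.le_opNorm_enorm _
  have hcost : ∑ j, ∫⁻ γ, edist (ι (p j)) γ ^ 2 ∂(S j) ≤ ‖ι‖ₑ ^ 2 * c := by
    calc ∑ j, ∫⁻ γ, edist (ι (p j)) γ ^ 2 ∂(S j)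
        ≤ ∑ j, ‖ι‖ₑ ^ 2 * ∫⁻ z, edist (p j) z ^ 2 ∂(ν j) := by
          refine Finset.sum_le_sum fun j _ => ?_
          have hm : Measurable fun γ : Traj d T => edist (ι (p j)) γ ^ 2 :=
            measurable_edist_right.pow_const 2
          simp only [S]
          rw [lintegral_map hm hιm, ← lintegral_const_mul _ (measurable_edist_right.pow_const 2)]
          refine lintegral_mono fun z => ?_
          rw [← mul_pow]
          gcongr
          exact hιe _ _
      _ ≤ _ := by rw [← Finset.mul_sum]; gcongr
  have hcost' : ∑ j, ∫⁻ γ, edist (ι (p j)) γ ^ 2 ∂(S j) ≠ ⊤ :=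
    ne_top_of_le_ne_top (ENNReal.mul_ne_top (ENNReal.pow_ne_top enorm_ne_top) hc) hcost
  obtain ⟨y, E, hy1, hy2, hy3, hy4, hy5, hy6⟩ := competitor hT.le L C hLconv hLcont hL0 δ hδ M hM
    hN S hS (fun j => ι (p j)) hcost' V hV1 (by rw [hV2, hSQ]) x
  have hEe : ∑ j, ∫⁻ γ, E j γ ^ 2 ∂(S j) ≤ 24 * (‖ι‖ₑ ^ 2 * c) + 4 * b :=
    hy6.trans (by gcongr)
  refine ⟨(N : ℝ≥0∞)⁻¹ • ∑ j, Measure.dirac (y j), ⟨y, hy1, rfl⟩, hy2, ?_, ?_, ?_⟩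
  · rw [lintegral_smul_measure, lintegral_finsetSum_measure]
    simp only [lintegral_dirac, smul_eq_mul]
    rwa [hSQ] at hy3
  · refine (moreau_sum_bound hT Ω hΩ r C hr hC L hLconv hLcont hLgrow hL0 δ hδ hδ1 M hM D hD hDΩ F
      hFsupp Q hF ε hε η hη hη' S hS hSQ y E hy4 hy5).trans ?_
    gcongr
  · intro f K hf
    refine (lip_bound Q hN S hS hSQ y f K hf).trans ?_
    gcongr
    have he0 : ENNReal.ofReal ε ≠ 0 := by simpa using hε
    have het : ENNReal.ofReal ε ≠ ⊤ := ENNReal.ofReal_ne_top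
    have hpt : ∀ a : ℝ≥0∞, a ≤ ENNReal.ofReal ε + (ENNReal.ofReal ε)⁻¹ * a ^ 2 := by
      intro a
      rcases le_total a (ENNReal.ofReal ε) with h | h
      · exact h.trans le_self_add
      · refine le_trans ?_ le_add_self
        calc a = (ENNReal.ofReal ε)⁻¹ * (ENNReal.ofReal ε * a) := by
              rw [← mul_assoc, ENNReal.inv_mul_cancel he0 het, one_mul]
          _ ≤ _ := by rw [pow_two]; gcongr
    set κ : ℝ≥0∞ := ENNReal.ofReal (δ ^ ((r - 1) / r)) with hκ
    have hκt : κ ≠ ⊤ := ENNReal.ofReal_ne_top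
    have hone : ∑ j : Fin N, (N : ℝ≥0∞)⁻¹ = 1 := by
      rw [Finset.sum_const, Finset.card_univ, Fintype.card_fin, nsmul_eq_mul]
      exact ENNReal.mul_inv_cancel (by exact_mod_cast hN) (ENNReal.natCast_ne_top N)
    calc ∑ j, ∫⁻ γ, edist (y j) γ ∂(S j)
        ≤ ∑ j, (ENNReal.ofReal ε * (N : ℝ≥0∞)⁻¹ + (ENNReal.ofReal ε)⁻¹ * ∫⁻ γ, E j γ ^ 2 ∂(S j)
          + κ * ((N : ℝ≥0∞)⁻¹ + ENNReal.ofReal (r * C) * ∫⁻ γ, actionN L C γ ∂(S j))) := by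
          refine Finset.sum_le_sum fun j _ => ?_
          have m1 : Measurable fun γ => (ENNReal.ofReal ε)⁻¹ * E j γ ^ 2 :=
            ((hy4 j).pow_const 2).const_mul _
          have m2 : Measurable fun γ => ENNReal.ofReal ε + (ENNReal.ofReal ε)⁻¹ * E j γ ^ 2 :=
            m1.const_add _
          calc ∫⁻ γ, edist (y j) γ ∂(S j)
              ≤ ∫⁻ γ, (ENNReal.ofReal ε + (ENNReal.ofReal ε)⁻¹ * E j γ ^ 2)
                + κ * (1 + ENNReal.ofReal (r * C) * actionN L C γ) ∂(S j) := by
                refine lintegral_mono fun γ => ?_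
                refine (unif_close hT r C hr hC L hLconv hLcont hLgrow hL0 δ hδ M hM (y j) γ
                  (hy1 j) (E j γ) (hy5 j γ)).trans ?_
                gcongr
                exact hpt _
            _ = _ := by
                rw [lintegral_add_left m2, lintegral_add_left measurable_const,
                  lintegral_const_mul' _ _ hκt, lintegral_add_left measurable_const,
                  lintegral_const_mul' _ _ ENNReal.ofReal_ne_top,
                  lintegral_const_mul _ ((hy4 j).pow_const 2), lintegral_const, lintegral_const,
                  hS, one_mul]
      _ = ENNReal.ofReal ε + (ENNReal.ofReal ε)⁻¹ * ∑ j, ∫⁻ γ, E j γ ^ 2 ∂(S j)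
          + κ * (1 + ENNReal.ofReal (r * C) * ∫⁻ γ, actionN L C γ ∂Q) := by
          rw [← hSQ, lintegral_finsetSum_measure, Finset.sum_add_distrib, Finset.sum_add_distrib,
            ← Finset.mul_sum, ← Finset.mul_sum, ← Finset.mul_sum, Finset.sum_add_distrib,
            ← Finset.mul_sum, hone, mul_one]
      _ ≤ _ := by gcongr

theorem unif_prob {X : Type*} [MeasurableSpace X] {N : ℕ} (hN : N ≠ 0) (x : Fin N → X) :
    IsProbabilityMeasure ((N : ℝ≥0∞)⁻¹ • ∑ i, Measure.dirac (x i)) := by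
  constructor
  rw [Measure.smul_apply, Measure.coe_finsetSum]
  simp only [Finset.sum_apply, measure_univ, Finset.sum_const, Finset.card_univ, Fintype.card_fin,
    nsmul_eq_mul, smul_eq_mul, mul_one]
  exact ENNReal.inv_mul_cancel (by exact_mod_cast hN) (ENNReal.natCast_ne_top N)

theorem narrow_of_lip {d : ℕ} {T : ℝ} (Q' : ℕ → Measure (Traj d T)) (Q : Measure (Traj d T))
    (h' : ∀ n, IsProbabilityMeasure (Q' n)) (h : IsProbabilityMeasure Q)
    (hl : ∀ (f : BoundedContinuousFunction (Traj d T) ℝ) (K : ℝ≥0), LipschitzWith K f →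
      Tendsto (fun n => ∫ γ, f γ ∂(Q' n)) atTop (𝓝 (∫ γ, f γ ∂Q))) : NarrowTendsto Q' Q := by
  intro f
  have := (ProbabilityMeasure.tendsto_iff_forall_integral_tendsto
    (μs := fun n => (⟨Q' n, h' n⟩ : ProbabilityMeasure (Traj d T))) (μ := ⟨Q, h⟩) (F := atTop)).1 ?_ f
  · exact this
  · refine tendsto_iff_forall_lipschitz_integral_tendsto.2 ?_
    rintro g hg ⟨K, hK⟩
    obtain ⟨Cg, hCg⟩ := hg
    exact hl (BoundedContinuousFunction.mkOfBound ⟨g, hK.continuous⟩ Cg hCg) K hK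

theorem tz_mul {u : ℕ → ℝ≥0∞} (c : ℝ≥0∞) (hc : c ≠ ⊤) (h : Tendsto u atTop (𝓝 0)) :
    Tendsto (fun n => c * u n) atTop (𝓝 0) := by
  have := ENNReal.Tendsto.const_mul (a := c) h (Or.inr hc)
  rwa [mul_zero] at this

theorem tz_add {u v : ℕ → ℝ≥0∞} (h : Tendsto u atTop (𝓝 0)) (h' : Tendsto v atTop (𝓝 0)) :
    Tendsto (fun n => u n + v n) atTop (𝓝 0) := by
  have := h.add h'
  rwa [add_zero] at this

theorem Jfun_top {d : ℕ} {T : ℝ} (hT : 0 ≤ T) (L : Euc d → ℝ) (C : ℝ)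
    (F : Measure (Euc d) → ℝ≥0∞) (G : Measure (Traj d T) → ℝ)
    (Q : Measure (Traj d T)) (h : (∫⁻ γ, actionN L C γ ∂Q) = ⊤ ∨
      ∫⁻ t in Set.Ioc (0:ℝ) T, F (Q.map (evalAt hT t)) = ⊤) : Jfun hT L C F G Q = ⊤ := by
  have key : ∀ a b : ℝ≥0∞, (a = ⊤ ∨ b = ⊤) → ∀ x y : ℝ,
      ((a : EReal) - (x : EReal)) + (b : EReal) + (y : EReal) = ⊤ := by
    intro a b hab x y
    have hb : (b : EReal) ≠ ⊥ := EReal.coe_ennreal_ne_bot b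
    have ha : (a : EReal) - (x : EReal) ≠ ⊥ := by
      rw [sub_eq_add_neg, ← EReal.coe_neg]
      simp [EReal.add_eq_bot_iff]
    have h1 : ((a : EReal) - (x : EReal)) + (b : EReal) = ⊤ := by
      rcases hab with rfl | rfl
      · rw [EReal.coe_ennreal_top, EReal.top_sub_coe, EReal.top_add_of_ne_bot hb]
      · rw [EReal.coe_ennreal_top, EReal.add_top_of_ne_bot ha]
    rw [h1, EReal.top_add_coe]
  exact key _ _ h _ _

theorem J_real {a b : ℝ≥0∞} (ha : a ≠ ⊤) (hb : b ≠ ⊤) (x y : ℝ) :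
    ((a : EReal) - (x : EReal)) + (b : EReal) + (y : EReal)
      = ((a.toReal - x + b.toReal + y : ℝ) : EReal) := by
  lift a to ℝ≥0 using ha
  lift b to ℝ≥0 using hb
  push_cast
  rfl

/-- **Fully discrete, upper bound.** Assume `δ_N, ε_N → 0`, `μ⁰_N → μ⁰`
narrowly, `τ_N = o(ε_N)`, `W₂²(μ⁰_N,μ⁰) = o(ε_N)` and `δ_N^{2/r'} = o(ε_N)` with
`r' = r/(r−1)`.  Then for every sequence `(Q_N)` of minimizers of the fully discrete
problems `(M_{N,μ⁰_N,δ_N,ε_N})`, `limsup_N J_{δ_N,ε_N}(Q_N) ≤ J(Q_min)`. -/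
theorem fully_discrete_upper_bound
    (d : ℕ) (T : ℝ) (hT : 0 < T)
    (Ω : Set (Euc d)) (hΩc : IsCompact Ω) (hΩmeas : MeasurableSet Ω) (hΩne : Ω.Nonempty)
    (r C : ℝ) (hr : 1 < r) (hC : 0 < C)
    (L : Euc d → ℝ) (hLconv : ConvexOn ℝ Set.univ L) (hLcont : Continuous L)
    (hLgrow : ∀ p : Euc d, 1 / (r * C) * ‖p‖ ^ r - C ≤ L p ∧ L p ≤ C / r * ‖p‖ ^ r + C)
    (F : Measure (Euc d) → ℝ≥0∞)
    (hFlsc : ∀ (ρ : ℕ → Measure (Euc d)) (σ : Measure (Euc d)),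
      (∀ n, IsFiniteMeasure (ρ n)) → IsFiniteMeasure σ → NarrowTendsto ρ σ →
      F σ ≤ liminf (fun n => F (ρ n)) atTop)
    (hFsupp : ∀ ρ : Measure (Euc d), F ρ ≠ ⊤ → ρ Ωᶜ = 0)
    (G : Measure (Traj d T) → ℝ)
    (hGcont : ∀ (Q : ℕ → Measure (Traj d T)) (Q' : Measure (Traj d T)),
      (∀ n, IsProbabilityMeasure (Q n)) → IsProbabilityMeasure Q' →
      NarrowTendsto Q Q' → Tendsto (fun n => G (Q n)) atTop (𝓝 (G Q')))
    (hGbdd : BddBelow (Set.range G))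
    (μ0 : Measure (Euc d)) (hμ0 : IsProbabilityMeasure μ0)
    (hμ0Ω : μ0 Ωᶜ = 0) (hμ0ac : μ0 ≪ volume)
    -- `Q_min`, a minimizer of the continuous problem
    (Qmin : Measure (Traj d T)) (hQminP : IsProbabilityMeasure Qmin)
    (hQmin0 : Qmin.map (evalAt hT.le 0) = μ0)
    (hQminmin : ∀ Q : Measure (Traj d T), IsProbabilityMeasure Q →
      Q.map (evalAt hT.le 0) = μ0 → Jfun hT.le L C F G Qmin ≤ Jfun hT.le L C F G Q)
    -- the Sobolev space `H = H^s` carrying `Q_min`, and the quantization error `τ_N`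
    (H : Type*) [NormedAddCommGroup H] [InnerProductSpace ℝ H] [CompleteSpace H]
    [SecondCountableTopology H] [MeasurableSpace H] [BorelSpace H]
    (ι : H →L[ℝ] Traj d T) (hι : Function.Injective ι) (hιcpt : IsCompactOperator ι)
    (R : Measure H) (hR : IsProbabilityMeasure R) (hRι : R.map ι = Qmin)
    (τ : ℕ → ℝ≥0∞)
    (hτ : ∀ N, τ N = ⨅ (P : Measure H) (_ : IsUnifDiscrete N P), W2sq P R)
    -- parameters of the discretization
    (δ : ℕ → ℝ) (M : ℕ → ℕ) (hδpos : ∀ N, 0 < δ N) (hMδ : ∀ N, (M N : ℝ) * δ N = T)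
    (hδlim : Tendsto δ atTop (𝓝 0))
    (ε : ℕ → ℝ) (hεpos : ∀ N, 0 < ε N) (hεlim : Tendsto ε atTop (𝓝 0))
    (μ0N : ℕ → Measure (Euc d))
    (hμ0N : ∀ N, IsUnifDiscrete N (μ0N N) ∧ (μ0N N) Ωᶜ = 0)
    (hμ0Ncv : NarrowTendsto μ0N μ0)
    (hτsmall : Tendsto (fun N => τ N / ENNReal.ofReal (ε N)) atTop (𝓝 0))
    (hW2small : Tendsto (fun N => W2sq (μ0N N) μ0 / ENNReal.ofReal (ε N)) atTop (𝓝 0))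
    (hδsmall : Tendsto
      (fun N => ENNReal.ofReal ((δ N) ^ (2 / (r / (r - 1)))) / ENNReal.ofReal (ε N))
      atTop (𝓝 0))
    -- a sequence of minimizers of the fully discrete problems
    (Q : ℕ → Measure (Traj d T))
    (hQdisc : ∀ N, IsUnifDiscreteAffine hT.le N (δ N) (M N) (Q N) ∧
      (Q N).map (evalAt hT.le 0) = μ0N N)
    (hQminN : ∀ N, ∀ Q' : Measure (Traj d T),
      IsUnifDiscreteAffine hT.le N (δ N) (M N) Q' →
      Q'.map (evalAt hT.le 0) = μ0N N →
      Jde hT.le Ω L C F G (δ N) (ε N) (M N) (Q N)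
        ≤ Jde hT.le Ω L C F G (δ N) (ε N) (M N) Q') :
    limsup (fun N => Jde hT.le Ω L C F G (δ N) (ε N) (M N) (Q N)) atTop
      ≤ Jfun hT.le L C F G Qmin := by
  have hL0 : ∀ p, 0 ≤ L p + C := fun p => by
    have h1 := (hLgrow p).1
    have h2 : 0 ≤ 1 / (r * C) * ‖p‖ ^ r := by positivity
    linarith
  by_cases hA : (∫⁻ γ, actionN L C γ ∂Qmin) = ⊤
  · rw [Jfun_top hT.le L C F G Qmin (Or.inl hA)]; exact le_top
  by_cases hF : ∫⁻ t in Set.Ioc (0:ℝ) T, F (Qmin.map (evalAt hT.le t)) = ⊤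
  · rw [Jfun_top hT.le L C F G Qmin (Or.inr hF)]; exact le_top
  obtain ⟨D, hD1, hD⟩ : ∃ D : ℝ, 1 ≤ D ∧ ∀ a ∈ Ω, ∀ b ∈ Ω, dist a b ≤ D :=
    ⟨max 1 (Metric.diam Ω), le_max_left _ _, fun a ha b hb =>
      (Metric.dist_le_diam_of_mem hΩc.isBounded ha hb).trans (le_max_right _ _)⟩
  let η : ℕ → ℝ≥0∞ := fun N => ((N : ℝ≥0∞) + 1)⁻¹
  have hη0 : ∀ N, η N ≠ 0 := fun N => by simp [η]
  have hηt : ∀ N, η N ≠ ⊤ := fun N => by simp [η]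
  have hηlim : Tendsto η atTop (𝓝 0) := by
    have := (tendsto_add_atTop_iff_nat 1).2 ENNReal.tendsto_inv_nat_nhds_zero
    refine this.congr fun n => ?_
    simp [η]
  have he0 : ∀ N, ENNReal.ofReal (ε N) ≠ 0 := fun N => by simpa using hεpos N
  have het : ∀ N, ENNReal.ofReal (ε N) ≠ ⊤ := fun N => ENNReal.ofReal_ne_top
  let c : ℕ → ℝ≥0∞ := fun N => τ N + ENNReal.ofReal (ε N) * η N
  let b : ℕ → ℝ≥0∞ := fun N => W2sq (μ0N N) μ0 + ENNReal.ofReal (ε N) * η N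
  let X : ℝ≥0∞ := ENNReal.ofReal T + ENNReal.ofReal (r * C) * ∫⁻ γ, actionN L C γ ∂Qmin
  have hXt : X ≠ ⊤ := ENNReal.add_ne_top.2 ⟨ENNReal.ofReal_ne_top,
    ENNReal.mul_ne_top ENNReal.ofReal_ne_top hA⟩
  let z : ℕ → ℝ≥0∞ := fun N => (ENNReal.ofReal (ε N))⁻¹ * (24 * (‖ι‖ₑ ^ 2 * c N) + 4 * b N)
  have hz : Tendsto z atTop (𝓝 0) := by
    have h24 : (24 : ℝ≥0∞) ≠ ⊤ := by simp
    have h4 : (4 : ℝ≥0∞) ≠ ⊤ := by simp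
    have := tz_add (tz_mul 24 h24 (tz_mul (‖ι‖ₑ ^ 2) (ENNReal.pow_ne_top enorm_ne_top)
      (tz_add hτsmall hηlim))) (tz_mul 4 h4 (tz_add hW2small hηlim))
    refine this.congr fun N => ?_
    have hinv : (ENNReal.ofReal (ε N))⁻¹ * (ENNReal.ofReal (ε N) * η N) = η N := by
      rw [← mul_assoc, ENNReal.inv_mul_cancel (he0 N) (het N), one_mul]
    simp only [z, c, b, div_eq_mul_inv]
    calc _ = 24 * (‖ι‖ₑ ^ 2 * (τ N * (ENNReal.ofReal (ε N))⁻¹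
          + (ENNReal.ofReal (ε N))⁻¹ * (ENNReal.ofReal (ε N) * η N)))
          + 4 * (W2sq (μ0N N) μ0 * (ENNReal.ofReal (ε N))⁻¹
          + (ENNReal.ofReal (ε N))⁻¹ * (ENNReal.ofReal (ε N) * η N)) := by rw [hinv]
      _ = _ := by ring
  let err : ℕ → ℝ≥0∞ := fun N => ENNReal.ofReal T * η N
        + (ENNReal.ofReal (ε N))⁻¹ * (2 * (ENNReal.ofReal T * (24 * (‖ι‖ₑ ^ 2 * c N) + 4 * b N))
          + 2 * (ENNReal.ofReal (D ^ 2 * (δ N) ^ (2 / (r / (r - 1)))) * X))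
  have herr : Tendsto err atTop (𝓝 0) := by
    have h2 : (2 : ℝ≥0∞) ≠ ⊤ := by simp
    have := tz_add (tz_add (tz_mul (ENNReal.ofReal T) ENNReal.ofReal_ne_top hηlim)
      (tz_mul 2 h2 (tz_mul (ENNReal.ofReal T) ENNReal.ofReal_ne_top hz)))
      (tz_mul (2 * (ENNReal.ofReal (D ^ 2) * X)) (ENNReal.mul_ne_top h2
        (ENNReal.mul_ne_top ENNReal.ofReal_ne_top hXt)) hδsmall)
    refine this.congr fun N => ?_
    simp only [z, err, div_eq_mul_inv]
    rw [ENNReal.ofReal_mul (by positivity : 0 ≤ D ^ 2)]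
    ring
  let w : ℕ → ℝ≥0∞ := fun N => ENNReal.ofReal (ε N) + z N
          + ENNReal.ofReal ((δ N) ^ ((r - 1) / r)) *
            (1 + ENNReal.ofReal (r * C) * ∫⁻ γ, actionN L C γ ∂Qmin)
  have hw : Tendsto w atTop (𝓝 0) := by
    have h1 : Tendsto (fun N => ENNReal.ofReal (ε N)) atTop (𝓝 0) := by
      have := ENNReal.tendsto_ofReal hεlim
      rwa [ENNReal.ofReal_zero] at this
    have hp : 0 < (r - 1) / r := div_pos (by linarith) (by linarith)
    have h2 : Tendsto (fun N => ENNReal.ofReal ((δ N) ^ ((r - 1) / r))) atTop (𝓝 0) := by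
      have h3 : Tendsto (fun N => (δ N) ^ ((r - 1) / r)) atTop (𝓝 (0 ^ ((r - 1) / r))) :=
        hδlim.rpow_const (Or.inr hp.le)
      rw [Real.zero_rpow hp.ne'] at h3
      have := ENNReal.tendsto_ofReal h3
      rwa [ENNReal.ofReal_zero] at this
    have h4 : (1 + ENNReal.ofReal (r * C) * ∫⁻ γ, actionN L C γ ∂Qmin) ≠ ⊤ :=
      ENNReal.add_ne_top.2 ⟨ENNReal.one_ne_top, ENNReal.mul_ne_top ENNReal.ofReal_ne_top hA⟩
    have := tz_add (tz_add h1 hz) (tz_mul _ h4 h2)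
    refine this.congr fun N => ?_
    simp only [w]
    ring
  -- the competitors
  let Good : ℕ → Prop := fun N => N ≠ 0 ∧ δ N ≤ 1 ∧ τ N ≠ ⊤ ∧ W2sq (μ0N N) μ0 ≠ ⊤
  have hne : ∀ u : ℕ → ℝ≥0∞, Tendsto (fun N => u N / ENNReal.ofReal (ε N)) atTop (𝓝 0) →
      ∀ᶠ N in atTop, u N ≠ ⊤ := by
    intro u hu
    filter_upwards [hu.eventually_lt_const (zero_lt_one' ℝ≥0∞)] with N hN h
    rw [h, ENNReal.top_div_of_ne_top (het N)] at hN
    exact absurd hN (by simp)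
  have hGood : ∀ᶠ N in atTop, Good N := by
    filter_upwards [eventually_ne_atTop 0, hδlim.eventually_le_const zero_lt_one, hne _ hτsmall,
      hne _ hW2small] with N h1 h2 h3 h4
    exact ⟨h1, h2, h3, h4⟩
  have hex : ∀ N, ∃ Q' : Measure (Traj d T), IsProbabilityMeasure Q' ∧ (Good N →
      IsUnifDiscreteAffine hT.le N (δ N) (M N) Q' ∧
      Q'.map (evalAt hT.le 0) = μ0N N ∧
      ∫⁻ γ, actionN L C γ ∂Q' ≤ ∫⁻ γ, actionN L C γ ∂Qmin ∧
      ENNReal.ofReal (δ N) * ∑ i ∈ Finset.Ico 1 (M N),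
        moreau Ω F (ε N) (Q'.map (evalAt hT.le (i * δ N)))
      ≤ (∫⁻ t in Set.Ioc (0:ℝ) T, F (Qmin.map (evalAt hT.le t))) + err N ∧
      ∀ (f : BoundedContinuousFunction (Traj d T) ℝ) (K : ℝ≥0), LipschitzWith K f →
        edist (∫ γ, f γ ∂Q') (∫ γ, f γ ∂Qmin) ≤ K * w N) := by
    intro N
    by_cases hg : Good N
    · obtain ⟨h1, h2, h3, h4⟩ := hg
      have hslack : ENNReal.ofReal (ε N) * η N ≠ 0 := mul_ne_zero (he0 N) (hη0 N)
      have hslackt : ENNReal.ofReal (ε N) * η N ≠ ⊤ := ENNReal.mul_ne_top (het N) (hηt N)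
      obtain ⟨Q', q1, q2, q3, q4, q5⟩ := step_exists hT Ω hΩc.isClosed r C hr hC L hLconv hLcont
        (fun p => (hLgrow p).1) hL0 (δ N) (hδpos N) h2 (M N) (hMδ N) D hD1 hD F hFsupp Qmin hF
        (ε N) (hεpos N) (η N) (hη0 N) (hηt N) h1 ι R hRι (μ0N N) (hμ0N N).1 (c N) (b N)
        (ENNReal.add_ne_top.2 ⟨h3, hslackt⟩)
        (by rw [← hτ N]; exact ENNReal.lt_add_right h3 hslack)
        (by rw [hQmin0]; exact ENNReal.lt_add_right h4 hslack)
      have hpr : IsProbabilityMeasure Q' := by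
        obtain ⟨x, _, rfl⟩ := q1
        exact unif_prob h1 x
      refine ⟨Q', hpr, fun _ => ⟨q1, q2, q3, ?_, q5⟩⟩
      rw [add_assoc] at q4
      exact q4
    · exact ⟨Qmin, hQminP, fun h => absurd h hg⟩
  choose Q' hQ'P hQ' using hex
  have hnarrow : NarrowTendsto Q' Qmin := by
    refine narrow_of_lip Q' Qmin hQ'P hQminP fun f K hf => ?_
    rw [tendsto_iff_edist_tendsto_0]
    refine tendsto_of_tendsto_of_tendsto_of_le_of_le' tendsto_const_nhds
      (tz_mul (K : ℝ≥0∞) ENNReal.coe_ne_top hw) (Eventually.of_forall fun _ => zero_le) ?_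
    filter_upwards [hGood] with N hN
    exact (hQ' N hN).2.2.2.2 f K hf
  have hGlim := hGcont Q' Qmin hQ'P hQminP hnarrow
  set A := ∫⁻ γ, actionN L C γ ∂Qmin with hAdef
  set Fi := ∫⁻ t in Set.Ioc (0:ℝ) T, F (Qmin.map (evalAt hT.le t)) with hFidef
  let u : ℕ → ℝ := fun N => A.toReal - C * T + (Fi + err N).toReal + G (Q' N)
  have hu : Tendsto u atTop (𝓝 (A.toReal - C * T + Fi.toReal + G Qmin)) := by
    have h1 : Tendsto (fun N => (Fi + err N).toReal) atTop (𝓝 Fi.toReal) := by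
      refine (ENNReal.tendsto_toReal hF).comp ?_
      have := (tendsto_const_nhds (x := Fi)).add herr
      rwa [add_zero] at this
    exact (tendsto_const_nhds.add h1).add hGlim
  have hJ : Jfun hT.le L C F G Qmin = ((A.toReal - C * T + Fi.toReal + G Qmin : ℝ) : EReal) :=
    J_real hA hF _ _
  have hlim : Tendsto (fun N => ((u N : ℝ) : EReal)) atTop (𝓝 (Jfun hT.le L C F G Qmin)) := by
    rw [hJ]
    exact (continuous_coe_real_ereal.tendsto _).comp hu
  rw [← hlim.limsup_eq]
  refine limsup_le_limsup ?_
  filter_upwards [hGood, herr.eventually_lt_const (zero_lt_one' ℝ≥0∞)] with N hN hN1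
  obtain ⟨q1, q2, q3, q4, q5⟩ := hQ' N hN
  refine (hQminN N (Q' N) q1 q2).trans ?_
  have het' : Fi + err N ≠ ⊤ := ENNReal.add_ne_top.2 ⟨hF, ne_top_of_lt hN1⟩
  simp only [u]
  rw [← J_real hA het']
  unfold Jde kinE
  refine add_le_add (add_le_add (EReal.sub_le_sub ?_ le_rfl) ?_) le_rfl
  · exact_mod_cast q3
  · exact_mod_cast q4
end

section
/- For any μ ∈ P(ℝ^d), F_ε(μ) = sup { ∫_{ℝ^d} φ dμ − F*(−φ^c) : φ c-concave }, where c(x,y) = ‖x−y‖²/(2ε). Moreover, this supremum is attained at a c-concave φ if and only if, for any ρ ∈ P(Ω) optimal in the primal problem defining F_ε(μ): (i) (φ, φ^c) is a pair of c-concave Kantorovich potentials for the optimal transport from μ to ρ with cost c, and (ii) −φ^c ∈ ∂F(ρ), equivalently ρ ∈ ∂F*(−φ^c). -/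
open MeasureTheory Filter Topology Set
open scoped ENNReal NNReal

noncomputable section

/-- the quadratic cost `c(x,y) = ‖x−y‖²/(2ε)` -/
def cost {d : ℕ} (ε : ℝ) (x y : Euc d) : ℝ := ‖x - y‖ ^ 2 / (2 * ε)

/-- optimal transport cost from `ρ` to `μ` for the cost `c` -/
def Icost {d : ℕ} (c : Euc d → Euc d → ℝ) (ρ μ : Measure (Euc d)) : ℝ≥0∞ :=
  ⨅ (π : Measure (Euc d × Euc d)) (_ : π.map Prod.fst = ρ ∧ π.map Prod.snd = μ),
    ∫⁻ p, ENNReal.ofReal (c p.1 p.2) ∂π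

/-- the Moreau envelope `F_ε(μ) = inf_{ρ ∈ P(Ω)} I_c(ρ,μ) + F(ρ)` -/
def moreauC {d : ℕ} (Ω : Set (Euc d)) (F : Measure (Euc d) → ℝ≥0∞)
    (c : Euc d → Euc d → ℝ) (μ : Measure (Euc d)) : ℝ≥0∞ :=
  ⨅ (ρ : Measure (Euc d)) (_ : IsProbabilityMeasure ρ ∧ ρ Ωᶜ = 0), Icost c ρ μ + F ρ

/-- the `c`-transform `ψ^c = inf_x [c(x,·) − ψ(x)]` -/
def ctrans {d : ℕ} (c : Euc d → Euc d → ℝ) (ψ : Euc d → ℝ) (y : Euc d) : ℝ :=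
  ⨅ x : Euc d, (c x y - ψ x)

/-- a function is `c`-concave when it is the `c`-transform of a (bounded continuous)
function -/
def CConcave {d : ℕ} (c : Euc d → Euc d → ℝ) (φ : Euc d → ℝ) : Prop :=
  ∃ ψ : Euc d → ℝ, Continuous ψ ∧ (∃ M : ℝ, ∀ x, |ψ x| ≤ M) ∧ φ = ctrans c ψ

/-- Legendre transform of `F` in the duality between `M(Ω)` and `C⁰(Ω)`:
`F*(ψ) = sup_ρ [∫ ψ dρ − F(ρ)]`. -/
def legendre {d : ℕ} (Ω : Set (Euc d)) (F : Measure (Euc d) → ℝ≥0∞)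
    (ψ : Euc d → ℝ) : EReal :=
  ⨆ (ρ : Measure (Euc d)) (_ : IsFiniteMeasure ρ ∧ ρ Ωᶜ = 0),
    (((∫ x, ψ x ∂ρ : ℝ) : EReal) - ((F ρ : ℝ≥0∞) : EReal))

/-- `φ ∈ ∂F(ρ)`, the subdifferential of `F` at `ρ` for this duality -/
def InSubdiff {d : ℕ} (Ω : Set (Euc d)) (F : Measure (Euc d) → ℝ≥0∞)
    (ρ : Measure (Euc d)) (φ : Euc d → ℝ) : Prop :=
  ∀ σ : Measure (Euc d), IsFiniteMeasure σ → σ Ωᶜ = 0 →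
    ((F ρ : ℝ≥0∞) : EReal) + ((∫ x, φ x ∂σ - ∫ x, φ x ∂ρ : ℝ) : EReal)
      ≤ ((F σ : ℝ≥0∞) : EReal)

/-- `(φ, ψ)` is a pair of Kantorovich potentials for the transport from `μ` to `ρ`
(for the cost `c`): admissible and attaining the optimal cost. -/
def IsKantorovichPair {d : ℕ} (c : Euc d → Euc d → ℝ) (μ ρ : Measure (Euc d))
    (φ ψ : Euc d → ℝ) : Prop :=
  (∀ x y : Euc d, ψ x + φ y ≤ c x y) ∧
  (((∫ y, φ y ∂μ + ∫ x, ψ x ∂ρ : ℝ) : EReal) = ((Icost c ρ μ : ℝ≥0∞) : EReal))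

/-- the value of the dual problem at `φ`: `∫ φ dμ − F*(−φ^c)` -/
def dualVal {d : ℕ} (Ω : Set (Euc d)) (F : Measure (Euc d) → ℝ≥0∞)
    (c : Euc d → Euc d → ℝ) (μ : Measure (Euc d)) (φ : Euc d → ℝ) : EReal :=
  ((∫ x, φ x ∂μ : ℝ) : EReal) - legendre Ω F (fun y => - ctrans c φ y)


lemma abs_min_sep {ι X : Type*} [Fintype ι] [Nonempty ι] [Nonempty X]
    (f : ι → X → ℝ) (t : ℝ)
    (hconv : ∀ x y : X, ∀ a b : ℝ, 0 ≤ a → 0 ≤ b → a + b = 1 →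
      ∃ z, ∀ i, f i z ≤ a * f i x + b * f i y)
    (hno : ∀ x, ∃ i, t ≤ f i x) :
    ∃ p : ι → ℝ, (∀ i, 0 ≤ p i) ∧ ∑ i, p i = 1 ∧ ∀ x, t ≤ ∑ i, p i * f i x := by
  classical
  set C : Set (ι → ℝ) := {v | ∃ x, ∀ i, f i x < v i} with hC
  have hCo : IsOpen C := by
    have : C = ⋃ x, ⋂ i, {v : ι → ℝ | f i x < v i} := by
      ext v; simp [hC]
    rw [this]
    refine isOpen_iUnion fun x => isOpen_iInter_of_finite fun i => ?_
    exact isOpen_lt continuous_const (continuous_apply i)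
  have hCc : Convex ℝ C := by
    rintro v ⟨x, hx⟩ w ⟨y, hy⟩ a b ha hb hab
    obtain ⟨z, hz⟩ := hconv x y a b ha hb hab
    refine ⟨z, fun i => (hz i).trans_lt ?_⟩
    simp only [Pi.add_apply, Pi.smul_apply, smul_eq_mul]
    rcases ha.eq_or_lt with h | h
    · have hb1 : b = 1 := by linarith
      subst h; subst hb1; simpa using hy i
    · have h1 := mul_lt_mul_of_pos_left (hx i) h
      have h2 := mul_le_mul_of_nonneg_left (hy i).le hb
      linarith
  have hCt : (fun _ : ι => t) ∉ C := by
    rintro ⟨x, hx⟩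
    obtain ⟨i, hi⟩ := hno x
    exact absurd (hx i) (not_lt.2 hi)
  obtain ⟨g, hg⟩ := geometric_hahn_banach_open_point hCc hCo hCt
  have hgv : ∀ v : ι → ℝ, g v = ∑ i, v i * g (Pi.single i 1) := by
    intro v
    conv_lhs => rw [← LinearMap.sum_single_apply (fun _ => ℝ) v]
    rw [map_sum]
    refine Finset.sum_congr rfl fun i _ => ?_
    have : (LinearMap.single ℝ (fun _ => ℝ) i) (v i) = v i • (Pi.single i (1:ℝ) : ι → ℝ) := by
      ext j; by_cases h : j = i
      · subst h; simp
      · simp [h]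
    rw [LinearMap.single_apply] at this
    rw [this, map_smul, smul_eq_mul]
  set q : ι → ℝ := fun i => - g (Pi.single i 1) with hq
  obtain ⟨x0⟩ := ‹Nonempty X›
  have hv0 : (fun i => f i x0 + 1) ∈ C := ⟨x0, fun i => by simp⟩
  have hqpos : ∀ i, 0 ≤ q i := by
    intro i
    by_contra hneg
    push Not at hneg
    -- move far in direction i
    set v0 : ι → ℝ := fun i => f i x0 + 1
    have key : ∀ n : ℕ, g v0 + n * (- q i) < g (fun _ => t) := by
      intro n
      have hmem : v0 + (n:ℝ) • Pi.single i (1:ℝ) ∈ C := by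
        refine ⟨x0, fun j => ?_⟩
        have : (0:ℝ) ≤ n * (Pi.single i (1:ℝ) : ι → ℝ) j := by
          by_cases h : j = i
          · subst h; simp
          · simp [h]
        simp only [Pi.add_apply, Pi.smul_apply, smul_eq_mul, v0]
        linarith
      have := hg _ hmem
      rw [map_add, map_smul, smul_eq_mul] at this
      simpa [hq] using this
    obtain ⟨n, hn⟩ := exists_nat_gt ((g (fun _ => t) - g v0) / (- q i))
    have := key n
    rw [div_lt_iff₀ (by linarith)] at hn
    linarith
  have hq' : ∀ v ∈ C, t * ∑ i, q i < ∑ i, q i * v i := by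
    intro v hv
    have := hg v hv
    rw [hgv v, hgv (fun _ => t)] at this
    simp only [hq]
    have e1 : ∑ i, -g (Pi.single i 1) * v i = - ∑ i, v i * g (Pi.single i 1) := by
      rw [← Finset.sum_neg_distrib]; exact Finset.sum_congr rfl fun i _ => by ring
    have e2 : t * ∑ i, -g (Pi.single i 1) = - ∑ i, t * g (Pi.single i 1) := by
      rw [Finset.mul_sum, ← Finset.sum_neg_distrib]; exact Finset.sum_congr rfl fun i _ => by ring
    rw [e1, e2]; linarith
  have hsum : 0 < ∑ i, q i := by
    refine lt_of_le_of_ne (Finset.sum_nonneg fun i _ => hqpos i) fun h => ?_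
    have hz := (Finset.sum_eq_zero_iff_of_nonneg (fun i _ => hqpos i)).1 h.symm
    have := hq' _ hv0
    rw [← h, Finset.sum_eq_zero (fun i hi => by rw [hz i hi, zero_mul])] at this
    simp at this
  refine ⟨fun i => q i / ∑ j, q j, fun i => div_nonneg (hqpos i) hsum.le, ?_, fun x => ?_⟩
  · rw [← Finset.sum_div, div_self hsum.ne']
  · have hle : t * ∑ i, q i ≤ ∑ i, q i * f i x := by
      refine le_of_forall_pos_le_add fun δ hδ => ?_
      have := hq' (fun i => f i x + δ / ∑ j, q j) ⟨x, fun i => by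
        have : 0 < δ / ∑ j, q j := div_pos hδ hsum
        linarith⟩
      simp only [mul_add, Finset.sum_add_distrib] at this
      rw [← Finset.sum_mul, mul_div_cancel₀ _ hsum.ne'] at this
      exact this.le
    have : ∑ i, q i / (∑ j, q j) * f i x = (∑ i, q i * f i x) / ∑ j, q j := by
      rw [Finset.sum_div]; exact Finset.sum_congr rfl fun i _ => by ring
    rw [this, le_div_iff₀ hsum]; exact hle

/-- `FiniteMeasure` over a separable metrizable space is first countable. -/
lemma fm_firstCountable {X : Type*} [TopologicalSpace X] [TopologicalSpace.PseudoMetrizableSpace X]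
    [TopologicalSpace.SeparableSpace X] [MeasurableSpace X] [BorelSpace X] [Nonempty X] :
    FirstCountableTopology (FiniteMeasure X) := by
  refine ⟨fun σ => ?_⟩
  by_cases h0 : σ = 0
  · subst h0
    have : 𝓝 (0 : FiniteMeasure X) = comap (fun σ : FiniteMeasure X => σ.mass) (𝓝 0) := by
      refine le_antisymm ?_ ?_
      · rw [← tendsto_iff_comap]
        simpa using FiniteMeasure.continuous_mass.tendsto (0 : FiniteMeasure X)
      · exact FiniteMeasure.tendsto_zero_of_tendsto_zero_mass (μs := id) tendsto_comap
    rw [this]; infer_instance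
  · have : 𝓝 σ = comap (fun σ : FiniteMeasure X => (σ.normalize, σ.mass))
        (𝓝 (σ.normalize, σ.mass)) := by
      refine le_antisymm ?_ ?_
      · rw [← tendsto_iff_comap]
        have := (FiniteMeasure.tendsto_normalize_iff_tendsto (μs := id) h0).2 tendsto_id
        exact this.1.prodMk_nhds this.2
      · have h := tendsto_comap (f := fun σ : FiniteMeasure X => (σ.normalize, σ.mass))
          (x := 𝓝 (σ.normalize, σ.mass))
        refine tendsto_id'.1
          ((FiniteMeasure.tendsto_normalize_iff_tendsto (μs := id) h0).1 ⟨?_, ?_⟩)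
        · exact (continuous_fst.tendsto (σ.normalize, σ.mass)).comp h
        · exact (continuous_snd.tendsto (σ.normalize, σ.mass)).comp h
    rw [this]; infer_instance

lemma lsc_lintegral_fm {X : Type*} [TopologicalSpace X] [MeasurableSpace X]
    [OpensMeasurableSpace X] (k : X → ℝ) (hk : Continuous k) :
    LowerSemicontinuous fun π : FiniteMeasure X => ∫⁻ p, ENNReal.ofReal (k p) ∂(π : Measure X) := by
  have hc : Continuous fun p => (k p).toNNReal := continuous_real_toNNReal.comp hk
  let g : ℕ → BoundedContinuousFunction X ℝ≥0 := fun n =>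
    BoundedContinuousFunction.mkOfBound ⟨fun p => min (k p).toNNReal n, hc.min continuous_const⟩
      n (fun x y => by
        simp only [ContinuousMap.coe_mk]
        rw [NNReal.dist_eq, abs_le]
        have h1 : ((min (k x).toNNReal n : ℝ≥0) : ℝ) ≤ n := by exact_mod_cast min_le_right _ _
        have h2 : ((min (k y).toNNReal n : ℝ≥0) : ℝ) ≤ n := by exact_mod_cast min_le_right _ _
        have h3 := (min (k x).toNNReal (n:ℝ≥0)).coe_nonneg
        have h4 := (min (k y).toNNReal (n:ℝ≥0)).coe_nonneg
        constructor <;> linarith)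
  have : (fun π : FiniteMeasure X => ∫⁻ p, ENNReal.ofReal (k p) ∂(π : Measure X))
      = fun π => ⨆ n, ((π.testAgainstNN (g n) : ℝ≥0) : ℝ≥0∞) := by
    funext π
    simp only [FiniteMeasure.testAgainstNN_coe_eq]
    rw [← lintegral_iSup]
    · refine lintegral_congr fun p => ?_
      refine le_antisymm ?_ (iSup_le fun n => ?_)
      · obtain ⟨n, hn⟩ := exists_nat_ge (k p).toNNReal
        refine le_iSup_of_le n ?_
        change ((k p).toNNReal : ℝ≥0∞) ≤ ((min (k p).toNNReal (n:ℝ≥0) : ℝ≥0) : ℝ≥0∞)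
        rw [min_eq_left hn]
      · change ((min (k p).toNNReal (n:ℝ≥0) : ℝ≥0) : ℝ≥0∞) ≤ ((k p).toNNReal : ℝ≥0∞)
        exact_mod_cast min_le_left _ _
    · intro n
      exact (ENNReal.continuous_coe.comp (g n).continuous).measurable
    · intro n m hnm p
      change ((min (k p).toNNReal (n:ℝ≥0) : ℝ≥0) : ℝ≥0∞) ≤ ((min (k p).toNNReal (m:ℝ≥0) : ℝ≥0) : ℝ≥0∞)
      have : (n:ℝ≥0) ≤ m := by exact_mod_cast hnm
      exact_mod_cast min_le_min_left _ this
  rw [this]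
  exact lowerSemicontinuous_iSup fun n =>
    (ENNReal.continuous_coe.comp (FiniteMeasure.continuous_testAgainstNN_eval (g n))).lowerSemicontinuous

lemma cost_nonneg {d : ℕ} {ε : ℝ} (hε : 0 < ε) (x y : Euc d) : 0 ≤ cost ε x y := by
  unfold cost; positivity

lemma cost_self {d : ℕ} (ε : ℝ) (x : Euc d) : cost ε x x = 0 := by
  simp [cost]

lemma cost_comm {d : ℕ} (ε : ℝ) (x y : Euc d) : cost ε x y = cost ε y x := by
  simp [cost, norm_sub_rev]

lemma cost_continuous {d : ℕ} (ε : ℝ) : Continuous fun p : Euc d × Euc d => cost ε p.1 p.2 := by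
  unfold cost; fun_prop

lemma ctrans_bdd {d : ℕ} {ε : ℝ} (hε : 0 < ε) {g : Euc d → ℝ} {M : ℝ} (hg : ∀ x, |g x| ≤ M)
    (y : Euc d) : BddBelow (range fun x => cost ε x y - g x) :=
  ⟨-M, by
    rintro _ ⟨x, rfl⟩
    have := cost_nonneg hε x y
    have := (abs_le.1 (hg x)).2
    simp only; linarith⟩

lemma ctrans_le {d : ℕ} {ε : ℝ} (hε : 0 < ε) {g : Euc d → ℝ} {M : ℝ} (hg : ∀ x, |g x| ≤ M)
    (x y : Euc d) : ctrans (cost ε) g y ≤ cost ε x y - g x :=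
  ciInf_le (ctrans_bdd hε hg y) x

lemma ctrans_abs {d : ℕ} {ε : ℝ} (hε : 0 < ε) {g : Euc d → ℝ} {M : ℝ} (hg : ∀ x, |g x| ≤ M)
    (y : Euc d) : |ctrans (cost ε) g y| ≤ M := by
  rw [abs_le]
  constructor
  · refine le_ciInf fun x => ?_
    have := cost_nonneg hε x y
    have := (abs_le.1 (hg x)).2
    linarith
  · have := ctrans_le hε hg y y
    rw [cost_self] at this
    have := (abs_le.1 (hg y)).1
    linarith

lemma ctrans_continuous {d : ℕ} {ε : ℝ} (hε : 0 < ε) {g : Euc d → ℝ} {M : ℝ}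
    (hg : ∀ x, |g x| ≤ M) : Continuous (ctrans (cost ε) g) := by
  have hconv : ConvexOn ℝ univ fun y : Euc d => ‖y‖ ^ 2 / (2 * ε) - ctrans (cost ε) g y := by
    refine ⟨convex_univ, fun y _ z _ a b ha hb hab => ?_⟩
    simp only [smul_eq_mul]
    have key : ‖a • y + b • z‖ ^ 2 / (2 * ε) - (a * (‖y‖ ^ 2 / (2 * ε) - ctrans (cost ε) g y)
        + b * (‖z‖ ^ 2 / (2 * ε) - ctrans (cost ε) g z)) ≤ ctrans (cost ε) g (a • y + b • z) := by
      refine le_ciInf fun x => ?_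
      have h1 := mul_le_mul_of_nonneg_left (ctrans_le hε hg x y) ha
      have h2 := mul_le_mul_of_nonneg_left (ctrans_le hε hg x z) hb
      have id1 : ∀ w : Euc d, cost ε x w - ‖w‖ ^ 2 / (2 * ε)
          = (‖x‖ ^ 2 - 2 * inner ℝ x w) / (2 * ε) := by
        intro w; unfold cost; rw [norm_sub_sq_real]; ring
      have e1 := id1 y
      have e2 := id1 z
      have e3 := id1 (a • y + b • z)
      rw [inner_add_right, inner_smul_right, inner_smul_right] at e3
      have hb' : b = 1 - a := by linarith
      have e4 : (‖x‖ ^ 2 - 2 * (a * inner ℝ x y + b * inner ℝ x z)) / (2 * ε)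
          = a * ((‖x‖ ^ 2 - 2 * inner ℝ x y) / (2 * ε))
            + b * ((‖x‖ ^ 2 - 2 * inner ℝ x z) / (2 * ε)) := by
        subst hb'; ring
      rw [e4, ← e1, ← e2] at e3
      have e5 : a * g x + b * g x = g x := by rw [← add_mul, hab, one_mul]
      nlinarith
    linarith
  have hc := hconv.continuousOn isOpen_univ
  rw [continuousOn_univ] at hc
  have : ctrans (cost ε) g = fun y : Euc d => ‖y‖ ^ 2 / (2 * ε)
      - (‖y‖ ^ 2 / (2 * ε) - ctrans (cost ε) g y) := by funext y; ring
  rw [this]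
  exact (by fun_prop : Continuous fun y : Euc d => ‖y‖ ^ 2 / (2 * ε)).sub hc

lemma bc_integrable {d : ℕ} {f : Euc d → ℝ} (hf : Continuous f) {M : ℝ} (hM : ∀ x, |f x| ≤ M)
    (ν : Measure (Euc d)) [IsFiniteMeasure ν] : Integrable f ν :=
  Integrable.of_bound hf.aestronglyMeasurable M (Eventually.of_forall fun x => by simpa using hM x)

/-- weak duality for transport -/
lemma weak_transport {d : ℕ} {ε : ℝ} (hε : 0 < ε) (μ ρ : Measure (Euc d))
    [IsProbabilityMeasure μ] [IsProbabilityMeasure ρ] {φ : Euc d → ℝ} {M : ℝ}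
    (hφ : Continuous φ) (hM : ∀ x, |φ x| ≤ M) :
    ((∫ y, φ y ∂μ + ∫ x, ctrans (cost ε) φ x ∂ρ : ℝ) : EReal)
      ≤ ((Icost (cost ε) ρ μ : ℝ≥0∞) : EReal) := by
  have hb := ctrans_abs hε hM
  have hcc := ctrans_continuous hε hM
  set ψ := ctrans (cost ε) φ with hψ
  have hreal : ENNReal.ofReal (∫ y, φ y ∂μ + ∫ x, ψ x ∂ρ) ≤ Icost (cost ε) ρ μ := by
    refine le_iInf₂ fun π hπ => ?_
    obtain ⟨h1, h2⟩ := hπ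
    have : IsFiniteMeasure π := ⟨by
      rw [← preimage_univ (f := Prod.fst), ← Measure.map_apply measurable_fst MeasurableSet.univ, h1]
      simp⟩
    have e1 : ∫ y, φ y ∂μ = ∫ p, φ p.2 ∂π := by
      rw [← h2, integral_map measurable_snd.aemeasurable hφ.aestronglyMeasurable]
    have e2 : ∫ y, ψ y ∂ρ = ∫ p, ψ p.1 ∂π := by
      rw [← h1, integral_map measurable_fst.aemeasurable hcc.aestronglyMeasurable]
    have i1 : Integrable (fun p : Euc d × Euc d => φ p.2) π :=
      Integrable.of_bound (hφ.comp continuous_snd).aestronglyMeasurable M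
        (Eventually.of_forall fun x => by simpa using hM x.2)
    have i2 : Integrable (fun p : Euc d × Euc d => ψ p.1) π :=
      Integrable.of_bound (hcc.comp continuous_fst).aestronglyMeasurable M
        (Eventually.of_forall fun x => by simpa using hb x.1)
    by_cases htop : ∫⁻ p, ENNReal.ofReal (cost ε p.1 p.2) ∂π = ⊤
    · rw [htop]; exact le_top
    have ic : Integrable (fun p : Euc d × Euc d => cost ε p.1 p.2) π := by
      refine ⟨(cost_continuous ε).aestronglyMeasurable, ?_⟩
      rw [hasFiniteIntegral_iff_ofReal (Eventually.of_forall fun p => cost_nonneg hε _ _)]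
      exact lt_top_iff_ne_top.2 htop
    rw [← ofReal_integral_eq_lintegral_ofReal ic (Eventually.of_forall fun p => cost_nonneg hε _ _)]
    refine ENNReal.ofReal_le_ofReal ?_
    rw [e1, e2, ← integral_add i1 i2]
    refine integral_mono (i1.add i2) ic fun p => ?_
    have := ctrans_le hε hM p.2 p.1
    rw [cost_comm] at this
    simp only; linarith
  calc ((∫ y, φ y ∂μ + ∫ x, ψ x ∂ρ : ℝ) : EReal)
      ≤ ((ENNReal.ofReal (∫ y, φ y ∂μ + ∫ x, ψ x ∂ρ) : ℝ≥0∞) : EReal) := by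
        rw [EReal.coe_ennreal_ofReal]; exact_mod_cast le_max_left _ _
    _ ≤ _ := by exact_mod_cast hreal

abbrev TestPair (d : ℕ) : Type :=
  BoundedContinuousFunction (Euc d) ℝ × BoundedContinuousFunction (Euc d) ℝ

abbrev PlanPair (d : ℕ) : Type := FiniteMeasure (Euc d × Euc d) × FiniteMeasure (Euc d)

def Gfun {d : ℕ} (F : Measure (Euc d) → ℝ≥0∞) (k : Euc d × Euc d → ℝ) (x : PlanPair d) : ℝ≥0∞ :=
  ∫⁻ p, ENNReal.ofReal (k p) ∂(x.1 : Measure (Euc d × Euc d)) + F (x.2 : Measure (Euc d))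

def bfst {d : ℕ} (f : BoundedContinuousFunction (Euc d) ℝ) :
    BoundedContinuousFunction (Euc d × Euc d) ℝ :=
  f.compContinuous ⟨Prod.fst, continuous_fst⟩

def bsnd {d : ℕ} (f : BoundedContinuousFunction (Euc d) ℝ) :
    BoundedContinuousFunction (Euc d × Euc d) ℝ :=
  f.compContinuous ⟨Prod.snd, continuous_snd⟩

def linf {d : ℕ} (μ : FiniteMeasure (Euc d)) (x : PlanPair d) (l : TestPair d) : ℝ :=
  (∫ p, bfst l.1 p ∂(x.1 : Measure (Euc d × Euc d)) - ∫ p, bsnd l.2 p ∂(x.1 : Measure (Euc d × Euc d)))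
    + ∫ y, l.2 y ∂(μ : Measure (Euc d)) - ∫ y, l.1 y ∂(x.2 : Measure (Euc d))

lemma linf_add {d : ℕ} (μ : FiniteMeasure (Euc d)) (x : PlanPair d) (l m : TestPair d) :
    linf μ x (l + m) = linf μ x l + linf μ x m := by
  unfold linf
  have e1 : ∫ p, bfst (l + m).1 p ∂(x.1 : Measure (Euc d × Euc d))
      = ∫ p, bfst l.1 p ∂(x.1 : Measure (Euc d × Euc d))
        + ∫ p, bfst m.1 p ∂(x.1 : Measure (Euc d × Euc d)) :=
    integral_add ((bfst l.1).integrable _) ((bfst m.1).integrable _)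
  have e2 : ∫ p, bsnd (l + m).2 p ∂(x.1 : Measure (Euc d × Euc d))
      = ∫ p, bsnd l.2 p ∂(x.1 : Measure (Euc d × Euc d))
        + ∫ p, bsnd m.2 p ∂(x.1 : Measure (Euc d × Euc d)) :=
    integral_add ((bsnd l.2).integrable _) ((bsnd m.2).integrable _)
  have e3 : ∫ p, (l + m).2 p ∂(μ : Measure (Euc d))
      = ∫ p, l.2 p ∂(μ : Measure (Euc d)) + ∫ p, m.2 p ∂(μ : Measure (Euc d)) :=
    integral_add (l.2.integrable _) (m.2.integrable _)
  have e4 : ∫ p, (l + m).1 p ∂(x.2 : Measure (Euc d))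
      = ∫ p, l.1 p ∂(x.2 : Measure (Euc d)) + ∫ p, m.1 p ∂(x.2 : Measure (Euc d)) :=
    integral_add (l.1.integrable _) (m.1.integrable _)
  rw [e1, e2, e3, e4]; ring

lemma linf_smul {d : ℕ} (μ : FiniteMeasure (Euc d)) (x : PlanPair d) (a : ℝ) (l : TestPair d) :
    linf μ x (a • l) = a * linf μ x l := by
  unfold linf
  have e1 : ∫ p, bfst (a • l).1 p ∂(x.1 : Measure (Euc d × Euc d))
      = a * ∫ p, bfst l.1 p ∂(x.1 : Measure (Euc d × Euc d)) := integral_const_mul _ _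
  have e2 : ∫ p, bsnd (a • l).2 p ∂(x.1 : Measure (Euc d × Euc d))
      = a * ∫ p, bsnd l.2 p ∂(x.1 : Measure (Euc d × Euc d)) := integral_const_mul _ _
  have e3 : ∫ p, (a • l).2 p ∂(μ : Measure (Euc d))
      = a * ∫ p, l.2 p ∂(μ : Measure (Euc d)) := integral_const_mul _ _
  have e4 : ∫ p, (a • l).1 p ∂(x.2 : Measure (Euc d))
      = a * ∫ p, l.1 p ∂(x.2 : Measure (Euc d)) := integral_const_mul _ _
  rw [e1, e2, e3, e4]; ring

def lin {d : ℕ} (μ : FiniteMeasure (Euc d)) (x : PlanPair d) : TestPair d →ₗ[ℝ] ℝ where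
  toFun := linf μ x
  map_add' := linf_add μ x
  map_smul' := linf_smul μ x

lemma lin_apply {d : ℕ} (μ : FiniteMeasure (Euc d)) (x : PlanPair d) (l : TestPair d) :
    lin μ x l = linf μ x l := rfl

lemma lin_continuous {d : ℕ} (μ : FiniteMeasure (Euc d)) (l : TestPair d) :
    Continuous fun x : PlanPair d => lin μ x l := by
  simp only [lin_apply, linf]
  have h1 := (FiniteMeasure.continuous_integral_boundedContinuousFunction (bfst l.1)).comp
    (continuous_fst (X := FiniteMeasure (Euc d × Euc d)) (Y := FiniteMeasure (Euc d)))
  have h2 := (FiniteMeasure.continuous_integral_boundedContinuousFunction (bsnd l.2)).comp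
    (continuous_fst (X := FiniteMeasure (Euc d × Euc d)) (Y := FiniteMeasure (Euc d)))
  have h3 := (FiniteMeasure.continuous_integral_boundedContinuousFunction l.1).comp
    (continuous_snd (X := FiniteMeasure (Euc d × Euc d)) (Y := FiniteMeasure (Euc d)))
  exact ((h1.sub h2).add continuous_const).sub h3

lemma fm_integral_comb {X : Type*} [TopologicalSpace X] [MeasurableSpace X]
    [OpensMeasurableSpace X] (a b : ℝ≥0) (π σ : FiniteMeasure X)
    (f : BoundedContinuousFunction X ℝ) :
    ∫ p, f p ∂((a • π + b • σ : FiniteMeasure X) : Measure X)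
      = a * ∫ p, f p ∂(π : Measure X) + b * ∫ p, f p ∂(σ : Measure X) := by
  rw [FiniteMeasure.toMeasure_add, FiniteMeasure.toMeasure_smul, FiniteMeasure.toMeasure_smul]
  rw [integral_add_measure, integral_smul_nnreal_measure, integral_smul_nnreal_measure]
  · simp [NNReal.smul_def]
  · exact (f.integrable _).smul_measure_nnreal
  · exact (f.integrable _).smul_measure_nnreal

lemma lin_comb {d : ℕ} (μ : FiniteMeasure (Euc d)) (x y : PlanPair d) (a b : ℝ≥0)
    (hab : a + b = 1) (l : TestPair d) :
    lin μ (a • x.1 + b • y.1, a • x.2 + b • y.2) l = a * lin μ x l + b * lin μ y l := by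
  simp only [lin_apply, linf, fm_integral_comb]
  have : (a : ℝ) + b = 1 := by exact_mod_cast hab
  linear_combination -(this) * (∫ y, l.2 y ∂(μ : Measure (Euc d)))

lemma Gfun_comb {d : ℕ} (F : Measure (Euc d) → ℝ≥0∞)
    (hFconv : ∀ ρ σ : Measure (Euc d), ∀ a b : ℝ≥0∞, a + b = 1 →
      F (a • ρ + b • σ) ≤ a * F ρ + b * F σ)
    (k : Euc d × Euc d → ℝ) (x y : PlanPair d) (a b : ℝ≥0) (hab : a + b = 1) :
    Gfun F k (a • x.1 + b • y.1, a • x.2 + b • y.2) ≤ a * Gfun F k x + b * Gfun F k y := by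
  unfold Gfun
  have hF := hFconv x.2 y.2 a b (by exact_mod_cast hab)
  have e : ((a • x.2 + b • y.2 : FiniteMeasure (Euc d)) : Measure (Euc d))
      = (a : ℝ≥0∞) • (x.2 : Measure (Euc d)) + (b : ℝ≥0∞) • (y.2 : Measure (Euc d)) := by
    rw [FiniteMeasure.toMeasure_add, FiniteMeasure.toMeasure_smul, FiniteMeasure.toMeasure_smul]
    rfl
  have e' : ((a • x.1 + b • y.1 : FiniteMeasure (Euc d × Euc d)) : Measure (Euc d × Euc d))
      = (a : ℝ≥0∞) • (x.1 : Measure (Euc d × Euc d)) + (b : ℝ≥0∞) • (y.1 : Measure (Euc d × Euc d)) := by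
    rw [FiniteMeasure.toMeasure_add, FiniteMeasure.toMeasure_smul, FiniteMeasure.toMeasure_smul]
    rfl
  simp only [e, e', lintegral_add_measure, lintegral_smul_measure, smul_eq_mul]
  calc _ ≤ _ := add_le_add_right hF _
    _ = _ := by ring

lemma Gfun_lsc {d : ℕ} (F : Measure (Euc d) → ℝ≥0∞)
    (hFlsc : ∀ (ρ : ℕ → Measure (Euc d)) (σ : Measure (Euc d)),
      (∀ n, IsFiniteMeasure (ρ n)) → IsFiniteMeasure σ →
      (∀ f : BoundedContinuousFunction (Euc d) ℝ,
        Tendsto (fun n => ∫ x, f x ∂(ρ n)) atTop (𝓝 (∫ x, f x ∂σ))) →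
      F σ ≤ liminf (fun n => F (ρ n)) atTop)
    (k : Euc d × Euc d → ℝ) (hk : Continuous k) : LowerSemicontinuous (Gfun F k) := by
  have hF : LowerSemicontinuous fun σ : FiniteMeasure (Euc d) => F (σ : Measure (Euc d)) := by
    have := fm_firstCountable (X := Euc d)
    rw [lowerSemicontinuous_iff_isClosed_preimage]
    intro r
    refine IsSeqClosed.isClosed fun u σ hu hlim => ?_
    refine (hFlsc (fun n => (u n : Measure (Euc d))) σ (fun n => inferInstance) inferInstance
      (FiniteMeasure.tendsto_iff_forall_integral_tendsto.1 hlim)).trans ?_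
    refine (liminf_le_liminf (v := fun _ => r) (Eventually.of_forall fun n => hu n)).trans ?_
    simp
  exact ((lsc_lintegral_fm k hk).comp continuous_fst).add (hF.comp continuous_snd)

def Aset {d : ℕ} (F : Measure (Euc d) → ℝ≥0∞) (k : Euc d × Euc d → ℝ) (μ : FiniteMeasure (Euc d))
    (l : TestPair d) (t : ℝ) : Set (PlanPair d) :=
  {x | lin μ x l ≤ t} ∩ {x | Gfun F k x ≤ ENNReal.ofReal (t - lin μ x l)}

lemma Aset_closed {d : ℕ} (F : Measure (Euc d) → ℝ≥0∞) (k : Euc d × Euc d → ℝ)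
    (hG : LowerSemicontinuous (Gfun F k)) (μ : FiniteMeasure (Euc d))
    (l : TestPair d) (t : ℝ) : IsClosed (Aset F k μ l t) := by
  have hl := lin_continuous μ l
  refine (isClosed_le hl continuous_const).inter ?_
  have hc : Continuous fun x : PlanPair d => (x, ENNReal.ofReal (t - lin μ x l)) :=
    continuous_id.prodMk (ENNReal.continuous_ofReal.comp (continuous_const.sub hl))
  exact hG.isClosed_epigraph.preimage hc

lemma mem_Aset_iff {d : ℕ} (F : Measure (Euc d) → ℝ≥0∞) (k : Euc d × Euc d → ℝ)
    (μ : FiniteMeasure (Euc d)) (l : TestPair d) (t : ℝ) (x : PlanPair d) :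
    x ∈ Aset F k μ l t ↔ Gfun F k x ≠ ⊤ ∧ (Gfun F k x).toReal + lin μ x l ≤ t := by
  constructor
  · rintro ⟨h1, h2⟩
    have h1' : lin μ x l ≤ t := h1
    have h2' : Gfun F k x ≤ ENNReal.ofReal (t - lin μ x l) := h2
    refine ⟨ne_top_of_le_ne_top ENNReal.ofReal_ne_top h2', ?_⟩
    have := ENNReal.toReal_le_of_le_ofReal (by linarith) h2'
    linarith
  · rintro ⟨h1, h2⟩
    have h0 : 0 ≤ (Gfun F k x).toReal := ENNReal.toReal_nonneg
    refine ⟨?_, ?_⟩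
    · change lin μ x l ≤ t
      linarith
    · change Gfun F k x ≤ ENNReal.ofReal (t - lin μ x l)
      rw [← ENNReal.ofReal_toReal h1]
      exact ENNReal.ofReal_le_ofReal (by linarith)

lemma Aset_mono {d : ℕ} (F : Measure (Euc d) → ℝ≥0∞) (k : Euc d × Euc d → ℝ)
    (μ : FiniteMeasure (Euc d)) (l : TestPair d) {s t : ℝ} (hst : s ≤ t) :
    Aset F k μ l s ⊆ Aset F k μ l t := by
  intro x hx
  rw [mem_Aset_iff] at hx ⊢
  exact ⟨hx.1, hx.2.trans hst⟩

/-- The coercive multiplier gives a compact sublevel set. -/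
lemma Aset_compact {d : ℕ} (Ω : Set (Euc d)) (hΩc : IsCompact Ω) (F : Measure (Euc d) → ℝ≥0∞)
    (hFsupp : ∀ ρ : Measure (Euc d), F ρ ≠ ⊤ → ρ Ωᶜ = 0)
    (k : Euc d × Euc d → ℝ) (hk : Continuous k)
    (hkc : ∀ r : ℝ, IsCompact {p | k p ≤ r}) (μ : FiniteMeasure (Euc d)) (t : ℝ) :
    ∃ S : Set (PlanPair d), IsCompact S ∧ ∃ l : TestPair d, Aset F k μ l t ⊆ S := by
  let l : TestPair d := (BoundedContinuousFunction.const _ (-1), BoundedContinuousFunction.const _ (-2))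
  set C : ℝ≥0 := (t + 2 * μ.mass).toNNReal with hC
  let K : ℕ → Set (Euc d × Euc d) := fun n => {p | k p ≤ n + 1}
  let u : ℕ → ℝ≥0 := fun n => C / (n + 1)
  have hu : Tendsto u atTop (𝓝 0) := by
    have := (tendsto_one_div_add_atTop_nhds_zero_nat (𝕜 := ℝ≥0)).const_mul C
    simpa [u, div_eq_mul_inv] using this
  refine ⟨{π | π.mass ≤ C ∧ ∀ n, π (K n)ᶜ ≤ u n} ×ˢ {σ | σ.mass ≤ C ∧ σ Ωᶜ = 0}, ?_, l, ?_⟩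
  · refine IsCompact.prod ?_ ?_
    · exact isCompact_setOfPred_finiteMeasure_mass_le_compl_isCompact_le C hu (fun n => hkc _)
        (Or.inl inferInstance)
    · exact isCompact_setOfPred_finiteMeasure_le_of_isCompact C hΩc
  · intro x hx
    rw [mem_Aset_iff] at hx
    obtain ⟨hG, hle⟩ := hx
    have hlin : lin μ x l = x.1.mass - 2 * μ.mass + x.2.mass := by
      have c1 : ∀ p, bfst l.1 p = -1 := fun p => rfl
      have c2 : ∀ p, bsnd l.2 p = -2 := fun p => rfl
      have c3 : ∀ p, l.1 p = -1 := fun p => rfl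
      have c4 : ∀ p, l.2 p = -2 := fun p => rfl
      simp only [lin_apply, linf, c1, c2, c3, c4, integral_const, smul_eq_mul]
      have m1 : (x.1 : Measure (Euc d × Euc d)).real univ = x.1.mass := rfl
      have m2 : (x.2 : Measure (Euc d)).real univ = x.2.mass := rfl
      have m3 : (μ : Measure (Euc d)).real univ = μ.mass := rfl
      rw [m1, m2, m3]; ring
    rw [hlin] at hle
    have hG0 : 0 ≤ (Gfun F k x).toReal := ENNReal.toReal_nonneg
    have n1 := x.1.mass.coe_nonneg
    have n2 := x.2.mass.coe_nonneg
    have hCr : (C : ℝ) = t + 2 * μ.mass := Real.coe_toNNReal _ (by linarith)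
    have hFt : F x.2 ≠ ⊤ := fun h => hG (by simp [Gfun, h])
    refine ⟨⟨?_, fun n => ?_⟩, ?_, ?_⟩
    · rw [← NNReal.coe_le_coe, hCr]; linarith
    · have hI : ∫⁻ p, ENNReal.ofReal (k p) ∂(x.1 : Measure (Euc d × Euc d)) ≤ (C : ℝ≥0∞) := by
        refine (le_add_right le_rfl : _ ≤ Gfun F k x).trans ?_
        change Gfun F k x ≤ _
        rw [← ENNReal.ofReal_toReal hG, ← ENNReal.ofReal_coe_nnreal]
        exact ENNReal.ofReal_le_ofReal (by rw [hCr]; linarith)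
      have hmk := mul_meas_ge_le_lintegral (μ := (x.1 : Measure (Euc d × Euc d)))
        (f := fun p => ENNReal.ofReal (k p)) (ENNReal.continuous_ofReal.comp hk).measurable
        ((n + 1 : ℝ≥0) : ℝ≥0∞)
      have hsub : (K n)ᶜ ⊆ {p | ((n + 1 : ℝ≥0) : ℝ≥0∞) ≤ ENNReal.ofReal (k p)} := by
        intro p hp
        have hp' : ¬ k p ≤ n + 1 := hp
        push Not at hp'
        change ((n + 1 : ℝ≥0) : ℝ≥0∞) ≤ ENNReal.ofReal (k p)
        rw [← ENNReal.ofReal_coe_nnreal]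
        refine ENNReal.ofReal_le_ofReal ?_
        push_cast; exact hp'.le
      have h3 : ((n + 1 : ℝ≥0) : ℝ≥0∞) * (x.1 : Measure (Euc d × Euc d)) (K n)ᶜ ≤ C :=
        (mul_le_mul_right (measure_mono hsub) _).trans (hmk.trans hI)
      rw [← FiniteMeasure.ennreal_coeFn_eq_coeFn_toMeasure] at h3
      have h4 : (n + 1 : ℝ≥0) * x.1 (K n)ᶜ ≤ C := by exact_mod_cast h3
      rw [le_div_iff₀ (by positivity), mul_comm]
      exact h4
    · rw [← NNReal.coe_le_coe, hCr]; linarith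
    · rw [FiniteMeasure.null_iff_toMeasure_null]
      exact hFsupp _ hFt

lemma exists_feasible {d : ℕ} (Ω : Set (Euc d)) (hΩc : IsCompact Ω) (F : Measure (Euc d) → ℝ≥0∞)
    (hFsupp : ∀ ρ : Measure (Euc d), F ρ ≠ ⊤ → ρ Ωᶜ = 0)
    (k : Euc d × Euc d → ℝ) (hk : Continuous k) (hG : LowerSemicontinuous (Gfun F k))
    (hkc : ∀ r : ℝ, IsCompact {p | k p ≤ r}) (μ : FiniteMeasure (Euc d)) (s : ℝ)
    (hfin : ∀ u : Finset (TestPair d), ∀ t > s, ∃ x, ∀ l ∈ u, x ∈ Aset F k μ l t) :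
    0 ≤ s ∧ ∃ x, Gfun F k x ≤ ENNReal.ofReal s ∧ ∀ l, lin μ x l = 0 := by
  classical
  obtain ⟨S, hS, l0, hl0⟩ := Aset_compact Ω hΩc F hFsupp k hk hkc μ (s + 1)
  obtain ⟨x, -, hx⟩ := hS.inter_iInter_nonempty
    (fun i : TestPair d × {t : ℝ // s < t} => Aset F k μ i.1 i.2)
    (fun i => Aset_closed F k hG μ _ _) (by
      intro u
      have h1 : ∀ᶠ t : ℝ in 𝓝[>] s, ∀ i ∈ u, t ≤ (i.2 : ℝ) := by
        rw [eventually_all_finset]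
        intro i _
        exact mem_of_superset (Ioc_mem_nhdsGT i.2.2) fun t ht => ht.2
      have h2 : ∀ᶠ t in 𝓝[>] s, t ∈ Ioc s (s + 1) := Ioc_mem_nhdsGT (by linarith)
      obtain ⟨t, ht1, ht2⟩ := (h1.and h2).exists
      obtain ⟨x, hx⟩ := hfin (insert l0 (u.image Prod.fst)) t ht2.1
      refine ⟨x, hl0 (Aset_mono F k μ l0 ht2.2 (hx l0 (by simp))), ?_⟩
      simp only [mem_iInter]
      intro i hi
      exact Aset_mono F k μ i.1 (ht1 i hi)
        (hx i.1 (Finset.mem_insert_of_mem (Finset.mem_image_of_mem _ hi))))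
  simp only [mem_iInter, mem_Aset_iff] at hx
  have hGt : Gfun F k x ≠ ⊤ := (hx ⟨0, s + 1, by linarith⟩).1
  have hle : ∀ l, (Gfun F k x).toReal + lin μ x l ≤ s := fun l =>
    le_of_forall_gt_imp_ge_of_dense fun t ht => (hx ⟨l, t, ht⟩).2
  have hG0 : 0 ≤ (Gfun F k x).toReal := ENNReal.toReal_nonneg
  have hle0 : ∀ l, lin μ x l ≤ 0 := by
    intro l
    by_contra hpos
    push Not at hpos
    obtain ⟨n, hn⟩ := exists_nat_gt (s / lin μ x l)
    rw [div_lt_iff₀ hpos] at hn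
    have := hle ((n : ℝ) • l)
    rw [map_smul, smul_eq_mul] at this
    linarith
  refine ⟨?_, x, ?_, fun l => le_antisymm (hle0 l) ?_⟩
  · have := hle 0
    rw [map_zero] at this
    linarith
  · rw [← ENNReal.ofReal_toReal hGt]
    refine ENNReal.ofReal_le_ofReal ?_
    have := hle 0
    rw [map_zero] at this
    linarith
  · have := hle0 (-l)
    rw [map_neg] at this
    linarith

lemma exists_multiplier {d : ℕ} (F : Measure (Euc d) → ℝ≥0∞)
    (hFconv : ∀ ρ σ : Measure (Euc d), ∀ a b : ℝ≥0∞, a + b = 1 →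
      F (a • ρ + b • σ) ≤ a * F ρ + b * F σ)
    (k : Euc d × Euc d → ℝ) (μ : FiniteMeasure (Euc d)) (hne : ∃ x, Gfun F k x ≠ ⊤)
    (u : Finset (TestPair d)) (t : ℝ) (hno : ¬ ∃ x, ∀ l ∈ u, x ∈ Aset F k μ l t) :
    ∃ l : TestPair d, ∀ x, Gfun F k x ≠ ⊤ → t ≤ (Gfun F k x).toReal + lin μ x l := by
  classical
  have hu : u.Nonempty := by
    by_contra h
    rw [Finset.not_nonempty_iff_eq_empty] at h
    subst h
    exact hno ⟨hne.choose, by simp⟩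
  have : Nonempty u := hu.coe_sort
  have : Nonempty {x : PlanPair d // Gfun F k x ≠ ⊤} := ⟨⟨_, hne.choose_spec⟩⟩
  obtain ⟨p, -, hp1, hp⟩ := abs_min_sep
    (fun (i : u) (x : {x : PlanPair d // Gfun F k x ≠ ⊤}) =>
      (Gfun F k x.1).toReal + lin μ x.1 i.1) t
    (by
      rintro ⟨x, hx⟩ ⟨y, hy⟩ a b ha hb hab
      lift a to ℝ≥0 using ha
      lift b to ℝ≥0 using hb
      have hab' : a + b = 1 := by exact_mod_cast hab
      have hc := Gfun_comb F hFconv k x y a b hab'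
      have hfin : (a : ℝ≥0∞) * Gfun F k x + b * Gfun F k y ≠ ⊤ :=
        ENNReal.add_ne_top.2 ⟨ENNReal.mul_ne_top ENNReal.coe_ne_top hx,
          ENNReal.mul_ne_top ENNReal.coe_ne_top hy⟩
      refine ⟨⟨_, ne_top_of_le_ne_top hfin hc⟩, fun i => ?_⟩
      simp only [lin_comb μ x y a b hab']
      have h2 := ENNReal.toReal_mono hfin hc
      rw [ENNReal.toReal_add (ENNReal.mul_ne_top ENNReal.coe_ne_top hx)
          (ENNReal.mul_ne_top ENNReal.coe_ne_top hy), ENNReal.toReal_mul, ENNReal.toReal_mul,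
          ENNReal.coe_toReal, ENNReal.coe_toReal] at h2
      linarith)
    (by
      rintro ⟨x, hx⟩
      by_contra hcon
      push Not at hcon
      exact hno ⟨x, fun l hl => (mem_Aset_iff F k μ l t x).2 ⟨hx, (hcon ⟨l, hl⟩).le⟩⟩)
  refine ⟨∑ i, p i • i.1, fun x hx => ?_⟩
  have := hp ⟨x, hx⟩
  simp only [mul_add, Finset.sum_add_distrib, ← Finset.sum_mul, hp1, one_mul] at this
  simpa [map_sum, map_smul] using this

/-- the auxiliary coercive cost -/
def kcost {d : ℕ} (ε : ℝ) (Ω : Set (Euc d)) (p : Euc d × Euc d) : ℝ :=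
  cost ε p.1 p.2 + Metric.infDist p.1 Ω

lemma kcost_continuous {d : ℕ} (ε : ℝ) (Ω : Set (Euc d)) : Continuous (kcost ε Ω) :=
  (cost_continuous ε).add ((Metric.continuous_infDist_pt Ω).comp continuous_fst)

lemma kcost_compact {d : ℕ} {ε : ℝ} (hε : 0 < ε) {Ω : Set (Euc d)} (hΩc : IsCompact Ω)
    (hne : Ω.Nonempty) (r : ℝ) : IsCompact {p | kcost ε Ω p ≤ r} := by
  refine Metric.isCompact_of_isClosed_isBounded
    (isClosed_le (kcost_continuous ε Ω) continuous_const) ?_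
  obtain ⟨R, hR⟩ := hΩc.isBounded.exists_norm_le
  rw [isBounded_iff_forall_norm_le]
  have key : ∀ p : Euc d × Euc d, kcost ε Ω p ≤ r → ‖p.1‖ ≤ R + r ∧
      ‖p.2‖ ≤ R + r + (1 + 2 * ε * r) := by
    intro p hp
    unfold kcost at hp
    have h1 := cost_nonneg hε p.1 p.2
    have h2 : 0 ≤ Metric.infDist p.1 Ω := Metric.infDist_nonneg
    obtain ⟨z, hz, hzd⟩ := hΩc.exists_infDist_eq_dist hne p.1
    have h3 : ‖p.1‖ ≤ R + r := by
      have := norm_le_norm_add_norm_sub' p.1 z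
      rw [hzd, dist_eq_norm] at hp
      have := hR z hz
      linarith
    refine ⟨h3, ?_⟩
    have h4 : ‖p.1 - p.2‖ ^ 2 ≤ 2 * ε * r := by
      have : cost ε p.1 p.2 ≤ r := by linarith
      unfold cost at this
      rw [div_le_iff₀ (by positivity)] at this
      linarith
    have h5 : ‖p.1 - p.2‖ ≤ 1 + 2 * ε * r := by nlinarith [sq_nonneg (‖p.1 - p.2‖ - 1)]
    have := norm_le_norm_add_norm_sub p.1 p.2
    linarith
  refine ⟨max (R + r) (R + r + (1 + 2 * ε * r)), fun p hp => ?_⟩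
  obtain ⟨h1, h2⟩ := key p hp
  exact max_le_max h1 h2

lemma lintegral_kcost {d : ℕ} {ε : ℝ} {Ω : Set (Euc d)} (hΩm : MeasurableSet Ω)
    {π : Measure (Euc d × Euc d)} (hπ : (π.map Prod.fst) Ωᶜ = 0) :
    ∫⁻ p, ENNReal.ofReal (kcost ε Ω p) ∂π = ∫⁻ p, ENNReal.ofReal (cost ε p.1 p.2) ∂π := by
  refine lintegral_congr_ae ?_
  rw [Measure.map_apply measurable_fst hΩm.compl] at hπ
  filter_upwards [measure_eq_zero_iff_ae_notMem.1 hπ] with p hp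
  have hpΩ : p.1 ∈ Ω := by simpa using hp
  simp [kcost, Metric.infDist_zero_of_mem hpΩ]

/-- a pair killed by all multipliers is a coupling -/
lemma coupling_of_lin {d : ℕ} {μ : FiniteMeasure (Euc d)} {x : PlanPair d}
    (h : ∀ l, lin μ x l = 0) :
    (x.1 : Measure (Euc d × Euc d)).map Prod.fst = x.2 ∧
      (x.1 : Measure (Euc d × Euc d)).map Prod.snd = μ := by
  constructor
  · refine ext_of_forall_integral_eq_of_IsFiniteMeasure fun f => ?_
    rw [integral_map measurable_fst.aemeasurable f.continuous.aestronglyMeasurable]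
    have := h (f, 0)
    simp only [lin_apply, linf, bfst, bsnd] at this
    simp at this
    linarith
  · refine ext_of_forall_integral_eq_of_IsFiniteMeasure fun f => ?_
    rw [integral_map measurable_snd.aemeasurable f.continuous.aestronglyMeasurable]
    have := h (0, f)
    simp only [lin_apply, linf, bfst, bsnd] at this
    simp at this
    linarith

lemma lin_of_coupling {d : ℕ} {μ : FiniteMeasure (Euc d)} {x : PlanPair d}
    (h1 : (x.1 : Measure (Euc d × Euc d)).map Prod.fst = x.2)
    (h2 : (x.1 : Measure (Euc d × Euc d)).map Prod.snd = μ) (l : TestPair d) :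
    lin μ x l = 0 := by
  simp only [lin_apply, linf, bfst, bsnd]
  rw [← h1, ← h2, integral_map measurable_fst.aemeasurable l.1.continuous.aestronglyMeasurable,
    integral_map measurable_snd.aemeasurable l.2.continuous.aestronglyMeasurable]
  simp

lemma primal_of_feasible {d : ℕ} {ε : ℝ} (Ω : Set (Euc d)) (hΩm : MeasurableSet Ω)
    (F : Measure (Euc d) → ℝ≥0∞)
    (hFsupp : ∀ ρ : Measure (Euc d), F ρ ≠ ⊤ → ρ Ωᶜ = 0)
    (μ : FiniteMeasure (Euc d)) (hμ : IsProbabilityMeasure (μ : Measure (Euc d))) (s : ℝ)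
    (h : ∃ x, Gfun F (kcost ε Ω) x ≤ ENNReal.ofReal s ∧ ∀ l, lin μ x l = 0) :
    ∃ ρ : Measure (Euc d), IsProbabilityMeasure ρ ∧ ρ Ωᶜ = 0 ∧
      Icost (cost ε) ρ μ + F ρ ≤ ENNReal.ofReal s := by
  obtain ⟨x, hx, hl⟩ := h
  obtain ⟨h1, h2⟩ := coupling_of_lin hl
  have hF : F x.2 ≠ ⊤ := by
    refine ne_top_of_le_ne_top ENNReal.ofReal_ne_top (le_trans ?_ hx)
    exact le_add_left le_rfl
  have h0 := hFsupp _ hF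
  refine ⟨x.2, ⟨?_⟩, h0, le_trans (add_le_add_left ?_ _) hx⟩
  · rw [← h1, Measure.map_apply measurable_fst MeasurableSet.univ]
    have := hμ.measure_univ
    rw [← h2, Measure.map_apply measurable_snd MeasurableSet.univ] at this
    simpa using this
  · rw [lintegral_kcost hΩm (by rw [h1]; exact h0)]
    exact iInf₂_le_of_le _ ⟨h1, h2⟩ le_rfl

lemma legendre_mono {d : ℕ} (Ω : Set (Euc d)) (hΩm : MeasurableSet Ω) (F : Measure (Euc d) → ℝ≥0∞)
    {f g : Euc d → ℝ} (hf : Continuous f) (hg : Continuous g) {M N : ℝ} (hM : ∀ x, |f x| ≤ M)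
    (hN : ∀ x, |g x| ≤ N) (hfg : ∀ x ∈ Ω, f x ≤ g x) : legendre Ω F f ≤ legendre Ω F g := by
  refine iSup₂_mono fun ρ hρ => ?_
  have := hρ.1
  refine EReal.sub_le_sub ?_ le_rfl
  rw [EReal.coe_le_coe_iff]
  refine integral_mono_ae (bc_integrable hf hM ρ) (bc_integrable hg hN ρ) ?_
  filter_upwards [measure_eq_zero_iff_ae_notMem.1 hρ.2] with x hx
  exact hfg x (by simpa using hx)

lemma kcost_eq_of_mem {d : ℕ} (ε : ℝ) {Ω : Set (Euc d)} {x : Euc d} (hx : x ∈ Ω) (y : Euc d) :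
    kcost ε Ω (x, y) = cost ε x y := by
  simp [kcost, Metric.infDist_zero_of_mem hx]

lemma multiplier_pointwise {d : ℕ} {ε : ℝ} (hε : 0 < ε) (Ω : Set (Euc d))
    (F : Measure (Euc d) → ℝ≥0∞) (ρ0 : FiniteMeasure (Euc d)) (hρ0 : F ρ0 ≠ ⊤)
    (μ : FiniteMeasure (Euc d)) (t : ℝ) (l : TestPair d)
    (hl : ∀ x, Gfun F (kcost ε Ω) x ≠ ⊤ → t ≤ (Gfun F (kcost ε Ω) x).toReal + lin μ x l)
    (x y : Euc d) : l.2 y ≤ kcost ε Ω (x, y) + l.1 x := by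
  have hk0 : 0 ≤ kcost ε Ω (x, y) := add_nonneg (cost_nonneg hε _ _) Metric.infDist_nonneg
  set B : ℝ := (F ρ0).toReal + ∫ y, l.2 y ∂(μ : Measure (Euc d)) - ∫ y, l.1 y ∂(ρ0 : Measure (Euc d))
    with hB
  have key : ∀ n : ℕ, t ≤ n * (kcost ε Ω (x, y) + l.1 x - l.2 y) + B := by
    intro n
    let δ : FiniteMeasure (Euc d × Euc d) := ⟨Measure.dirac (x, y), inferInstance⟩
    have eδ : (((n : ℝ≥0) • δ : FiniteMeasure (Euc d × Euc d)) : Measure (Euc d × Euc d))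
        = (n : ℝ≥0) • Measure.dirac (x, y) := FiniteMeasure.toMeasure_smul _ _
    have hGv : Gfun F (kcost ε Ω) ((n : ℝ≥0) • δ, ρ0)
        = ENNReal.ofReal (n * kcost ε Ω (x, y)) + F ρ0 := by
      unfold Gfun
      simp only [eδ]
      rw [lintegral_smul_measure, lintegral_dirac, ENNReal.ofReal_mul (by positivity)]
      simp [ENNReal.smul_def]
    have hGt : Gfun F (kcost ε Ω) ((n : ℝ≥0) • δ, ρ0) ≠ ⊤ := by
      rw [hGv]; exact ENNReal.add_ne_top.2 ⟨ENNReal.ofReal_ne_top, hρ0⟩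
    have h := hl _ hGt
    rw [hGv, ENNReal.toReal_add ENNReal.ofReal_ne_top hρ0, ENNReal.toReal_ofReal (by positivity)] at h
    simp only [lin_apply, linf, eδ] at h
    rw [integral_smul_nnreal_measure, integral_smul_nnreal_measure, integral_dirac,
      integral_dirac] at h
    have b1 : bfst l.1 (x, y) = l.1 x := rfl
    have b2 : bsnd l.2 (x, y) = l.2 y := rfl
    rw [b1, b2] at h
    simp only [NNReal.smul_def, NNReal.coe_natCast, smul_eq_mul] at h
    rw [hB]; linarith
  by_contra hneg
  push Not at hneg
  obtain ⟨n, hn⟩ := exists_nat_gt ((B - t) / (l.2 y - (kcost ε Ω (x, y) + l.1 x)))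
  rw [div_lt_iff₀ (by linarith)] at hn
  have := key n
  linarith

lemma multiplier_legendre {d : ℕ} {ε : ℝ} (Ω : Set (Euc d))
    (F : Measure (Euc d) → ℝ≥0∞)
    (μ : FiniteMeasure (Euc d)) (t : ℝ) (l : TestPair d)
    (hl : ∀ x, Gfun F (kcost ε Ω) x ≠ ⊤ → t ≤ (Gfun F (kcost ε Ω) x).toReal + lin μ x l) :
    legendre Ω F l.1 ≤ ((∫ y, l.2 y ∂(μ : Measure (Euc d)) - t : ℝ) : EReal) := by
  refine iSup₂_le fun σ hσ => ?_
  have := hσ.1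
  by_cases hF : F σ = ⊤
  · rw [hF]; simp
  let σ' : FiniteMeasure (Euc d) := ⟨σ, hσ.1⟩
  have hGv : Gfun F (kcost ε Ω) (0, σ') = F σ := by
    simp [Gfun, σ']
  have h := hl (0, σ') (by rw [hGv]; exact hF)
  rw [hGv] at h
  simp only [lin_apply, linf] at h
  have e0 : ((0 : FiniteMeasure (Euc d × Euc d)) : Measure (Euc d × Euc d)) = 0 := rfl
  have e1 : (σ' : Measure (Euc d)) = σ := rfl
  rw [e0, e1, integral_zero_measure, integral_zero_measure] at h
  rw [← EReal.coe_ennreal_toReal hF, ← EReal.coe_sub, EReal.coe_le_coe_iff]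
  linarith

lemma dual_ge {d : ℕ} {ε : ℝ} (hε : 0 < ε)
    (Ω : Set (Euc d)) (hΩc : IsCompact Ω) (hΩmeas : MeasurableSet Ω) (hΩne : Ω.Nonempty)
    (F : Measure (Euc d) → ℝ≥0∞)
    (hFconv : ∀ ρ σ : Measure (Euc d), ∀ a b : ℝ≥0∞, a + b = 1 →
      F (a • ρ + b • σ) ≤ a * F ρ + b * F σ)
    (hFlsc : ∀ (ρ : ℕ → Measure (Euc d)) (σ : Measure (Euc d)),
      (∀ n, IsFiniteMeasure (ρ n)) → IsFiniteMeasure σ →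
      (∀ f : BoundedContinuousFunction (Euc d) ℝ,
        Tendsto (fun n => ∫ x, f x ∂(ρ n)) atTop (𝓝 (∫ x, f x ∂σ))) →
      F σ ≤ liminf (fun n => F (ρ n)) atTop)
    (hFsupp : ∀ ρ : Measure (Euc d), F ρ ≠ ⊤ → ρ Ωᶜ = 0)
    (hFproper : ∃ ρ : Measure (Euc d), IsProbabilityMeasure ρ ∧ ρ Ωᶜ = 0 ∧ F ρ ≠ ⊤)
    (μ : Measure (Euc d)) (hμ : IsProbabilityMeasure μ) (s : ℝ)
    (hs : (s : EReal) < ((moreauC Ω F (cost ε) μ : ℝ≥0∞) : EReal)) :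
    ∃ φ, CConcave (cost ε) φ ∧ (s : EReal) ≤ dualVal Ω F (cost ε) μ φ := by
  obtain ⟨ρ0, hρ0p, hρ0Ω, hρ0F⟩ := hFproper
  let μ' : FiniteMeasure (Euc d) := ⟨μ, inferInstance⟩
  let ρ' : FiniteMeasure (Euc d) := ⟨ρ0, inferInstance⟩
  have hG := Gfun_lsc F hFlsc (kcost ε Ω) (kcost_continuous ε Ω)
  have hnot : ¬ ∀ u : Finset (TestPair d), ∀ t > s, ∃ x, ∀ l ∈ u, x ∈ Aset F (kcost ε Ω) μ' l t := by
    intro hfin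
    obtain ⟨hs0, hx⟩ := exists_feasible Ω hΩc F hFsupp (kcost ε Ω) (kcost_continuous ε Ω) hG
      (kcost_compact hε hΩc hΩne) μ' s hfin
    obtain ⟨ρ, hρ, hρΩ, hle⟩ := primal_of_feasible Ω hΩmeas F hFsupp μ' hμ s hx
    have h1 : moreauC Ω F (cost ε) μ ≤ ENNReal.ofReal s := le_trans (iInf₂_le ρ ⟨hρ, hρΩ⟩) hle
    have h2 : ((moreauC Ω F (cost ε) μ : ℝ≥0∞) : EReal) ≤ ((ENNReal.ofReal s : ℝ≥0∞) : EReal) := by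
      exact_mod_cast h1
    rw [EReal.coe_ennreal_ofReal, max_eq_left hs0] at h2
    exact absurd hs (not_lt.2 h2)
  push Not at hnot
  obtain ⟨u, t, hst, hno⟩ := hnot
  obtain ⟨l, hl⟩ := exists_multiplier F hFconv (kcost ε Ω) μ'
    ⟨(0, ρ'), by simpa [Gfun, ρ'] using hρ0F⟩ u t (by push Not; exact hno)
  have hpt := multiplier_pointwise hε Ω F ρ' hρ0F μ' t l hl
  have hleg := multiplier_legendre Ω F μ' t l hl
  obtain ⟨ψ, g⟩ := l
  simp only at hpt hleg
  have hgb : ∀ x, |g x| ≤ ‖g‖ := fun x => g.norm_coe_le_norm x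
  have hψb : ∀ x, |ψ x| ≤ ‖ψ‖ := fun x => ψ.norm_coe_le_norm x
  have hgcb := ctrans_abs hε hgb
  have hgcc := ctrans_continuous hε hgb
  set gc := ctrans (cost ε) g with hgc
  have hφb := ctrans_abs hε hgcb
  have hφc := ctrans_continuous hε hgcb
  set φ := ctrans (cost ε) gc with hφ
  refine ⟨φ, ⟨gc, hgcc, ⟨_, hgcb⟩, rfl⟩, ?_⟩
  have hφcb := ctrans_abs hε hφb
  have hφcc := ctrans_continuous hε hφb
  have hge : ∀ y, g y ≤ φ y := by
    intro y
    refine le_ciInf fun x => ?_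
    have := ctrans_le hε hgb y x
    rw [cost_comm] at this
    rw [hgc]; linarith
  have hle : ∀ x ∈ Ω, - ctrans (cost ε) φ x ≤ ψ x := by
    intro x hx
    have h1 : -ψ x ≤ gc x := by
      refine le_ciInf fun y => ?_
      have := hpt x y
      rw [kcost_eq_of_mem ε hx, cost_comm] at this
      linarith
    have h2 : gc x ≤ ctrans (cost ε) φ x := by
      refine le_ciInf fun y => ?_
      have := ctrans_le hε hgcb x y
      rw [cost_comm] at this
      rw [hφ]; linarith
    linarith
  have hL : legendre Ω F (fun y => - ctrans (cost ε) φ y) ≤ legendre Ω F ψ :=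
    legendre_mono Ω hΩmeas F hφcc.neg ψ.continuous (fun x => by rw [abs_neg]; exact hφcb x) hψb hle
  have hint : ∫ y, g y ∂μ ≤ ∫ y, φ y ∂μ :=
    integral_mono (bc_integrable g.continuous hgb μ) (bc_integrable hφc hφb μ) hge
  have e : ((∫ y, φ y ∂μ - (∫ y, g y ∂μ - t) : ℝ) : EReal) ≤ dualVal Ω F (cost ε) μ φ := by
    unfold dualVal
    rw [EReal.coe_sub]
    exact EReal.sub_le_sub le_rfl (hL.trans hleg)
  refine le_trans ?_ e
  rw [EReal.coe_le_coe_iff]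
  have : t > s := hst
  linarith

lemma primal_exists {d : ℕ} {ε : ℝ} (hε : 0 < ε)
    (Ω : Set (Euc d)) (hΩc : IsCompact Ω) (hΩmeas : MeasurableSet Ω) (hΩne : Ω.Nonempty)
    (F : Measure (Euc d) → ℝ≥0∞)
    (hFlsc : ∀ (ρ : ℕ → Measure (Euc d)) (σ : Measure (Euc d)),
      (∀ n, IsFiniteMeasure (ρ n)) → IsFiniteMeasure σ →
      (∀ f : BoundedContinuousFunction (Euc d) ℝ,
        Tendsto (fun n => ∫ x, f x ∂(ρ n)) atTop (𝓝 (∫ x, f x ∂σ))) →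
      F σ ≤ liminf (fun n => F (ρ n)) atTop)
    (hFsupp : ∀ ρ : Measure (Euc d), F ρ ≠ ⊤ → ρ Ωᶜ = 0)
    (hFproper : ∃ ρ : Measure (Euc d), IsProbabilityMeasure ρ ∧ ρ Ωᶜ = 0 ∧ F ρ ≠ ⊤)
    (μ : Measure (Euc d)) (hμ : IsProbabilityMeasure μ) :
    ∃ ρ : Measure (Euc d), IsProbabilityMeasure ρ ∧ ρ Ωᶜ = 0 ∧
      Icost (cost ε) ρ μ + F ρ = moreauC Ω F (cost ε) μ := by
  by_cases htop : moreauC Ω F (cost ε) μ = ⊤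
  · obtain ⟨ρ0, h1, h2, -⟩ := hFproper
    refine ⟨ρ0, h1, h2, ?_⟩
    rw [htop, ← top_le_iff, ← htop]
    exact iInf₂_le ρ0 ⟨h1, h2⟩
  let μ' : FiniteMeasure (Euc d) := ⟨μ, inferInstance⟩
  have hG := Gfun_lsc F hFlsc (kcost ε Ω) (kcost_continuous ε Ω)
  set s := (moreauC Ω F (cost ε) μ).toReal with hs
  obtain ⟨-, hx⟩ := exists_feasible Ω hΩc F hFsupp (kcost ε Ω) (kcost_continuous ε Ω) hG
    (kcost_compact hε hΩc hΩne) μ' s (by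
      intro u t ht
      have hlt : moreauC Ω F (cost ε) μ < ENNReal.ofReal t := by
        rw [← ENNReal.ofReal_toReal htop]
        exact (ENNReal.ofReal_lt_ofReal_iff (lt_of_le_of_lt ENNReal.toReal_nonneg ht)).2 ht
      unfold moreauC at hlt
      simp only [iInf_lt_iff] at hlt
      obtain ⟨ρ, ⟨hρ, hρΩ⟩, hlt⟩ := hlt
      unfold Icost at hlt
      rw [ENNReal.iInf_add] at hlt
      simp only [ENNReal.iInf_add, iInf_lt_iff] at hlt
      obtain ⟨π, ⟨h1, h2⟩, hlt⟩ := hlt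
      have hfin : IsFiniteMeasure π := ⟨by
        rw [← preimage_univ (f := Prod.fst),
          ← Measure.map_apply measurable_fst MeasurableSet.univ, h1]
        simp⟩
      let x : PlanPair d := (⟨π, hfin⟩, ⟨ρ, inferInstance⟩)
      refine ⟨x, fun l _ => ?_⟩
      have hGx : Gfun F (kcost ε Ω) x = ∫⁻ p, ENNReal.ofReal (cost ε p.1 p.2) ∂π + F ρ := by
        unfold Gfun
        have := lintegral_kcost (ε := ε) hΩmeas (π := π) (by rw [h1]; exact hρΩ)
        rw [← this]; rfl
      have hl0 : lin μ' x l = 0 := lin_of_coupling (μ := μ') (x := x) h1 h2 l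
      rw [mem_Aset_iff, hl0, add_zero, hGx]
      refine ⟨ne_top_of_lt hlt, ENNReal.toReal_le_of_le_ofReal
        (lt_of_le_of_lt ENNReal.toReal_nonneg ht).le hlt.le⟩)
  obtain ⟨ρ, hρ, hρΩ, hle⟩ := primal_of_feasible Ω hΩmeas F hFsupp μ' hμ s hx
  refine ⟨ρ, hρ, hρΩ, le_antisymm ?_ (iInf₂_le ρ ⟨hρ, hρΩ⟩)⟩
  rw [hs, ENNReal.ofReal_toReal htop] at hle
  exact hle

lemma weak_arith (A B : ℝ) (L : EReal) (I f : ℝ≥0∞)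
    (h1 : ((A + B : ℝ) : EReal) ≤ (I : EReal)) (h2 : ((-B : ℝ) : EReal) - (f : EReal) ≤ L) :
    (A : EReal) - L ≤ ((I + f : ℝ≥0∞) : EReal) := by
  by_cases hI : I = ⊤
  · simp [hI]
  by_cases hf : f = ⊤
  · simp [hf]
  lift I to ℝ≥0 using hI
  lift f to ℝ≥0 using hf
  have eI : (((I : ℝ≥0∞)) : EReal) = ((I : ℝ) : EReal) := rfl
  have ef : (((f : ℝ≥0∞)) : EReal) = ((f : ℝ) : EReal) := rfl
  rw [EReal.coe_ennreal_add, eI, ef]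
  rw [eI] at h1
  rw [ef] at h2
  induction L with
  | bot =>
    rw [← EReal.coe_sub] at h2
    exact absurd (le_bot_iff.1 h2) (EReal.coe_ne_bot _)
  | top => simp
  | coe l =>
    rw [← EReal.coe_sub] at h2 ⊢
    rw [← EReal.coe_add]
    rw [EReal.coe_le_coe_iff] at *
    linarith

lemma fwd_arith (A B : ℝ) (L : EReal) (I f : ℝ≥0∞)
    (h1 : ((A + B : ℝ) : EReal) ≤ (I : EReal)) (h2 : ((-B : ℝ) : EReal) - (f : EReal) ≤ L)
    (hL : L ≠ ⊥) (h : (A : EReal) - L = ((I + f : ℝ≥0∞) : EReal)) :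
    ((A + B : ℝ) : EReal) = (I : EReal) ∧ f ≠ ⊤ ∧ L = ((-B - f.toReal : ℝ) : EReal) := by
  induction L with
  | bot => exact absurd rfl hL
  | top =>
    rw [EReal.sub_top] at h
    exact absurd h.symm (EReal.coe_ennreal_ne_bot _)
  | coe l =>
    rw [← EReal.coe_sub] at h
    have hne : I + f ≠ ⊤ := by
      intro hh
      rw [hh, EReal.coe_ennreal_top] at h
      exact EReal.coe_ne_top _ h
    obtain ⟨hI, hf⟩ := ENNReal.add_ne_top.1 hne
    lift I to ℝ≥0 using hI
    lift f to ℝ≥0 using hf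
    have eI : (((I : ℝ≥0∞)) : EReal) = ((I : ℝ) : EReal) := rfl
    have ef : (((f : ℝ≥0∞)) : EReal) = ((f : ℝ) : EReal) := rfl
    rw [EReal.coe_ennreal_add, eI, ef, ← EReal.coe_add, EReal.coe_eq_coe_iff] at h
    rw [eI, EReal.coe_le_coe_iff] at h1
    rw [ef, ← EReal.coe_sub, EReal.coe_le_coe_iff] at h2
    refine ⟨?_, ENNReal.coe_ne_top, ?_⟩
    · rw [eI, EReal.coe_eq_coe_iff]; linarith
    · rw [EReal.coe_eq_coe_iff, ENNReal.coe_toReal]; linarith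

lemma legendre_ge {d : ℕ} (Ω : Set (Euc d)) (F : Measure (Euc d) → ℝ≥0∞) (g : Euc d → ℝ)
    (σ : Measure (Euc d)) (h1 : IsFiniteMeasure σ) (h2 : σ Ωᶜ = 0) :
    ((-∫ x, g x ∂σ : ℝ) : EReal) - ((F σ : ℝ≥0∞) : EReal) ≤ legendre Ω F (fun y => - g y) := by
  have := le_iSup₂ (f := fun (ρ : Measure (Euc d)) (_ : IsFiniteMeasure ρ ∧ ρ Ωᶜ = 0) =>
    (((∫ x, - g x ∂ρ : ℝ) : EReal) - ((F ρ : ℝ≥0∞) : EReal))) σ ⟨h1, h2⟩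
  rw [integral_neg] at this
  exact this
/-- **dual formulation of the Moreau envelope.** For any `μ ∈ P(ℝ^d)`,
`F_ε(μ) = sup {∫ φ dμ − F*(−φ^c) : φ c-concave}`, and the supremum is attained at a
`c`-concave `φ` if and only if, for any `ρ` optimal in the primal problem, `(φ, φ^c)` is
a pair of `c`-concave Kantorovich potentials from `μ` to `ρ` and `−φ^c ∈ ∂F(ρ)`. -/
theorem moreau_duality
    (d : ℕ) (ε : ℝ) (hε : 0 < ε)
    (Ω : Set (Euc d)) (hΩc : IsCompact Ω) (hΩmeas : MeasurableSet Ω) (hΩne : Ω.Nonempty)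
    (F : Measure (Euc d) → ℝ≥0∞)
    (hFconv : ∀ ρ σ : Measure (Euc d), ∀ a b : ℝ≥0∞, a + b = 1 →
      F (a • ρ + b • σ) ≤ a * F ρ + b * F σ)
    (hFlsc : ∀ (ρ : ℕ → Measure (Euc d)) (σ : Measure (Euc d)),
      (∀ n, IsFiniteMeasure (ρ n)) → IsFiniteMeasure σ →
      (∀ f : BoundedContinuousFunction (Euc d) ℝ,
        Tendsto (fun n => ∫ x, f x ∂(ρ n)) atTop (𝓝 (∫ x, f x ∂σ))) →
      F σ ≤ liminf (fun n => F (ρ n)) atTop)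
    (hFsupp : ∀ ρ : Measure (Euc d), F ρ ≠ ⊤ → ρ Ωᶜ = 0)
    (hFproper : ∃ ρ : Measure (Euc d), IsProbabilityMeasure ρ ∧ ρ Ωᶜ = 0 ∧ F ρ ≠ ⊤)
    (μ : Measure (Euc d)) (hμ : IsProbabilityMeasure μ)
    (hmom : ∫⁻ x, ENNReal.ofReal (‖x‖ ^ 2) ∂μ ≠ ⊤) :
    ((moreauC Ω F (cost ε) μ : ℝ≥0∞) : EReal)
        = ⨆ (φ : Euc d → ℝ) (_ : CConcave (cost ε) φ), dualVal Ω F (cost ε) μ φ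
    ∧ ∀ φ : Euc d → ℝ, CConcave (cost ε) φ →
      ((dualVal Ω F (cost ε) μ φ = ((moreauC Ω F (cost ε) μ : ℝ≥0∞) : EReal)) ↔
        (∀ ρ : Measure (Euc d), IsProbabilityMeasure ρ → ρ Ωᶜ = 0 →
          Icost (cost ε) ρ μ + F ρ = moreauC Ω F (cost ε) μ →
          IsKantorovichPair (cost ε) μ ρ φ (ctrans (cost ε) φ) ∧
          InSubdiff Ω F ρ (fun y => - ctrans (cost ε) φ y))) := by
  have cc : ∀ φ : Euc d → ℝ, CConcave (cost ε) φ → ∃ M : ℝ, Continuous φ ∧ ∀ x, |φ x| ≤ M := by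
    rintro φ ⟨ψ, -, ⟨M, hM⟩, rfl⟩
    exact ⟨M, ctrans_continuous hε hM, ctrans_abs hε hM⟩
  have weak : ∀ φ : Euc d → ℝ, CConcave (cost ε) φ → ∀ ρ : Measure (Euc d),
      IsProbabilityMeasure ρ → ρ Ωᶜ = 0 →
      dualVal Ω F (cost ε) μ φ ≤ ((Icost (cost ε) ρ μ + F ρ : ℝ≥0∞) : EReal) := by
    intro φ hφ ρ hρ hρΩ
    obtain ⟨M, hc, hM⟩ := cc φ hφ
    exact weak_arith _ _ _ _ _ (weak_transport hε μ ρ hc hM)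
      (legendre_ge Ω F (ctrans (cost ε) φ) ρ inferInstance hρΩ)
  obtain ⟨ρs, hρs, hρsΩ, hρsopt⟩ :=
    primal_exists hε Ω hΩc hΩmeas hΩne F hFlsc hFsupp hFproper μ hμ
  have weak' : ∀ φ : Euc d → ℝ, CConcave (cost ε) φ →
      dualVal Ω F (cost ε) μ φ ≤ ((moreauC Ω F (cost ε) μ : ℝ≥0∞) : EReal) := by
    intro φ hφ
    rw [← hρsopt]
    exact weak φ hφ ρs hρs hρsΩ
  refine ⟨le_antisymm ?_ (iSup₂_le weak'), fun φ hφ => ?_⟩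
  · refine le_of_forall_lt fun s hs => ?_
    obtain ⟨t, hst, ht⟩ := EReal.lt_iff_exists_real_btwn.1 hs
    obtain ⟨φ, hφ, hle⟩ := dual_ge hε Ω hΩc hΩmeas hΩne F hFconv hFlsc hFsupp hFproper μ hμ t ht
    exact lt_of_lt_of_le hst (hle.trans (le_iSup₂ (f := fun (φ : Euc d → ℝ)
      (_ : CConcave (cost ε) φ) => dualVal Ω F (cost ε) μ φ) φ hφ))
  obtain ⟨M, hc, hM⟩ := cc φ hφ
  obtain ⟨ρ0, hρ0, hρ0Ω, hρ0F⟩ := hFproper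
  constructor
  · intro heq ρ hρ hρΩ hopt
    have hLbot : legendre Ω F (fun y => - ctrans (cost ε) φ y) ≠ ⊥ := by
      intro hbot
      have h := legendre_ge Ω F (ctrans (cost ε) φ) ρ0 inferInstance hρ0Ω
      rw [hbot] at h
      lift F ρ0 to ℝ≥0 using hρ0F with f
      have ef : (((f : ℝ≥0∞)) : EReal) = ((f : ℝ) : EReal) := rfl
      rw [ef, ← EReal.coe_sub] at h
      exact EReal.coe_ne_bot _ (le_bot_iff.1 h)
    rw [← hopt] at heq
    obtain ⟨hk, hf, hL⟩ := fwd_arith _ _ _ _ _ (weak_transport hε μ ρ hc hM)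
      (legendre_ge Ω F (ctrans (cost ε) φ) ρ inferInstance hρΩ) hLbot heq
    refine ⟨⟨fun x y => ?_, hk⟩, fun σ hσ hσΩ => ?_⟩
    · have := ctrans_le hε hM y x
      rw [cost_comm] at this
      linarith
    · have h := legendre_ge Ω F (ctrans (cost ε) φ) σ hσ hσΩ
      rw [hL] at h
      rw [integral_neg, integral_neg]
      by_cases hσF : F σ = ⊤
      · rw [hσF]; simp
      generalize F ρ = a at hf h ⊢
      generalize F σ = b at hσF h ⊢
      lift a to ℝ≥0 using hf
      lift b to ℝ≥0 using hσF
      have ea : (((a : ℝ≥0∞)) : EReal) = ((a : ℝ) : EReal) := rfl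
      have eb : (((b : ℝ≥0∞)) : EReal) = ((b : ℝ) : EReal) := rfl
      rw [eb, ← EReal.coe_sub, EReal.coe_le_coe_iff, ENNReal.coe_toReal] at h
      rw [ea, eb, ← EReal.coe_add, EReal.coe_le_coe_iff]
      linarith
  · intro hall
    obtain ⟨⟨-, hk⟩, hsub⟩ := hall ρs hρs hρsΩ hρsopt
    refine le_antisymm (weak' φ hφ) ?_
    rw [← hρsopt]
    have hfin : F ρs ≠ ⊤ := by
      intro htop
      have h := hsub ρ0 inferInstance hρ0Ω
      rw [htop, EReal.coe_ennreal_top, EReal.top_add_coe, top_le_iff,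
        EReal.coe_ennreal_eq_top_iff] at h
      exact hρ0F h
    have hL : legendre Ω F (fun y => - ctrans (cost ε) φ y)
        ≤ ((-∫ x, ctrans (cost ε) φ x ∂ρs - (F ρs).toReal : ℝ) : EReal) := by
      refine iSup₂_le fun σ hσ => ?_
      have h := hsub σ hσ.1 hσ.2
      rw [integral_neg, integral_neg] at h
      rw [integral_neg]
      by_cases hσF : F σ = ⊤
      · rw [hσF]; simp
      generalize F ρs = a at hfin h ⊢
      generalize F σ = b at hσF h ⊢
      lift a to ℝ≥0 using hfin
      lift b to ℝ≥0 using hσF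
      have ea : (((a : ℝ≥0∞)) : EReal) = ((a : ℝ) : EReal) := rfl
      have eb : (((b : ℝ≥0∞)) : EReal) = ((b : ℝ) : EReal) := rfl
      rw [ea, eb, ← EReal.coe_add, EReal.coe_le_coe_iff] at h
      rw [eb, ← EReal.coe_sub, EReal.coe_le_coe_iff, ENNReal.coe_toReal]
      linarith
    unfold dualVal
    refine le_trans ?_ (EReal.sub_le_sub le_rfl hL)
    rw [EReal.coe_ennreal_add, ← hk, ← EReal.coe_ennreal_toReal hfin, ← EReal.coe_sub,
      ← EReal.coe_add, EReal.coe_le_coe_iff]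
    linarith

end
end
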